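/- arXiv:0911.4365 — 5 statements merged into one kernel-verified Lean document; each statement's English description precedes it below -/
import Mathlib

section
/- Let (Ω, F, (F_s)_{s≥0}, P) be a filtered probability space satisfying property (NP). Let (X_s)_{s≥0} be a nonnegative submartingale of class (Σ) with respect to (F_s)_{s≥0} and P, with X_s integrable for every s ≥ 0. Then there exists a unique σ-finite measure Q on (Ω, F) such that, setting g := sup{s ≥ 0 : X_s = 0}: (i) Q(g = ∞) = 0; and (ii) for all s ≥ 0 and all bounded F_s-measurable random variables F_s-functionals F, ∫ F·1_{g ≤ s} dQ = E_P[F · X_s]. -/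
open MeasureTheory Filter Set
open scoped NNReal ENNReal

/-- The atom of `ω` in a σ-algebra `m`: the intersection of all `m`-measurable sets
containing `ω`. -/
def sigmaAtom {Ω : Type} (m : MeasurableSpace Ω) (ω : Ω) : Set Ω :=
  ⋂₀ {B : Set Ω | MeasurableSet[m] B ∧ ω ∈ B}

/-- Property (P) for a filtered measurable space `(Ω, F, (𝓕 s)_{s ≥ 0})`:
`𝓕` is a filtration generating `F`, each `𝓕 s` is countably generated, each `𝓕 s` is the
σ-algebra of inverse images of Borel sets of a Polish space under a surjection separating
the points of `𝓕 s`, and finitely consistent sequences of atoms have nonempty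
intersection. -/
def PropertyP {Ω : Type} (F : MeasurableSpace Ω) (𝓕 : ℝ≥0 → MeasurableSpace Ω) : Prop :=
  Monotone 𝓕 ∧
  F = (⨆ s : ℝ≥0, 𝓕 s) ∧
  (∀ s : ℝ≥0, ∃ S : Set (Set Ω), S.Countable ∧ 𝓕 s = MeasurableSpace.generateFrom S) ∧
  (∀ s : ℝ≥0, ∃ (Ωs : Type) (τ : TopologicalSpace Ωs),
    @PolishSpace Ωs τ ∧
    ∃ π : Ω → Ωs, Function.Surjective π ∧
      𝓕 s = MeasurableSpace.comap π (@borel Ωs τ) ∧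
      (∀ B : Set Ω, MeasurableSet[𝓕 s] B → ∀ ω : Ω, π ω ∈ π '' B → ω ∈ B)) ∧
  (∀ ω : ℕ → Ω,
    (∀ N : ℕ, (⋂ n ∈ Finset.range (N + 1), sigmaAtom (𝓕 n) (ω n)).Nonempty) →
    (⋂ n : ℕ, sigmaAtom (𝓕 n) (ω n)).Nonempty)

/-- A filtered probability space `(Ω, F, (𝓕 s)_{s ≥ 0}, P)`. -/
structure FilteredProbabilitySpace (Ω : Type) where
  F : MeasurableSpace Ω
  𝓕 : ℝ≥0 → MeasurableSpace Ω
  mono : Monotone 𝓕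
  le : ∀ s : ℝ≥0, 𝓕 s ≤ F
  P : @MeasureTheory.Measure Ω F
  prob : @MeasureTheory.IsProbabilityMeasure Ω F P

/-- The natural conditions: the filtration is right-continuous and every subset of a
`P`-negligible set belonging to some `𝓕 s` belongs to `𝓕 0`. -/
def NaturalConditions {Ω : Type} (X : FilteredProbabilitySpace Ω) : Prop :=
  (∀ s : ℝ≥0, X.𝓕 s = ⨅ (t : ℝ≥0) (_ : s < t), X.𝓕 t) ∧
  (∀ s : ℝ≥0, ∀ A : Set Ω, MeasurableSet[X.𝓕 s] A → X.P A = 0 →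
    ∀ B ⊆ A, MeasurableSet[X.𝓕 0] B)

/-- `Y` extends `X`: the σ-algebras are larger and the measure of `Y` agrees with that of
`X` on the σ-algebra of `X`. -/
def ExtendsFPS {Ω : Type} (Y X : FilteredProbabilitySpace Ω) : Prop :=
  (∀ s : ℝ≥0, X.𝓕 s ≤ Y.𝓕 s) ∧ X.F ≤ Y.F ∧
  (∀ A : Set Ω, MeasurableSet[X.F] A → Y.P A = X.P A)

/-- `Y` is the natural enlargement of `X`: it is the smallest extension of `X` satisfying
the natural conditions. -/
def IsNaturalEnlargement {Ω : Type} (Y X : FilteredProbabilitySpace Ω) : Prop :=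
  ExtendsFPS Y X ∧ NaturalConditions Y ∧
  ∀ Z : FilteredProbabilitySpace Ω, ExtendsFPS Z X → NaturalConditions Z → ExtendsFPS Z Y

/-- Property (NP): the space is the natural enlargement of a filtered probability space
whose underlying filtered measurable space satisfies property (P). -/
def PropertyNP {Ω : Type} (Y : FilteredProbabilitySpace Ω) : Prop :=
  ∃ X : FilteredProbabilitySpace Ω, PropertyP X.F X.𝓕 ∧ IsNaturalEnlargement Y X

/-- A càdlàg martingale with respect to the filtration `Y.𝓕` and the probability `Y.P`. -/
def CadlagMartingale {Ω : Type} (Y : FilteredProbabilitySpace Ω) (N : ℝ≥0 → Ω → ℝ) : Prop :=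
  letI : MeasurableSpace Ω := Y.F
  (∀ s : ℝ≥0, Measurable[Y.𝓕 s] (N s)) ∧
  (∀ s : ℝ≥0, MeasureTheory.Integrable (N s) Y.P) ∧
  (∀ s t : ℝ≥0, s ≤ t → Y.P[N t | Y.𝓕 s] =ᵐ[Y.P] N s) ∧
  (∀ ω : Ω, ∀ s : ℝ≥0,
    Filter.Tendsto (fun u => N u ω) (nhdsWithin s (Set.Ici s)) (nhds (N s ω)) ∧
    ∃ l : ℝ, Filter.Tendsto (fun u => N u ω) (nhdsWithin s (Set.Iio s)) (nhds l))

/-- The process `X` is of class (Σ): `X = N + A` where `N` is a càdlàg martingale and `A` is a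
continuous increasing adapted process starting from `0` whose Stieltjes measure is carried by
`{s | X s = 0}` (i.e. `∫_0^∞ 1_{X_s ≠ 0} dA_s = 0` almost surely). -/
def IsClassSigma {Ω : Type} (Y : FilteredProbabilitySpace Ω)
    (X N A : ℝ≥0 → Ω → ℝ) : Prop :=
  (∀ s : ℝ≥0, ∀ ω : Ω, X s ω = N s ω + A s ω) ∧
  CadlagMartingale Y N ∧
  (∀ s : ℝ≥0, Measurable[Y.𝓕 s] (A s)) ∧
  (∀ ω : Ω, Continuous fun s : ℝ≥0 => A s ω) ∧
  (∀ ω : Ω, Monotone fun s : ℝ≥0 => A s ω) ∧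
  (∀ ω : Ω, A 0 ω = 0) ∧
  ∃ μA : Ω → MeasureTheory.Measure ℝ≥0,
    (∀ ω : Ω, ∀ s t : ℝ≥0, s ≤ t → μA ω (Set.Ioc s t) = ENNReal.ofReal (A t ω - A s ω)) ∧
    (∀ ω : Ω, μA ω {0} = 0) ∧
    (∀ᵐ ω ∂Y.P, μA ω {s : ℝ≥0 | X s ω ≠ 0} = 0)

/-- `g = sup {s ≥ 0 | X s = 0}` (with values in `[0,∞]`, `sup ∅ = 0`). -/
noncomputable def lastZeroTime {Ω : Type} (X : ℝ≥0 → Ω → ℝ) (ω : Ω) : ℝ≥0∞ :=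
  ⨆ (s : ℝ≥0) (_ : X s ω = 0), (s : ℝ≥0∞)

set_option linter.unusedSectionVars false

lemma ms_lt {Ω : Type} (m : MeasurableSpace Ω) {f g : Ω → ℝ} (hf : Measurable[m] f)
    (hg : Measurable[m] g) : MeasurableSet[m] {ω | f ω < g ω} := measurableSet_lt hf hg

lemma ms_le {Ω : Type} (m : MeasurableSpace Ω) {f g : Ω → ℝ} (hf : Measurable[m] f)
    (hg : Measurable[m] g) : MeasurableSet[m] {ω | f ω ≤ g ω} := measurableSet_le hf hg

lemma ms_eq {Ω : Type} (m : MeasurableSpace Ω) {f g : Ω → ℝ} (hf : Measurable[m] f)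
    (hg : Measurable[m] g) : MeasurableSet[m] {ω | f ω = g ω} := measurableSet_eq_fun hf hg

/-- Working package of the properties of a class (Σ) submartingale. -/
structure SD {Ω : Type} [mΩ : MeasurableSpace Ω] (P : Measure Ω)
    (𝓕 : ℝ≥0 → MeasurableSpace Ω) (X N A : ℝ≥0 → Ω → ℝ) : Prop where
  mono : Monotone 𝓕
  le : ∀ s, 𝓕 s ≤ mΩ
  nonneg : ∀ s ω, 0 ≤ X s ω
  measX : ∀ s, Measurable[𝓕 s] (X s)
  measA : ∀ s, Measurable[𝓕 s] (A s)
  intX : ∀ s, Integrable (X s) P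
  intN : ∀ s, Integrable (N s) P
  intA : ∀ s, Integrable (A s) P
  mart : ∀ s t, s ≤ t → ∀ B, MeasurableSet[𝓕 s] B → ∫ ω in B, N t ω ∂P = ∫ ω in B, N s ω ∂P
  eq : ∀ s ω, X s ω = N s ω + A s ω
  rc : ∀ ω s, Tendsto (fun u => X u ω) (nhdsWithin s (Ici s)) (nhds (X s ω))
  contA : ∀ ω, Continuous fun s => A s ω
  monoA : ∀ ω, Monotone fun s => A s ω
  carried : ∀ᵐ ω ∂P, ∀ v s, A v ω < A s ω → ∃ w, v < w ∧ w ≤ s ∧ X w ω = 0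

/-- A fixed countable dense sequence of times. -/
noncomputable def dseq (n : ℕ) : ℝ≥0 := TopologicalSpace.denseSeq ℝ≥0 n

lemma exists_dseq {v w : ℝ≥0} (h : v < w) : ∃ n, v < dseq n ∧ dseq n < w := by
  obtain ⟨n, hn⟩ := (TopologicalSpace.denseRange_denseSeq ℝ≥0).exists_mem_open
    (isOpen_Ioo (a := v) (b := w)) (nonempty_Ioo.2 h)
  exact ⟨n, hn.1, hn.2⟩

open Classical in
/-- First time in the finite grid `G` at which `C` holds, `u` if there is none. -/
noncomputable def ftau {Ω : Type} (C : ℝ≥0 → Set Ω) (u : ℝ≥0) (G : Finset ℝ≥0) (ω : Ω) : ℝ≥0 :=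
  if h : (G.filter (fun r => ω ∈ C r)).Nonempty then (G.filter (fun r => ω ∈ C r)).min' h else u

section ftau
variable {Ω : Type} {C : ℝ≥0 → Set Ω} {u : ℝ≥0} {G : Finset ℝ≥0} {ω : Ω}

lemma ftau_none (h : ∀ r ∈ G, ω ∉ C r) : ftau C u G ω = u := by
  classical
  unfold ftau
  rw [dif_neg]
  rintro ⟨r, hr⟩
  rw [Finset.mem_filter] at hr
  exact h r hr.1 hr.2

lemma ftau_some {r : ℝ≥0} (hr : r ∈ G) (hC : ω ∈ C r) :
    ftau C u G ω ∈ G ∧ ω ∈ C (ftau C u G ω) ∧ ftau C u G ω ≤ r := by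
  classical
  have hm : r ∈ G.filter (fun r => ω ∈ C r) := Finset.mem_filter.2 ⟨hr, hC⟩
  have hne : (G.filter (fun r => ω ∈ C r)).Nonempty := ⟨r, hm⟩
  have e : ftau C u G ω = (G.filter (fun r => ω ∈ C r)).min' hne := by
    unfold ftau
    rw [dif_pos hne]
  have h1 := Finset.min'_mem _ hne
  rw [← e, Finset.mem_filter] at h1
  exact ⟨h1.1, h1.2, e ▸ Finset.min'_le _ _ hm⟩

lemma ftau_le (hG : ∀ r ∈ G, r ≤ u) : ftau C u G ω ≤ u := by
  by_cases h : ∃ r ∈ G, ω ∈ C r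
  · obtain ⟨r, hr, hC⟩ := h
    exact hG _ (ftau_some hr hC).1
  · push Not at h
    rw [ftau_none h]

lemma le_ftau {v : ℝ≥0} (hv : v ≤ u) (hG : ∀ r ∈ G, v ≤ r) : v ≤ ftau C u G ω := by
  by_cases h : ∃ r ∈ G, ω ∈ C r
  · obtain ⟨r, hr, hC⟩ := h
    exact hG _ (ftau_some hr hC).1
  · push Not at h
    rwa [ftau_none h]

lemma ftau_insert_pos {a : ℝ≥0} (ha : ∀ r ∈ G, a < r) (hC : ω ∈ C a) :
    ftau C u (insert a G) ω = a := by
  have h := ftau_some (u := u) (Finset.mem_insert_self a G) hC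
  refine le_antisymm h.2.2 ?_
  rcases Finset.mem_insert.1 h.1 with h1 | h1
  · exact h1.ge
  · exact (ha _ h1).le

lemma ftau_insert_neg {a : ℝ≥0} (hC : ω ∉ C a) :
    ftau C u (insert a G) ω = ftau C u G ω := by
  classical
  have : (insert a G).filter (fun r => ω ∈ C r) = G.filter (fun r => ω ∈ C r) := by
    rw [Finset.filter_insert, if_neg hC]
  unfold ftau
  simp only [this]

end ftau

/-- The finite grids. -/
noncomputable def grid (v u : ℝ≥0) (k : ℕ) : Finset ℝ≥0 :=
  ((Finset.range k).image dseq).filter (fun r => v ≤ r ∧ r ≤ u)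

lemma mem_grid {v u r : ℝ≥0} {k : ℕ} : r ∈ grid v u k ↔ (∃ j < k, dseq j = r) ∧ v ≤ r ∧ r ≤ u := by
  simp [grid]

section main
variable {Ω : Type} [mΩ : MeasurableSpace Ω] {P : Measure Ω} [IsProbabilityMeasure P]
    {𝓕 : ℝ≥0 → MeasurableSpace Ω} {X N A : ℝ≥0 → Ω → ℝ}

lemma stopped_insert_eq {Ω : Type} {C : ℝ≥0 → Set Ω} {u a : ℝ≥0} {G : Finset ℝ≥0}
    (ha : ∀ r ∈ G, a < r) (Z : ℝ≥0 → Ω → ℝ) :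
    (fun ω => Z (ftau C u (insert a G) ω) ω) =
      (C a).indicator (Z a) + (C a)ᶜ.indicator (fun ω => Z (ftau C u G ω) ω) := by
  funext ω
  by_cases h : ω ∈ C a
  · simp [ftau_insert_pos ha h, h]
  · simp [ftau_insert_neg h, h]

lemma stopped_integrable {C : ℝ≥0 → Set Ω} (hC : ∀ r, MeasurableSet (C r)) (u : ℝ≥0)
    (Z : ℝ≥0 → Ω → ℝ) (hZ : ∀ s, Integrable (Z s) P) (G : Finset ℝ≥0) :
    Integrable (fun ω => Z (ftau C u G ω) ω) P := by
  induction G using Finset.induction_on_min with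
  | empty =>
    have : (fun ω => Z (ftau C u ∅ ω) ω) = Z u := by
      funext ω
      rw [ftau_none (by simp)]
    rw [this]
    exact hZ u
  | insert a G ha ih =>
    rw [stopped_insert_eq ha]
    exact ((hZ a).indicator (hC a)).add (ih.indicator (hC a).compl)

lemma SD.stopped_N (h : SD P 𝓕 X N A) {C : ℝ≥0 → Set Ω} (hC : ∀ r, MeasurableSet[𝓕 r] (C r))
    (u : ℝ≥0) (G : Finset ℝ≥0) (hGu : ∀ r ∈ G, r ≤ u) :
    ∀ w ≤ u, (∀ r ∈ G, w ≤ r) → ∀ B, MeasurableSet[𝓕 w] B →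
    ∫ ω in B, N (ftau C u G ω) ω ∂P = ∫ ω in B, N u ω ∂P := by
  induction G using Finset.induction_on_min with
  | empty =>
    intro w _ _ B _
    have : (fun ω => N (ftau C u ∅ ω) ω) = N u := by
      funext ω
      rw [ftau_none (by simp)]
    rw [this]
  | insert a G ha ih =>
    intro w hwu hw B hB
    have hau : a ≤ u := hGu a (Finset.mem_insert_self a G)
    have hCm : ∀ r, MeasurableSet (C r) := fun r => h.le r _ (hC r)
    have hBa : MeasurableSet[𝓕 a] B := h.mono (hw a (Finset.mem_insert_self a G)) _ hB
    have hB' : MeasurableSet B := h.le _ _ hB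
    have i1 := (h.intN a).indicator (hCm a)
    have i2 := (stopped_integrable hCm u N h.intN G).indicator (hCm a).compl
    rw [stopped_insert_eq ha]
    rw [integral_add' i1.integrableOn i2.integrableOn, setIntegral_indicator (hCm a),
      setIntegral_indicator (hCm a).compl,
      ih (fun r hr => hGu r (Finset.mem_insert_of_mem hr)) a hau (fun r hr => (ha r hr).le)
        (B ∩ (C a)ᶜ) (hBa.inter (hC a).compl),
      ← h.mart a u hau (B ∩ C a) (hBa.inter (hC a)), ← Set.sdiff_eq]
    exact integral_inter_add_sdiff (hCm a) (h.intN u).integrableOn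

/-- The limit lemma along grids. -/
lemma SD.tendsto_stopped (h : SD P 𝓕 X N A) {C : ℝ≥0 → Set Ω}
    (hC : ∀ r, MeasurableSet[𝓕 r] (C r)) {v u : ℝ≥0} (hvu : v ≤ u)
    (hhit : ∀ᵐ ω ∂P, ∀ s, v < s → s ≤ u → A v ω < A s ω →
      ∃ j, v ≤ dseq j ∧ dseq j ≤ s ∧ ω ∈ C (dseq j))
    {B : Set Ω} (hB : MeasurableSet[𝓕 v] B) :
    Tendsto (fun k => ∫ ω in B, X (ftau C u (grid v u k) ω) ω ∂P) atTop
      (nhds (∫ ω in B, X v ω ∂P)) := by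
  have hCm : ∀ r, MeasurableSet (C r) := fun r => h.le r _ (hC r)
  have hgu : ∀ k, ∀ r ∈ grid v u k, r ≤ u := fun k r hr => (mem_grid.1 hr).2.2
  have hgv : ∀ k, ∀ r ∈ grid v u k, v ≤ r := fun k r hr => (mem_grid.1 hr).2.1
  have e1 : ∀ k, ∫ ω in B, X (ftau C u (grid v u k) ω) ω ∂P =
      ∫ ω in B, N v ω ∂P + ∫ ω in B, A (ftau C u (grid v u k) ω) ω ∂P := by
    intro k
    have i1 := stopped_integrable hCm u N h.intN (grid v u k)
    have i2 := stopped_integrable hCm u A h.intA (grid v u k)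
    simp only [h.eq]
    rw [integral_add i1.integrableOn i2.integrableOn,
      h.stopped_N hC u _ (hgu k) v hvu (hgv k) B hB, h.mart v u hvu B hB]
  have e2 : ∫ ω in B, X v ω ∂P = ∫ ω in B, N v ω ∂P + ∫ ω in B, A v ω ∂P := by
    simp only [h.eq]
    rw [integral_add (h.intN v).integrableOn (h.intA v).integrableOn]
  simp only [e1]
  rw [e2]
  refine tendsto_const_nhds.add ?_
  refine tendsto_integral_of_dominated_convergence (fun ω => |A u ω| + |A v ω|)
    (fun k => (stopped_integrable hCm u A h.intA (grid v u k)).integrableOn.1)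
    ((h.intA u).abs.add (h.intA v).abs).integrableOn ?_ ?_
  · intro k
    refine Eventually.of_forall fun ω => ?_
    have a1 := h.monoA ω (ftau_le (C := C) (ω := ω) (hgu k))
    have a2 := h.monoA ω (le_ftau (C := C) (ω := ω) hvu (hgv k))
    simp only at a1 a2
    rw [Real.norm_eq_abs]
    have := abs_le_max_abs_abs a2 a1
    have b1 := abs_nonneg (A u ω)
    have b2 := abs_nonneg (A v ω)
    rcases le_max_iff.1 this with h3 | h3 <;> linarith
  · refine ae_restrict_of_ae ?_
    filter_upwards [hhit] with ω hω
    refine tendsto_order.2 ⟨fun a ha => Eventually.of_forall fun k => ha.trans_le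
      (h.monoA ω (le_ftau (C := C) (ω := ω) hvu (hgv k))), fun a ha => ?_⟩
    by_cases hau : A u ω < a
    · exact Eventually.of_forall fun k => lt_of_le_of_lt
        (h.monoA ω (ftau_le (C := C) (ω := ω) (hgu k))) hau
    · push Not at hau
      obtain ⟨b, hb1, hb2⟩ := exists_between ha
      obtain ⟨s, hs, hsb⟩ := intermediate_value_Icc hvu (h.contA ω).continuousOn
        (show b ∈ Icc (A v ω) (A u ω) from ⟨hb1.le, hb2.le.trans hau⟩)
      simp only at hsb
      have hvs : v < s := by
        refine lt_of_le_of_ne hs.1 ?_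
        rintro rfl
        exact hb1.ne hsb
      obtain ⟨j, hj1, hj2, hj3⟩ := hω s hvs hs.2 (hsb ▸ hb1)
      filter_upwards [eventually_gt_atTop j] with k hk
      have hm : dseq j ∈ grid v u k := mem_grid.2 ⟨⟨j, hk, rfl⟩, hj1, hj2.trans hs.2⟩
      have := h.monoA ω ((ftau_some (u := u) hm hj3).2.2.trans hj2)
      simp only at this
      linarith


/-- `X ≥ ε` along the dense sequence in `[v, u]`. -/
def noE {Ω : Type} (X : ℝ≥0 → Ω → ℝ) (ε : ℝ) (v u : ℝ≥0) : Set Ω :=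
  {ω | ∀ j, v ≤ dseq j → dseq j ≤ u → ε ≤ X (dseq j) ω}

/-- `X` is bounded below by a positive constant along the dense sequence in `[v, u]`. -/
def PosS {Ω : Type} (X : ℝ≥0 → Ω → ℝ) (v u : ℝ≥0) : Set Ω :=
  ⋃ n : ℕ, noE X (1 / ((n : ℝ) + 1)) v u

lemma noE_meas (h : SD P 𝓕 X N A) (ε : ℝ) (v u : ℝ≥0) : MeasurableSet[𝓕 u] (noE X ε v u) := by
  have : noE X ε v u = ⋂ j, ⋂ (_ : v ≤ dseq j), ⋂ (_ : dseq j ≤ u), {ω | ε ≤ X (dseq j) ω} := by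
    ext ω
    simp [noE]
  rw [this]
  refine MeasurableSet.iInter fun j => MeasurableSet.iInter fun _ => MeasurableSet.iInter fun hj => ?_
  exact h.mono hj _ (ms_le (𝓕 (dseq j)) measurable_const (h.measX _))

lemma PosS_meas (h : SD P 𝓕 X N A) (v u : ℝ≥0) : MeasurableSet[𝓕 u] (PosS X v u) :=
  MeasurableSet.iUnion fun _ => noE_meas h _ v u

lemma SD.rc_lt (h : SD P 𝓕 X N A) {ω : Ω} {r s : ℝ≥0} {ε : ℝ} (hr : X r ω < ε) (hrs : r < s) :
    ∃ j, r < dseq j ∧ dseq j < s ∧ X (dseq j) ω < ε := by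
  have h1 := (h.rc ω r).eventually (eventually_lt_nhds hr)
  obtain ⟨r', hr', hs⟩ := (mem_nhdsGE_iff_exists_Ico_subset' hrs).1 h1
  obtain ⟨j, hj1, hj2⟩ := exists_dseq (lt_min hr' hrs)
  exact ⟨j, hj1, hj2.trans_le (min_le_right _ _), hs ⟨hj1.le, hj2.trans_le (min_le_left _ _)⟩⟩

lemma SD.rc_gt (h : SD P 𝓕 X N A) {ω : Ω} {r s : ℝ≥0} {ε : ℝ} (hr : ε < X r ω) (hrs : r < s) :
    ∃ r', r < r' ∧ r' ≤ s ∧ ∀ x, r ≤ x → x < r' → ε < X x ω := by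
  have h1 := (h.rc ω r).eventually (eventually_gt_nhds hr)
  obtain ⟨r', hr', hs⟩ := (mem_nhdsGE_iff_exists_Ico_subset' hrs).1 h1
  exact ⟨min r' s, lt_min hr' hrs, min_le_right _ _, fun x hx1 hx2 =>
    hs ⟨hx1, hx2.trans_le (min_le_left _ _)⟩⟩

lemma SD.noE_le (h : SD P 𝓕 X N A) {ω : Ω} {ε : ℝ} {v u r : ℝ≥0} (hω : ω ∈ noE X ε v u)
    (hv : v ≤ r) (hu : r < u) : ε ≤ X r ω := by
  by_contra hc
  push Not at hc
  obtain ⟨j, h1, h2, h3⟩ := h.rc_lt hc hu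
  exact absurd (hω j (hv.trans h1.le) h2.le) (not_le.2 h3)

lemma SD.PosS_pos (h : SD P 𝓕 X N A) {ω : Ω} {v u r : ℝ≥0} (hω : ω ∈ PosS X v u)
    (hv : v ≤ r) (hu : r < u) : 0 < X r ω := by
  obtain ⟨n, hn⟩ := mem_iUnion.1 hω
  exact lt_of_lt_of_le (by positivity) (h.noE_le hn hv hu)

lemma PosS_mono {v v' u : ℝ≥0} (hv : v ≤ v') : PosS X v u ⊆ PosS X v' u := by
  refine iUnion_mono fun n ω hω j h1 h2 => hω j (hv.trans h1) h2

lemma mem_PosS_of {ω : Ω} {v u : ℝ≥0} {ε : ℝ} (hε : 0 < ε)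
    (h : ∀ r, v ≤ r → r ≤ u → ε ≤ X r ω) : ω ∈ PosS X v u := by
  obtain ⟨n, hn⟩ := exists_nat_one_div_lt hε
  exact mem_iUnion.2 ⟨n, fun j h1 h2 => hn.le.trans (h _ h1 h2)⟩

lemma SD.exists_before (h : SD P 𝓕 X N A) {ω : Ω} {v s : ℝ≥0} (hA : A v ω < A s ω) :
    ∃ s', v < s' ∧ s' < s ∧ A v ω < A s' ω := by
  have hvs : v < s := by
    by_contra hc
    exact absurd (h.monoA ω (not_lt.1 hc)) (not_le.2 hA)
  obtain ⟨b, hb1, hb2⟩ := exists_between hA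
  obtain ⟨s', hs, hsb⟩ := intermediate_value_Icc hvs.le (h.contA ω).continuousOn
    (show b ∈ Icc (A v ω) (A s ω) from ⟨hb1.le, hb2.le⟩)
  simp only at hsb
  refine ⟨s', lt_of_le_of_ne hs.1 ?_, lt_of_le_of_ne hs.2 ?_, hsb ▸ hb1⟩
  · rintro rfl
    exact hb1.ne hsb
  · rintro rfl
    exact hb2.ne hsb.symm

lemma SD.noE_bounds (h : SD P 𝓕 X N A) {ε : ℝ} (hε : 0 < ε) {v u : ℝ≥0} (hvu : v ≤ u)
    {B : Set Ω} (hB : MeasurableSet[𝓕 v] B) :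
    ∫ ω in B ∩ noE X ε v u, X u ω ∂P ≤ ∫ ω in B, X v ω ∂P ∧
    ∫ ω in B, X v ω ∂P ≤ ∫ ω in B ∩ noE X ε v u, X u ω ∂P + ε := by
  set C : ℝ≥0 → Set Ω := fun r => {ω | X r ω < ε} with hCdef
  have hC : ∀ r, MeasurableSet[𝓕 r] (C r) := fun r =>
    ms_lt (𝓕 r) (h.measX r) measurable_const
  have hCm : ∀ r, MeasurableSet (C r) := fun r => h.le r _ (hC r)
  have hBm : MeasurableSet B := h.le _ _ hB
  have hnm : MeasurableSet (noE X ε v u) := h.le _ _ (noE_meas h ε v u)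
  have hlim := h.tendsto_stopped hC hvu (by
    filter_upwards [h.carried] with ω hω s hvs hsu hA
    obtain ⟨s', h1, h2, h3⟩ := h.exists_before hA
    obtain ⟨w, hw1, hw2, hw3⟩ := hω v s' h3
    obtain ⟨j, hj1, hj2, hj3⟩ := h.rc_lt (hw3.trans_lt hε) (hw2.trans_lt h2)
    exact ⟨j, (hw1.trans hj1).le, hj2.le, hj3⟩) hB
  have hint := fun k => stopped_integrable hCm u X h.intX (grid v u k) (P := P)
  constructor
  · refine ge_of_tendsto' hlim fun k => ?_
    have e : ∫ ω in B ∩ noE X ε v u, X u ω ∂P =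
        ∫ ω in B ∩ noE X ε v u, X (ftau C u (grid v u k) ω) ω ∂P := by
      refine setIntegral_congr_fun (hBm.inter hnm) fun ω hω => ?_
      rw [ftau_none]
      intro r hr
      obtain ⟨⟨j, _, rfl⟩, h1, h2⟩ := mem_grid.1 hr
      exact not_lt.2 (hω.2 j h1 h2)
    rw [e]
    exact setIntegral_mono_set (hint k).integrableOn
      (Eventually.of_forall fun ω => h.nonneg _ _) (Eventually.of_forall inter_subset_left)
  · set nk : ℕ → Set Ω := fun k => {ω | ∀ r ∈ grid v u k, ω ∉ C r} with hnk
    have hnkm : ∀ k, MeasurableSet (nk k) := by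
      intro k
      have : nk k = ⋂ r ∈ grid v u k, (C r)ᶜ := by
        ext ω
        simp [hnk]
      rw [this]
      exact Finset.measurableSet_biInter _ fun r _ => (hCm r).compl
    have hanti : Antitone fun k => B ∩ nk k := by
      intro k l hkl
      refine inter_subset_inter_right _ fun ω hω r hr => hω r ?_
      obtain ⟨⟨j, hj, e⟩, h12⟩ := mem_grid.1 hr
      exact mem_grid.2 ⟨⟨j, hj.trans_le hkl, e⟩, h12⟩
    have hI : ⋂ k, B ∩ nk k = B ∩ noE X ε v u := by
      rw [← inter_iInter]
      congr 1
      ext ω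
      simp only [mem_iInter]
      constructor
      · intro hω j h1 h2
        exact not_lt.1 (hω (j + 1) (dseq j) (mem_grid.2 ⟨⟨j, Nat.lt_succ_self j, rfl⟩, h1, h2⟩))
      · intro hω k r hr
        obtain ⟨⟨j, _, rfl⟩, h1, h2⟩ := mem_grid.1 hr
        exact not_lt.2 (hω j h1 h2)
    have hlim2 := tendsto_setIntegral_of_antitone (f := X u) (μ := P)
      (fun k => hBm.inter (hnkm k)) hanti ⟨0, (h.intX u).integrableOn⟩
    rw [hI] at hlim2
    refine le_of_tendsto_of_tendsto' hlim (hlim2.add_const ε) fun k => ?_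
    rw [← integral_inter_add_sdiff (hnkm k) (hint k).integrableOn]
    refine add_le_add (le_of_eq ?_) ?_
    · refine setIntegral_congr_fun (hBm.inter (hnkm k)) fun ω hω => ?_
      rw [ftau_none hω.2]
    · calc ∫ ω in B \ nk k, X (ftau C u (grid v u k) ω) ω ∂P
          ≤ ∫ ω in B \ nk k, ε ∂P := by
            refine setIntegral_mono_on (hint k).integrableOn (integrable_const _).integrableOn
              (hBm.diff (hnkm k)) fun ω hω => ?_
            have := hω.2
            simp only [hnk, mem_ofPred_eq, not_forall, not_not] at this
            obtain ⟨r, hr, hrC⟩ := this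
            exact le_of_lt (ftau_some (u := u) hr hrC).2.1
        _ = P.real (B \ nk k) * ε := by simp
        _ ≤ 1 * ε := by
            gcongr
            exact measureReal_le_one
        _ = ε := one_mul ε

lemma noE_mono_eps {ε ε' : ℝ} (he : ε' ≤ ε) (v u : ℝ≥0) : noE X ε v u ⊆ noE X ε' v u :=
  fun _ hω j h1 h2 => he.trans (hω j h1 h2)

/-- The key identity (b). -/
lemma SD.PosS_integral (h : SD P 𝓕 X N A) {v u : ℝ≥0} (hvu : v ≤ u)
    {B : Set Ω} (hB : MeasurableSet[𝓕 v] B) :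
    ∫ ω in B ∩ PosS X v u, X u ω ∂P = ∫ ω in B, X v ω ∂P := by
  have hBm : MeasurableSet B := h.le _ _ hB
  have hlim := tendsto_setIntegral_of_monotone (f := X u) (μ := P)
    (s := fun n : ℕ => B ∩ noE X (1 / ((n : ℝ) + 1)) v u)
    (fun n => hBm.inter (h.le _ _ (noE_meas h _ v u)))
    (fun n m hnm => inter_subset_inter_right _
      (noE_mono_eps (one_div_le_one_div_of_le (by positivity) (by gcongr)) v u))
    (h.intX u).integrableOn
  rw [← inter_iUnion] at hlim
  change Tendsto _ _ (nhds (∫ ω in B ∩ PosS X v u, X u ω ∂P)) at hlim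
  refine le_antisymm (le_of_tendsto' hlim fun n => (h.noE_bounds (by positivity) hvu hB).1) ?_
  have h2 := hlim.add tendsto_one_div_add_atTop_nhds_zero_nat
  rw [add_zero] at h2
  exact ge_of_tendsto' h2 fun n => (h.noE_bounds (by positivity) hvu hB).2

lemma measA_eq (h : SD P 𝓕 X N A) {v u : ℝ≥0} (hvu : v ≤ u) :
    MeasurableSet[𝓕 u] {ω | A u ω = A v ω} :=
  ms_eq (𝓕 u) (h.measA u) ((h.measA v).mono (h.mono hvu) le_rfl)

/-- Auxiliary inequality, upper part. -/
lemma SD.const_le (h : SD P 𝓕 X N A) {v u : ℝ≥0} (hvu : v ≤ u)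
    {B : Set Ω} (hB : MeasurableSet[𝓕 v] B) :
    ∫ ω in B ∩ {ω | A u ω = A v ω}, X u ω ∂P ≤ ∫ ω in B, X v ω ∂P := by
  classical
  set C : ℝ≥0 → Set Ω := fun r => {ω | v ≤ r ∧ A v ω < A r ω} with hCdef
  have hC : ∀ r, MeasurableSet[𝓕 r] (C r) := fun r => by
    by_cases hr : v ≤ r
    · simp only [hCdef, hr, true_and]
      exact ms_lt (𝓕 r) ((h.measA v).mono (h.mono hr) le_rfl) (h.measA r)
    · simp [hCdef, hr]
  have hCm : ∀ r, MeasurableSet (C r) := fun r => h.le r _ (hC r)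
  have hBm : MeasurableSet B := h.le _ _ hB
  have hnm : MeasurableSet {ω | A u ω = A v ω} := h.le _ _ (measA_eq h hvu)
  have hlim := h.tendsto_stopped hC hvu (by
    refine Eventually.of_forall fun ω s hvs hsu hA => ?_
    obtain ⟨s', h1, h2, h3⟩ := h.exists_before hA
    obtain ⟨j, hj1, hj2⟩ := exists_dseq h2
    exact ⟨j, (h1.trans hj1).le, hj2.le, (h1.trans hj1).le, h3.trans_le (h.monoA ω hj1.le)⟩) hB
  have hint := fun k => stopped_integrable hCm u X h.intX (grid v u k) (P := P)
  refine ge_of_tendsto' hlim fun k => ?_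
  have e : ∫ ω in B ∩ {ω | A u ω = A v ω}, X u ω ∂P =
      ∫ ω in B ∩ {ω | A u ω = A v ω}, X (ftau C u (grid v u k) ω) ω ∂P := by
    refine setIntegral_congr_fun (hBm.inter hnm) fun ω hω => ?_
    rw [ftau_none]
    intro r hr hrC
    have := h.monoA ω (mem_grid.1 hr).2.2
    have h2 : A u ω = A v ω := hω.2
    simp only at this
    linarith [hrC.2]
  rw [e]
  exact setIntegral_mono_set (hint k).integrableOn
    (Eventually.of_forall fun ω => h.nonneg _ _) (Eventually.of_forall inter_subset_left)

lemma SD.hit_le (h : SD P 𝓕 X N A) {ε : ℝ} (hε : 0 < ε) {v u : ℝ≥0} (hvu : v ≤ u)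
    (G : Finset ℝ≥0) (hGu : ∀ r ∈ G, r ≤ u) :
    ∀ w ≤ u, v ≤ w → (∀ r ∈ G, w ≤ r) → ∀ B, MeasurableSet[𝓕 w] B →
    ∫ ω in B ∩ ({ω | ∃ r ∈ G, X r ω < ε} ∩ {ω | A u ω = A v ω}), X u ω ∂P ≤ ε * P.real B := by
  induction G using Finset.induction_on_min with
  | empty =>
    intro w _ _ _ B _
    simp
    positivity
  | insert a G ha ih =>
    intro w hwu hvw hw B hB
    have hau : a ≤ u := hGu a (Finset.mem_insert_self a G)
    have hwa : w ≤ a := hw a (Finset.mem_insert_self a G)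
    have hva : v ≤ a := hvw.trans hwa
    have hBa : MeasurableSet[𝓕 a] B := h.mono hwa _ hB
    have hB' : MeasurableSet B := h.le _ _ hB
    have hC : MeasurableSet[𝓕 a] {ω | X a ω < ε} :=
      ms_lt (𝓕 a) (h.measX a) measurable_const
    have hCm := h.le _ _ hC
    have i1 := ih (fun r hr => hGu r (Finset.mem_insert_of_mem hr)) a hau hva
      (fun r hr => (ha r hr).le) (B \ {ω | X a ω < ε}) (hBa.diff hC)
    have i2 := h.const_le hau (hBa.inter hC)
    have i3 : ∫ ω in B ∩ {ω | X a ω < ε}, X a ω ∂P ≤ ε * P.real (B ∩ {ω | X a ω < ε}) := by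
      calc ∫ ω in B ∩ {ω | X a ω < ε}, X a ω ∂P ≤ ∫ ω in B ∩ {ω | X a ω < ε}, ε ∂P := by
            refine setIntegral_mono_on (h.intX a).integrableOn (integrable_const _).integrableOn
              (hB'.inter hCm) fun ω hω => le_of_lt hω.2
        _ = _ := by simp [mul_comm]
    have i4 : ∫ ω in B ∩ {ω | X a ω < ε} ∩ {ω | A u ω = A v ω}, X u ω ∂P ≤
        ∫ ω in B ∩ {ω | X a ω < ε} ∩ {ω | A u ω = A a ω}, X u ω ∂P := by
      refine setIntegral_mono_set (h.intX u).integrableOn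
        (Eventually.of_forall fun ω => h.nonneg _ _) (Eventually.of_forall ?_)
      refine inter_subset_inter_right _ fun ω hω => ?_
      have h1 := h.monoA ω hva
      have h2 := h.monoA ω hau
      simp only [mem_ofPred_eq] at *
      linarith
    rw [← integral_inter_add_sdiff hCm (h.intX u).integrableOn]
    have s1 : B ∩ ({ω | ∃ r ∈ insert a G, X r ω < ε} ∩ {ω | A u ω = A v ω}) ∩ {ω | X a ω < ε} =
        B ∩ {ω | X a ω < ε} ∩ {ω | A u ω = A v ω} := by
      ext ω
      simp only [Finset.mem_insert, exists_eq_or_imp, mem_inter_iff, mem_ofPred_eq]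
      tauto
    have s2 : (B ∩ ({ω | ∃ r ∈ insert a G, X r ω < ε} ∩ {ω | A u ω = A v ω})) \ {ω | X a ω < ε} =
        B \ {ω | X a ω < ε} ∩ ({ω | ∃ r ∈ G, X r ω < ε} ∩ {ω | A u ω = A v ω}) := by
      ext ω
      simp only [Finset.mem_insert, exists_eq_or_imp, mem_inter_iff, mem_ofPred_eq, Set.mem_sdiff]
      tauto
    rw [s1, s2]
    have := measureReal_inter_add_sdiff (μ := P) (s := B) hCm
    rw [← this, mul_add]
    linarith

/-- Auxiliary inequality. -/
lemma SD.null_c (h : SD P 𝓕 X N A) {v u : ℝ≥0} (hvu : v ≤ u) :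
    P {ω | 0 < X u ω ∧ A u ω = A v ω ∧ ω ∉ PosS X v u} = 0 := by
  have hAm : MeasurableSet {ω | A u ω = A v ω} := h.le _ _ (measA_eq h hvu)
  have key : ∀ n : ℕ, ∫ ω in (noE X (1 / ((n : ℝ) + 1)) v u)ᶜ ∩ {ω | A u ω = A v ω}, X u ω ∂P
      ≤ 1 / ((n : ℝ) + 1) := by
    intro n
    set ε : ℝ := 1 / ((n : ℝ) + 1)
    have hε : 0 < ε := by positivity
    set H : ℕ → Set Ω := fun k => {ω | ∃ r ∈ grid v u k, X r ω < ε} ∩ {ω | A u ω = A v ω} with hH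
    have hHm : ∀ k, MeasurableSet (H k) := by
      intro k
      refine MeasurableSet.inter ?_ hAm
      have : {ω | ∃ r ∈ grid v u k, X r ω < ε} = ⋃ r ∈ grid v u k, {ω | X r ω < ε} := by
        ext ω
        simp
      rw [this]
      exact Finset.measurableSet_biUnion _ fun r _ =>
        h.le _ _ (ms_lt (𝓕 r) (h.measX r) measurable_const)
    have hmono : Monotone H := by
      intro k l hkl
      refine inter_subset_inter_left _ ?_
      rintro ω ⟨r, hr, hx⟩
      obtain ⟨⟨j, hj, e⟩, h12⟩ := mem_grid.1 hr
      exact ⟨r, mem_grid.2 ⟨⟨j, hj.trans_le hkl, e⟩, h12⟩, hx⟩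
    have hU : ⋃ k, H k = (noE X ε v u)ᶜ ∩ {ω | A u ω = A v ω} := by
      rw [hH, ← iUnion_inter]
      congr 1
      ext ω
      simp only [mem_iUnion, mem_compl_iff, noE, mem_ofPred_eq, not_forall, not_le]
      constructor
      · rintro ⟨k, r, hr, hx⟩
        obtain ⟨⟨j, _, rfl⟩, h1, h2⟩ := mem_grid.1 hr
        exact ⟨j, h1, h2, hx⟩
      · rintro ⟨j, h1, h2, hx⟩
        exact ⟨j + 1, dseq j, mem_grid.2 ⟨⟨j, Nat.lt_succ_self j, rfl⟩, h1, h2⟩, hx⟩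
    have hlim := tendsto_setIntegral_of_monotone (f := X u) (μ := P) hHm hmono
      (h.intX u).integrableOn
    rw [hU] at hlim
    refine le_of_tendsto' hlim fun k => ?_
    have := h.hit_le hε hvu (grid v u k) (fun r hr => (mem_grid.1 hr).2.2) v hvu le_rfl
      (fun r hr => (mem_grid.1 hr).2.1) univ MeasurableSet.univ
    simpa [univ_inter] using this
  have hPm : MeasurableSet (PosS X v u) := h.le _ _ (PosS_meas h v u)
  have h0 : ∫ ω in (PosS X v u)ᶜ ∩ {ω | A u ω = A v ω}, X u ω ∂P ≤ 0 := by
    refine ge_of_tendsto' tendsto_one_div_add_atTop_nhds_zero_nat fun n => le_trans ?_ (key n)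
    refine setIntegral_mono_set (h.intX u).integrableOn
      (Eventually.of_forall fun ω => h.nonneg _ _) (Eventually.of_forall ?_)
    exact inter_subset_inter_left _ (compl_subset_compl.2 (subset_iUnion_of_subset n subset_rfl))
  have h1 : ∫ ω in (PosS X v u)ᶜ ∩ {ω | A u ω = A v ω}, X u ω ∂P = 0 :=
    le_antisymm h0 (integral_nonneg fun ω => h.nonneg _ _)
  rw [setIntegral_eq_zero_iff_of_nonneg_ae (Eventually.of_forall fun ω => h.nonneg _ _)
    (h.intX u).integrableOn, EventuallyEq, ae_restrict_iff' (hPm.compl.inter hAm)] at h1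
  refine measure_mono_null ?_ (ae_iff.1 h1)
  rintro ω ⟨a1, a2, a3⟩ hc
  exact a1.ne' (hc ⟨a3, a2⟩)

/-- Auxiliary fact. -/
lemma SD.null_a (h : SD P 𝓕 X N A) (v w : ℝ≥0) :
    P {ω | ω ∈ PosS X v w ∧ A v ω < A w ω} = 0 := by
  refine measure_mono_null ?_ (ae_iff.1 h.carried)
  rintro ω ⟨h1, h2⟩ hc
  obtain ⟨s', a1, a2, a3⟩ := h.exists_before h2
  obtain ⟨x, b1, b2, b3⟩ := hc v s' a3
  exact (h.PosS_pos h1 b1.le (b2.trans_lt a2)).ne' b3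

/-- exceptional set at level `u`. -/
def badS {Ω : Type} (X A : ℝ≥0 → Ω → ℝ) (u : ℝ≥0) : Set Ω :=
  (⋃ i, ⋃ j, ⋃ (_ : dseq i ≤ u), ⋃ (_ : dseq j ≤ u),
    {ω | ω ∈ PosS X (dseq i) (dseq j) ∧ A (dseq i) ω < A (dseq j) ω}) ∪
  ⋃ i, ⋃ (_ : dseq i ≤ u), {ω | 0 < X u ω ∧ A u ω = A (dseq i) ω ∧ ω ∉ PosS X (dseq i) u}

lemma SD.bad_meas (h : SD P 𝓕 X N A) (u : ℝ≥0) : MeasurableSet[𝓕 u] (badS X A u) := by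
  refine MeasurableSet.union ?_ ?_
  · refine MeasurableSet.iUnion fun i => MeasurableSet.iUnion fun j => MeasurableSet.iUnion fun hi =>
      MeasurableSet.iUnion fun hj => ?_
    exact MeasurableSet.inter (h.mono hj _ (PosS_meas h _ _))
      (ms_lt (𝓕 u) ((h.measA _).mono (h.mono hi) le_rfl) ((h.measA _).mono (h.mono hj) le_rfl))
  · refine MeasurableSet.iUnion fun i => MeasurableSet.iUnion fun hi => ?_
    exact (ms_lt (𝓕 u) measurable_const (h.measX u)).inter
      ((measA_eq h hi).inter (PosS_meas h _ _).compl)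

lemma SD.bad_null (h : SD P 𝓕 X N A) (u : ℝ≥0) : P (badS X A u) = 0 := by
  refine measure_union_null ?_ ?_
  · simp only [measure_iUnion_null_iff]
    exact fun i j _ _ => h.null_a _ _
  · simp only [measure_iUnion_null_iff]
    exact fun i hi => h.null_c hi

lemma SD.mem_PosS_of_nz (h : SD P 𝓕 X N A) {ω : Ω} {u : ℝ≥0} (hω : ω ∉ badS X A u) {i : ℕ}
    (hi : dseq i < u) (hz : ∀ r, dseq i ≤ r → r ≤ u → X r ω ≠ 0) : ω ∈ PosS X (dseq i) u := by
  set v := dseq i with hv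
  have hpos : ∀ r, v ≤ r → r ≤ u → 0 < X r ω := fun r h1 h2 =>
    lt_of_le_of_ne (h.nonneg _ _) (hz r h1 h2).symm
  have hbad1 : ∀ j k, dseq j ≤ u → dseq k ≤ u → ω ∈ PosS X (dseq j) (dseq k) →
      A (dseq k) ω ≤ A (dseq j) ω := by
    intro j k h1 h2 h3
    by_contra hc
    push Not at hc
    exact hω (Or.inl (mem_iUnion.2 ⟨j, mem_iUnion.2 ⟨k, mem_iUnion.2 ⟨h1, mem_iUnion.2 ⟨h2,
      ⟨h3, hc⟩⟩⟩⟩⟩))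
  have hcomp : IsCompact (Icc v u ∩ {r | A r ω ≤ A v ω}) :=
    isCompact_Icc.inter_right (isClosed_le (h.contA ω) continuous_const)
  obtain ⟨p, hp, hpmax⟩ := hcomp.exists_isGreatest ⟨v, ⟨le_rfl, hi.le⟩, le_refl (A v ω)⟩
  have hAp : A p ω = A v ω := le_antisymm hp.2 (h.monoA ω hp.1.1)
  have hpu : p = u := by
    by_contra hne
    have hlt : p < u := lt_of_le_of_ne hp.1.2 hne
    obtain ⟨δ, hδ0, hδ⟩ := exists_between (hpos p hp.1.1 hp.1.2)
    obtain ⟨r', h1, h2, h3⟩ := h.rc_gt hδ hlt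
    obtain ⟨k, hk1, hk2⟩ := exists_dseq h1
    have hAk : A p ω < A (dseq k) ω := by
      by_contra hc
      push Not at hc
      exact absurd (hpmax ⟨⟨hp.1.1.trans hk1.le, (hk2.trans_le h2).le⟩, hc.trans hp.2⟩)
        (not_le.2 hk1)
    -- find a time between with strictly smaller value
    obtain ⟨b, hb1, hb2⟩ := exists_between hAk
    have hev : ∀ᶠ x in nhds p, A x ω < b :=
      ((h.contA ω).tendsto p).eventually (eventually_lt_nhds hb1)
    obtain ⟨q, hq1, hq⟩ := (mem_nhdsGE_iff_exists_Ico_subset' hk1).1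
      (mem_nhdsWithin_of_mem_nhds hev)
    obtain ⟨j, hj1, hj2⟩ := exists_dseq (lt_min hq1 hk1)
    have hjk : dseq j < dseq k := hj2.trans_le (min_le_right _ _)
    have hAj : A (dseq j) ω < b := hq ⟨hj1.le, hj2.trans_le (min_le_left _ _)⟩
    have := hbad1 j k ((hjk.trans hk2).le.trans h2) (hk2.le.trans h2)
      (mem_PosS_of hδ0 fun r hr1 hr2 => (h3 r (hj1.le.trans hr1) (hr2.trans_lt hk2)).le)
    linarith
  subst hpu
  by_contra hc
  exact hω (Or.inr (mem_iUnion.2 ⟨i, mem_iUnion.2 ⟨hi.le, hpos p hi.le le_rfl, hAp, hc⟩⟩))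

/-- No zeros in `(s, u]`. -/
def nzS {Ω : Type} (X : ℝ≥0 → Ω → ℝ) (s u : ℝ≥0) : Set Ω :=
  {ω | ∀ r, s < r → r ≤ u → X r ω ≠ 0}

lemma SD.nz_approx (h : SD P 𝓕 X N A) {s u : ℝ≥0} {f : ℕ → ℝ≥0}
    (hf : ∀ n, f n ∈ Ioo s u) (hlim : Tendsto f atTop (nhds s)) :
    (⋂ n, PosS X (f n) u) ∩ {ω | 0 < X u ω} ⊆ nzS X s u ∧
    nzS X s u \ badS X A u ⊆ (⋂ n, PosS X (f n) u) ∩ {ω | 0 < X u ω} := by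
  constructor
  · rintro ω ⟨h1, h2⟩ r hsr hru
    rcases hru.lt_or_eq with hru | rfl
    · obtain ⟨n, hn⟩ := (hlim.eventually (eventually_lt_nhds hsr)).exists
      exact (h.PosS_pos (mem_iInter.1 h1 n) hn.le hru).ne'
    · exact ne_of_gt h2
  · rintro ω ⟨h1, h2⟩
    refine ⟨mem_iInter.2 fun n => ?_, ?_⟩
    · obtain ⟨i, hi1, hi2⟩ := exists_dseq (hf n).1
      exact PosS_mono hi2.le (h.mem_PosS_of_nz h2 (hi2.trans (hf n).2)
        fun r hr1 hr2 => h1 r (hi1.trans_le hr1) hr2)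
    · exact lt_of_le_of_ne (h.nonneg _ _) (h1 u ((hf 0).1.trans (hf 0).2) le_rfl).symm

lemma nzS_of_le {s u : ℝ≥0} (hus : u ≤ s) : nzS X s u = univ := by
  ext ω
  simp only [nzS, mem_ofPred_eq, mem_univ, iff_true]
  intro r h1 h2
  exact absurd (h1.trans_le h2) (not_lt.2 hus)

lemma SD.nz_meas (h : SD P 𝓕 X N A)
    (hnull : ∀ s : ℝ≥0, ∀ D : Set Ω, MeasurableSet[𝓕 s] D → P D = 0 →
      ∀ B ⊆ D, MeasurableSet[𝓕 0] B) (s u : ℝ≥0) : MeasurableSet[𝓕 u] (nzS X s u) := by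
  rcases le_or_gt u s with hus | hsu
  · rw [nzS_of_le hus]
    exact MeasurableSet.univ
  · obtain ⟨f, hf1, hf2, hf3⟩ := exists_seq_strictAnti_tendsto' hsu
    obtain ⟨h1, h2⟩ := h.nz_approx hf2 hf3
    set T := (⋂ n, PosS X (f n) u) ∩ {ω | 0 < X u ω} with hT
    have hTm : MeasurableSet[𝓕 u] T :=
      (MeasurableSet.iInter fun n => PosS_meas h _ _).inter
        (ms_lt (𝓕 u) measurable_const (h.measX u))
    have e : nzS X s u = T ∪ (nzS X s u ∩ badS X A u) := by
      ext ω
      constructor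
      · intro hω
        by_cases hb : ω ∈ badS X A u
        · exact Or.inr ⟨hω, hb⟩
        · exact Or.inl (h2 ⟨hω, hb⟩)
      · rintro (hω | hω)
        · exact h1 hω
        · exact hω.1
    rw [e]
    exact hTm.union (h.mono (zero_le) _
      (hnull u _ (h.bad_meas u) (h.bad_null u) _ inter_subset_right))

lemma SD.nz_integral (h : SD P 𝓕 X N A) {s u : ℝ≥0} (hsu : s ≤ u) {B : Set Ω}
    (hB : MeasurableSet[𝓕 s] B) :
    ∫ ω in B ∩ nzS X s u, X u ω ∂P = ∫ ω in B, X s ω ∂P := by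
  rcases hsu.eq_or_lt with rfl | hsu
  · rw [nzS_of_le le_rfl, inter_univ]
  obtain ⟨f, hf1, hf2, hf3⟩ := exists_seq_strictAnti_tendsto' hsu
  obtain ⟨h1, h2⟩ := h.nz_approx hf2 hf3
  have hBm : MeasurableSet B := h.le _ _ hB
  have hPm : ∀ n, MeasurableSet (PosS X (f n) u) := fun n => h.le _ _ (PosS_meas h _ _)
  have e1 : ∀ n, ∫ ω in B ∩ PosS X (f n) u, X u ω ∂P = ∫ ω in B, X (f n) ω ∂P := fun n =>
    h.PosS_integral (hf2 n).2.le (h.mono (hf2 n).1.le _ hB)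
  have l1 := tendsto_setIntegral_of_antitone (f := X u) (μ := P)
    (s := fun n => B ∩ PosS X (f n) u) (fun n => hBm.inter (hPm n))
    (fun n m hnm => inter_subset_inter_right _ (PosS_mono (hf1.antitone hnm)))
    ⟨0, (h.intX u).integrableOn⟩
  rw [← inter_iInter] at l1
  have l2 : Tendsto (fun n => ∫ ω in B, X (f n) ω ∂P) atTop (nhds (∫ ω in B, X s ω ∂P)) := by
    have e : ∀ t, s ≤ t → ∫ ω in B, X t ω ∂P = ∫ ω in B, N s ω ∂P + ∫ ω in B, A t ω ∂P := by
      intro t hst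
      simp only [h.eq]
      rw [integral_add (h.intN t).integrableOn (h.intA t).integrableOn, h.mart s t hst B hB]
    simp only [e _ (hf2 _).1.le]
    rw [e s le_rfl]
    refine tendsto_const_nhds.add ?_
    refine tendsto_integral_of_dominated_convergence (fun ω => |A u ω| + |A s ω|)
      (fun k => (h.intA _).integrableOn.1)
      ((h.intA u).abs.add (h.intA s).abs).integrableOn ?_ ?_
    · intro k
      refine Eventually.of_forall fun ω => ?_
      have a1 := h.monoA ω (hf2 k).2.le
      have a2 := h.monoA ω (hf2 k).1.le
      simp only at a1 a2
      rw [Real.norm_eq_abs]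
      have := abs_le_max_abs_abs a2 a1
      have b1 := abs_nonneg (A u ω)
      have b2 := abs_nonneg (A s ω)
      rcases le_max_iff.1 this with h3 | h3 <;> linarith
    · exact Eventually.of_forall fun ω => ((h.contA ω).tendsto s).comp hf3
  simp only [e1] at l1
  rw [← tendsto_nhds_unique l1 l2]
  -- compare the two sets
  have hIm : MeasurableSet (⋂ n, PosS X (f n) u) := MeasurableSet.iInter hPm
  have hXm : MeasurableSet {ω | 0 < X u ω} :=
    h.le _ _ (ms_lt (𝓕 u) measurable_const (h.measX u))
  have e3 : ∫ ω in B ∩ nzS X s u, X u ω ∂P =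
      ∫ ω in B ∩ ((⋂ n, PosS X (f n) u) ∩ {ω | 0 < X u ω}), X u ω ∂P := by
    refine setIntegral_congr_set ?_
    have hb : ∀ᵐ ω ∂P, ω ∉ badS X A u := by
      rw [ae_iff]
      simpa using h.bad_null u
    filter_upwards [hb] with ω hω
    refine propext ⟨fun hx => ⟨hx.1, h2 ⟨hx.2, hω⟩⟩, fun hx => ⟨hx.1, h1 hx.2⟩⟩
  rw [e3, ← inter_assoc]
  refine (setIntegral_eq_of_subset_of_forall_sdiff_eq_zero (hBm.inter hIm) inter_subset_left ?_).symm
  rintro ω ⟨a1, a2⟩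
  have : ¬ 0 < X u ω := fun hc => a2 ⟨a1, hc⟩
  exact le_antisymm (not_lt.1 this) (h.nonneg _ _)

/-- Lower-integral form of the key identity. -/
lemma SD.nz_lintegral (h : SD P 𝓕 X N A) {s u : ℝ≥0} (hsu : s ≤ u) {B : Set Ω}
    (hB : MeasurableSet[𝓕 s] B) :
    ∫⁻ ω in B ∩ nzS X s u, ENNReal.ofReal (X u ω) ∂P = ∫⁻ ω in B, ENNReal.ofReal (X s ω) ∂P := by
  rw [← ofReal_integral_eq_lintegral_ofReal (h.intX u).integrableOn
    (Eventually.of_forall fun ω => h.nonneg _ _), ← ofReal_integral_eq_lintegral_ofReal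
    (h.intX s).integrableOn (Eventually.of_forall fun ω => h.nonneg _ _), h.nz_integral hsu hB]

end main

section kolm
open ProbabilityTheory ProbabilityTheory.Kernel

/-- Gluing map. -/
noncomputable def glueJ (E : ℕ → Type) [∀ n, MeasurableSpace (E n)] (n : ℕ) (p : ((i : Finset.Iic n) → E i) × E (n + 1)) :
    (i : Finset.Iic (n + 1)) → E i :=
  IicProdIoc n (n + 1) (p.1, MeasurableEquiv.piSingleton n p.2)

lemma measurable_glueJ (E : ℕ → Type) [∀ n, MeasurableSpace (E n)] (n : ℕ) :
    Measurable (glueJ E n) := by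
  unfold glueJ
  fun_prop

lemma glueJ_eq (E : ℕ → Type) [∀ n, MeasurableSpace (E n)] (n : ℕ) (x : (n : ℕ) → E n) :
    glueJ E n (fun i => x i, x (n + 1)) = fun i : Finset.Iic (n + 1) => x i := by
  ext ⟨i, hi⟩
  unfold glueJ
  by_cases h : i ≤ n
  · simp [IicProdIoc, h]
  · have : i = n + 1 := le_antisymm (Finset.mem_Iic.1 hi) (by omega)
    subst this
    simp [IicProdIoc, MeasurableEquiv.piSingleton]

lemma kolm_law {Ω : Type} [Nonempty Ω] [F : MeasurableSpace Ω] (E : ℕ → Type)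
    [∀ n, MeasurableSpace (E n)] [∀ n, StandardBorelSpace (E n)] (π : ∀ n, Ω → E n)
    (hπ : ∀ n, Measurable (π n))
    (hmono : ∀ n, ∀ i ≤ n, Measurable[MeasurableSpace.comap (π n) inferInstance] (π i))
    (ρ : ℕ → Measure Ω) [∀ n, IsProbabilityMeasure (ρ n)]
    (hcons : ∀ n B, MeasurableSet[MeasurableSpace.comap (π n) inferInstance] B →
      ρ (n + 1) B = ρ n B) :
    ∃ ν : Measure ((n : ℕ) → E n), ∀ n,
      ν.map (Preorder.frestrictLe (π := E) n) =
        (ρ n).map (fun ω i => π i ω : Ω → (i : Finset.Iic n) → E i) := by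
  have : ∀ n, Nonempty (E n) := fun n => ⟨π n (Classical.arbitrary Ω)⟩
  let κ : (n : ℕ) → Kernel ((i : Finset.Iic n) → E i) (E (n + 1)) := fun n =>
    condDistrib (π (n + 1)) (fun ω i => π i ω : Ω → (i : Finset.Iic n) → E i) (ρ (n + 1))
  have hPi : ∀ n : ℕ, Measurable (fun ω i => π i ω : Ω → (i : Finset.Iic n) → E i) := fun n =>
    by exact measurable_pi_lambda _ fun i => hπ i
  have hPi' : ∀ n : ℕ, Measurable[MeasurableSpace.comap (π n) inferInstance]
      (fun ω i => π i ω : Ω → (i : Finset.Iic n) → E i) := fun n => by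
    refine @measurable_pi_lambda _ _ _ (_) _ _ fun i => hmono n i (Finset.mem_Iic.1 i.2)
  have : ∀ n, IsMarkovKernel (κ n) := fun n => by dsimp [κ]; infer_instance
  have hρ0 : IsProbabilityMeasure ((ρ 0).map (π 0)) :=
    Measure.isProbabilityMeasure_map (hπ 0).aemeasurable
  refine ⟨trajMeasure ((ρ 0).map (π 0)) κ, fun n => ?_⟩
  induction n with
  | zero =>
    rw [trajMeasure, Measure.map_comp _ _ (by fun_prop), traj_map_frestrictLe, partialTraj_self,
      Measure.id_comp]
    refine (Measure.map_map (MeasurableEquiv.measurable _) (hπ 0)).trans ?_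
    congr 1
    ext ω ⟨i, hi⟩
    obtain rfl : i = 0 := by simpa using hi
    rfl
  | succ n ih =>
    have e1 : Preorder.frestrictLe (π := E) (n + 1) =
        glueJ E n ∘ (fun x => (Preorder.frestrictLe n x, x (n + 1))) := by
      ext x : 1
      exact (glueJ_eq E n x).symm
    have e2 : (fun ω (i : Finset.Iic (n + 1)) => π i ω) =
        glueJ E n ∘ (fun ω => ((fun (i : Finset.Iic n) => π i ω), π (n + 1) ω)) := by
      ext ω : 1
      exact (glueJ_eq E n (fun i => π i ω)).symm
    rw [e1, e2, ← Measure.map_map (measurable_glueJ E n) (by fun_prop),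
      ← Measure.map_map (measurable_glueJ E n) ((hPi n).prodMk (hπ _)),
      ← map_frestrictLe_trajMeasure_compProd_eq_map_trajMeasure, ih]
    congr 1
    rw [← compProd_map_condDistrib (hπ (n + 1)).aemeasurable]
    have : (ρ n).map (fun ω i => π i ω : Ω → (i : Finset.Iic n) → E i) =
        (ρ (n + 1)).map (fun ω i => π i ω : Ω → (i : Finset.Iic n) → E i) := by
      ext C hC
      rw [Measure.map_apply (hPi n) hC, Measure.map_apply (hPi n) hC]
      exact (hcons n _ (hPi' n hC)).symm
    rw [this]

lemma kolm_prob {Ω : Type} [Nonempty Ω] [F : MeasurableSpace Ω] (E : ℕ → Type)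
    [∀ n, MeasurableSpace (E n)] [∀ n, StandardBorelSpace (E n)] (π : ∀ n, Ω → E n)
    (hF : F = ⨆ n, MeasurableSpace.comap (π n) inferInstance)
    (hmono : Monotone fun n => MeasurableSpace.comap (π n) inferInstance)
    (hcoh : ∀ x : (n : ℕ) → E n, (∀ n, ∃ ω, ∀ i ≤ n, π i ω = x i) → ∃ ω, ∀ n, π n ω = x n)
    (hsurj : ∀ n, Function.Surjective (π n))
    (ρ : ℕ → Measure Ω) [∀ n, IsProbabilityMeasure (ρ n)]
    (hcons : ∀ n B, MeasurableSet[MeasurableSpace.comap (π n) inferInstance] B →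
      ρ (n + 1) B = ρ n B) :
    ∃ M : Measure Ω, ∀ n B, MeasurableSet[MeasurableSpace.comap (π n) inferInstance] B →
      M B = ρ n B := by
  have : ∀ n, Nonempty (E n) := fun n => ⟨π n (Classical.arbitrary Ω)⟩
  have hle : ∀ n, MeasurableSpace.comap (π n) inferInstance ≤ F := fun n => by
    rw [hF]; exact le_iSup (fun n => MeasurableSpace.comap (π n) inferInstance) n
  have hπ : ∀ n, Measurable (π n) := fun n => measurable_iff_comap_le.2 (hle n)
  have hmono' : ∀ n, ∀ i ≤ n, Measurable[MeasurableSpace.comap (π n) inferInstance] (π i) :=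
    fun n i hi => measurable_iff_comap_le.2 (hmono hi)
  obtain ⟨ν, hν⟩ := kolm_law E π hπ hmono' ρ hcons
  have hPi : ∀ n : ℕ, Measurable (fun ω i => π i ω : Ω → (i : Finset.Iic n) → E i) := fun n =>
    by exact measurable_pi_lambda _ fun i => hπ i
  -- transition maps
  have hq : ∀ n, ∃ q : E (n + 1) → E n, Measurable q ∧ π n = q ∘ π (n + 1) := fun n =>
    (hmono' (n + 1) n (Nat.le_succ n)).exists_eq_measurable_comp
  choose q hqm hq using hq
  have hL : ∀ᵐ x ∂ν, ∀ n, x n = q n (x (n + 1)) := by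
    rw [ae_all_iff]
    intro n
    have hm : MeasurableSet {y : (i : Finset.Iic (n + 1)) → E i |
        y ⟨n, Finset.mem_Iic.2 (Nat.le_succ n)⟩ =
          q n (y ⟨n + 1, Finset.mem_Iic.2 le_rfl⟩)}ᶜ := by
      refine (measurableSet_eq_fun (by fun_prop) ?_).compl
      exact (hqm n).comp (by fun_prop)
    have h0 : ν.map (Preorder.frestrictLe (π := E) (n + 1)) {y : (i : Finset.Iic (n + 1)) → E i |
        y ⟨n, Finset.mem_Iic.2 (Nat.le_succ n)⟩ =
          q n (y ⟨n + 1, Finset.mem_Iic.2 le_rfl⟩)}ᶜ = 0 := by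
      rw [hν (n + 1), Measure.map_apply (hPi _) hm]
      convert measure_empty (μ := ρ (n + 1))
      ext ω
      simp only [mem_preimage, mem_compl_iff, mem_ofPred_eq, mem_empty_iff_false, iff_false,
        not_not]
      exact congrFun (hq n) ω
    rw [Measure.map_apply (by fun_prop) hm] at h0
    rw [ae_iff]
    exact h0
  have hsec : ∀ x : (n : ℕ) → E n, ∃ ω : Ω, (∀ n, x n = q n (x (n + 1))) → ∀ n, π n ω = x n := by
    intro x
    by_cases hx : ∀ n, x n = q n (x (n + 1))
    · obtain ⟨ω, hω⟩ := hcoh x fun n => by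
        obtain ⟨ω, hω⟩ := hsurj n (x n)
        refine ⟨ω, fun i hi => ?_⟩
        induction hi using Nat.decreasingInduction with
        | self => exact hω
        | of_succ k hk ih => rw [hx k, ← ih, hq k]; rfl
      exact ⟨ω, fun _ => hω⟩
    · exact ⟨Classical.arbitrary Ω, fun h => absurd h hx⟩
  choose s hs using hsec
  -- the set of coherent sequences
  have hLm : MeasurableSet {x : (n : ℕ) → E n | ∀ n, x n = q n (x (n + 1))} := by
    simp only [ofPred_forall]
    exact MeasurableSet.iInter fun n =>
      measurableSet_eq_fun (by fun_prop) ((hqm n).comp (by fun_prop))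
  have hsae : AEMeasurable s ν := by
    classical
    let L : Set ((n : ℕ) → E n) := {x | ∀ n, x n = q n (x (n + 1))}
    let s' : ((n : ℕ) → E n) → Ω := fun x => if x ∈ L then s x else Classical.arbitrary Ω
    refine ⟨s', ?_, ?_⟩
    · rw [measurable_iff_comap_le, hF, MeasurableSpace.comap_iSup]
      refine iSup_le fun n => ?_
      rw [MeasurableSpace.comap_comp, ← measurable_iff_comap_le]
      have : π n ∘ s' = L.piecewise (fun x => x n) (fun _ => π n (Classical.arbitrary Ω)) := by
        ext x
        by_cases hx : x ∈ L
        · simp only [s', Function.comp, hx, if_true, Set.piecewise_eq_of_mem]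
          exact hs x hx n
        · simp [s', hx]
      rw [this]
      exact Measurable.piecewise hLm (measurable_pi_apply n) measurable_const
    · filter_upwards [hL] with x hx
      have : x ∈ L := hx
      simp [s', this]
  refine ⟨ν.map s, ?_⟩
  rintro n B ⟨C, hC, rfl⟩
  rw [Measure.map_apply_of_aemeasurable hsae (hπ n hC)]
  have : s ⁻¹' (π n ⁻¹' C) =ᵐ[ν] (fun x => x n) ⁻¹' C := by
    filter_upwards [hL] with x hx
    show (π n (s x) ∈ C) = (x n ∈ C)
    rw [hs x hx n]
  rw [measure_congr this]
  have e := hν n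
  have hm : MeasurableSet ((fun y : (i : Finset.Iic n) → E i =>
    y ⟨n, Finset.mem_Iic.2 le_rfl⟩) ⁻¹' C) := by
    exact (measurable_pi_apply _) hC
  have e' := congrArg (fun m => m ((fun y : (i : Finset.Iic n) → E i =>
    y ⟨n, Finset.mem_Iic.2 le_rfl⟩) ⁻¹' C)) e
  simp only at e'
  rw [Measure.map_apply (by fun_prop) hm, Measure.map_apply (hPi n) hm] at e'
  exact e'

end kolm

lemma ext_P_prob {Ω : Type} [Nonempty Ω] [F : MeasurableSpace Ω] {𝓕 : ℝ≥0 → MeasurableSpace Ω}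
    (hP : PropertyP F 𝓕) (ρ : ℕ → Measure Ω) [∀ n, IsProbabilityMeasure (ρ n)]
    (hcons : ∀ (n : ℕ) B, MeasurableSet[𝓕 n] B → ρ (n + 1) B = ρ n B) :
    ∃ M : Measure Ω, ∀ (n : ℕ) B, MeasurableSet[𝓕 n] B → M B = ρ n B := by
  obtain ⟨hmono, hF, -, hpol, hat⟩ := hP
  choose E τ hE π hsurj hcomap hsep using fun n : ℕ => hpol n
  let _ : ∀ n, MeasurableSpace (E n) := fun n => @borel (E n) (τ n)
  have : ∀ n, BorelSpace (E n) := fun n => ⟨rfl⟩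
  have : ∀ n, StandardBorelSpace (E n) := fun n => inferInstance
  have hF' : F = ⨆ n : ℕ, MeasurableSpace.comap (π n) inferInstance := by
    rw [hF]
    refine le_antisymm (iSup_le fun s => ?_) (iSup_le fun n => ?_)
    · obtain ⟨n, hn⟩ := exists_nat_ge s
      refine (hmono hn).trans ?_
      rw [hcomap n]
      exact le_iSup (fun n : ℕ => MeasurableSpace.comap (π n) inferInstance) n
    · have := hcomap n
      exact this.symm.le.trans (le_iSup 𝓕 (n : ℝ≥0))
  have hmono' : Monotone fun n : ℕ => MeasurableSpace.comap (π n) inferInstance := by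
    intro a b hab
    have := @hmono a b (by exact_mod_cast hab)
    rw [hcomap a, hcomap b] at this
    exact this
  have hcoh : ∀ x : (n : ℕ) → E n, (∀ n, ∃ ω, ∀ i ≤ n, π i ω = x i) →
      ∃ ω, ∀ n, π n ω = x n := by
    intro x hx
    choose w hw using hx
    obtain ⟨ω, hω⟩ := hat w fun N => by
      refine ⟨w N, ?_⟩
      simp only [Finset.mem_range, mem_iInter]
      intro n hn B hB
      obtain ⟨hB, hmem⟩ := hB
      rw [hcomap n] at hB
      obtain ⟨C, hC, rfl⟩ := hB
      show π n (w N) ∈ C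
      rw [hw N n (by omega), ← hw n n le_rfl]
      exact hmem
    refine ⟨ω, fun n => ?_⟩
    have h0 : MeasurableSet[𝓕 n] (π n ⁻¹' {x n}) := by
      rw [hcomap n]
      exact ⟨{x n}, measurableSet_singleton (x n), rfl⟩
    exact mem_iInter.1 hω n (π n ⁻¹' {x n}) ⟨h0, hw n n le_rfl⟩
  obtain ⟨M, hM⟩ := kolm_prob E π hF' hmono' hcoh hsurj ρ fun n B hB => by
    refine hcons n B ?_
    rw [hcomap n]
    exact hB
  refine ⟨M, fun n B hB => hM n B ?_⟩
  rw [hcomap n] at hB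
  exact hB

lemma ext_P {Ω : Type} [F : MeasurableSpace Ω] {𝓕 : ℝ≥0 → MeasurableSpace Ω}
    (hP : PropertyP F 𝓕) (ρ : ℕ → Measure Ω) [∀ n, IsFiniteMeasure (ρ n)]
    (hcons : ∀ (n : ℕ) B, MeasurableSet[𝓕 n] B → ρ (n + 1) B = ρ n B) :
    ∃ M : Measure Ω, ∀ (n : ℕ) B, MeasurableSet[𝓕 n] B → M B = ρ n B := by
  rcases isEmpty_or_nonempty Ω with hΩ | hΩ
  · refine ⟨0, fun n B _ => ?_⟩
    simp [Set.eq_empty_of_isEmpty B]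
  have hu : ∀ n, ρ n univ = ρ 0 univ := by
    intro n
    induction n with
    | zero => rfl
    | succ n ih => rw [← ih]; exact hcons n univ MeasurableSet.univ
  by_cases h0 : ρ 0 univ = 0
  · refine ⟨0, fun n B _ => ?_⟩
    have : ρ n = 0 := Measure.measure_univ_eq_zero.1 ((hu n).trans h0)
    simp [this]
  have htop : ρ 0 univ ≠ ∞ := measure_ne_top _ _
  have : ∀ n, IsProbabilityMeasure ((ρ 0 univ)⁻¹ • ρ n) := fun n => ⟨by
    rw [Measure.smul_apply, smul_eq_mul, hu n]
    exact ENNReal.inv_mul_cancel h0 htop⟩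
  obtain ⟨M, hM⟩ := ext_P_prob hP (fun n => (ρ 0 univ)⁻¹ • ρ n) fun n B hB => by
    rw [Measure.smul_apply, Measure.smul_apply, hcons n B hB]
  refine ⟨ρ 0 univ • M, fun n B hB => ?_⟩
  rw [Measure.smul_apply, hM n B hB, Measure.smul_apply, smul_eq_mul, smul_eq_mul, ← mul_assoc,
    ENNReal.mul_inv_cancel h0 htop, one_mul]

/-- Extension of a measure to a σ-algebra of eventually measurable sets. -/
lemma extend_measure {Ω : Type} {m m' : MeasurableSpace Ω} (l : Filter Ω)
    [CountableInterFilter l] (μ : @Measure Ω m) (hl : ae μ ≤ l)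
    (hm : m' ≤ eventuallyMeasurableSpace m l) :
    ∃ μ' : @Measure Ω m', ∀ B, MeasurableSet[m'] B → μ' B = μ B := by
  have hle : m' ≤ eventuallyMeasurableSpace m (ae μ) := by
    intro B hB
    obtain ⟨B', hB', h⟩ := hm B hB
    exact ⟨B', hB', hl h⟩
  have hle' : m' ≤ @NullMeasurableSpace.instMeasurableSpace Ω m μ := hle
  refine ⟨@Measure.trim Ω m' _ μ.completion hle', fun B hB => ?_⟩
  exact @trim_measurableSet_eq Ω m' (@NullMeasurableSpace.instMeasurableSpace Ω m μ) μ.completion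
    B hle' hB

/-- The filter of co-null sets generated by the filtration. -/
def nullFilter {Ω : Type} (X : FilteredProbabilitySpace Ω) : Filter Ω :=
  countableGenerate {S | ∃ s T, MeasurableSet[X.𝓕 s] T ∧ X.P T = 0 ∧ S = Tᶜ}

instance {Ω : Type} (X : FilteredProbabilitySpace Ω) : CountableInterFilter (nullFilter X) := by
  unfold nullFilter; infer_instance

lemma ae_le_nullFilter {Ω : Type} {X : FilteredProbabilitySpace Ω} {m : MeasurableSpace Ω}
    {μ : @Measure Ω m} (h : ∀ s T, MeasurableSet[X.𝓕 s] T → X.P T = 0 → μ T = 0) :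
    ae μ ≤ nullFilter X := by
  unfold nullFilter
  rw [le_countableGenerate_iff_of_countableInterFilter]
  rintro S ⟨s, T, hT, h0, rfl⟩
  show μ Tᶜᶜ = 0
  rw [compl_compl]
  exact h s T hT h0

lemma mem_nullFilter {Ω : Type} {X : FilteredProbabilitySpace Ω} {s : ℝ≥0} {T : Set Ω}
    (hT : MeasurableSet[X.𝓕 s] T) (h0 : X.P T = 0) : Tᶜ ∈ nullFilter X := by
  unfold nullFilter
  rw [mem_countableGenerate_iff]
  exact ⟨{Tᶜ}, by rintro _ rfl; exact ⟨s, T, hT, h0, rfl⟩, countable_singleton _, by simp⟩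

lemma exists_enlargement {Ω : Type} (X : FilteredProbabilitySpace Ω) :
    ∃ Z : FilteredProbabilitySpace Ω, ExtendsFPS Z X ∧ NaturalConditions Z ∧
      Z.F = eventuallyMeasurableSpace X.F (nullFilter X) ∧
      ∀ s, Z.𝓕 s = ⨅ (t : ℝ≥0) (_ : s < t), eventuallyMeasurableSpace (X.𝓕 t) (nullFilter X) := by
  have hae : ae X.P ≤ nullFilter X := ae_le_nullFilter fun s T _ h0 => h0
  have hmonoE : ∀ {m m' : MeasurableSpace Ω}, m ≤ m' →
      eventuallyMeasurableSpace m (nullFilter X) ≤ eventuallyMeasurableSpace m' (nullFilter X) := by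
    intro m m' h B hB
    obtain ⟨B', hB', hh⟩ := hB
    exact ⟨B', h _ hB', hh⟩
  obtain ⟨P', hP'⟩ := extend_measure (m' := eventuallyMeasurableSpace X.F (nullFilter X))
    (nullFilter X) X.P hae le_rfl
  have hX := X.prob
  let Z : FilteredProbabilitySpace Ω :=
    { F := eventuallyMeasurableSpace X.F (nullFilter X)
      𝓕 := fun s => ⨅ (t : ℝ≥0) (_ : s < t), eventuallyMeasurableSpace (X.𝓕 t) (nullFilter X)
      mono := fun a b hab => le_iInf₂ fun t ht => iInf₂_le t (hab.trans_lt ht)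
      le := fun s => (iInf₂_le (s + 1) (lt_add_one s)).trans (hmonoE (X.le _))
      P := P'
      prob := @IsProbabilityMeasure.mk _ (_) _ (by
        rw [hP' univ MeasurableSet.univ]; exact hX.measure_univ) }
  refine ⟨Z, ⟨?_, le_eventuallyMeasurableSpace, ?_⟩, ⟨?_, ?_⟩, rfl, fun s => rfl⟩
  · intro s
    exact le_iInf₂ fun t ht => (X.mono ht.le).trans le_eventuallyMeasurableSpace
  · intro A hA
    exact hP' A (le_eventuallyMeasurableSpace A hA)
  · intro s
    refine le_antisymm (le_iInf₂ fun t ht => le_iInf₂ fun u hu => iInf₂_le u (ht.trans hu))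
      (le_iInf₂ fun u hu => ?_)
    obtain ⟨t, h1, h2⟩ := exists_between hu
    exact (iInf₂_le t h1).trans (iInf₂_le u h2)
  · intro s A hA h0 B hBA
    obtain ⟨A', hA', he⟩ := (iInf₂_le (s + 1) (lt_add_one s) :
      Z.𝓕 s ≤ eventuallyMeasurableSpace (X.𝓕 (s + 1)) (nullFilter X)) A hA
    have hA0 : X.P A = 0 := by
      rw [← hP' A (Z.le s A hA)]; exact h0
    have hA'0 : X.P A' = 0 := by
      rw [← hA0]; exact (measure_congr (hae he)).symm
    have hB : B =ᶠ[nullFilter X] (∅ : Set Ω) := by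
      filter_upwards [mem_nullFilter hA' hA'0, he] with ω h1 h2
      refine propext ⟨fun h => ?_, fun h => absurd h (notMem_empty ω)⟩
      exact (h1 (h2.mp (hBA h))).elim
    have : ∀ t, MeasurableSet[eventuallyMeasurableSpace (X.𝓕 t) (nullFilter X)] B := fun t =>
      ⟨∅, @MeasurableSet.empty _ (X.𝓕 t), hB⟩
    show MeasurableSet[⨅ (t : ℝ≥0) (_ : (0 : ℝ≥0) < t),
      eventuallyMeasurableSpace (X.𝓕 t) (nullFilter X)] B
    simp only [MeasurableSpace.measurableSet_iInf]
    exact fun t _ => this t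

lemma ext_Y {Ω : Type} {Y : FilteredProbabilitySpace Ω} (hNP : PropertyNP Y)
    (μ : ℕ → @Measure Ω Y.F) (hfin : ∀ n, @IsFiniteMeasure Ω Y.F (μ n))
    (hac : ∀ n T, Y.P T = 0 → μ n T = 0)
    (hcons : ∀ (n : ℕ) B, MeasurableSet[Y.𝓕 n] B → μ (n + 1) B = μ n B) :
    ∃ R : @Measure Ω Y.F, ∀ (n : ℕ) B, MeasurableSet[Y.𝓕 n] B → R B = μ n B := by
  obtain ⟨X, hP, ⟨hE1, hE2, hE3⟩, hnat, hmin⟩ := hNP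
  obtain ⟨Z, hZX, hZn, hZF, hZ𝓕⟩ := exists_enlargement X
  obtain ⟨hm1, hm2, -⟩ := hmin Z hZX hZn
  have hYF : Y.F ≤ eventuallyMeasurableSpace X.F (nullFilter X) := hZF ▸ hm2
  have hY𝓕 : ∀ s, Y.𝓕 s ≤ eventuallyMeasurableSpace (X.𝓕 (s + 1)) (nullFilter X) := fun s => by
    refine (hm1 s).trans ?_
    rw [hZ𝓕 s]
    exact iInf₂_le (s + 1) (lt_add_one s)
  have hnull : ∀ n s T, MeasurableSet[X.𝓕 s] T → X.P T = 0 → μ n T = 0 := fun n s T hT h0 =>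
    hac n T (by rw [hE3 T (X.le s T hT)]; exact h0)
  have hfin' : ∀ n, @IsFiniteMeasure Ω X.F ((μ n).trim hE2) := fun n => by
    have := hfin n
    exact isFiniteMeasure_trim hE2
  obtain ⟨M, hM⟩ := @ext_P Ω X.F X.𝓕 hP (fun n => (μ n).trim hE2) hfin' fun n B hB => by
    rw [trim_measurableSet_eq hE2 (X.le _ B hB), trim_measurableSet_eq hE2 (X.le _ B hB)]
    exact hcons n B (hE1 _ B hB)
  have hM' : ∀ (n : ℕ) B, MeasurableSet[X.𝓕 n] B → M B = μ n B := fun n B hB => by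
    rw [hM n B hB, trim_measurableSet_eq hE2 (X.le _ B hB)]
  have haeM : ae M ≤ nullFilter X := ae_le_nullFilter fun s T hT h0 => by
    obtain ⟨n, hn⟩ := exists_nat_ge s
    rw [hM' n T (X.mono hn T hT)]
    exact hnull n s T hT h0
  obtain ⟨R, hR⟩ := extend_measure (m' := Y.F) (nullFilter X) M haeM hYF
  refine ⟨R, fun n B hB => ?_⟩
  obtain ⟨B', hB', he⟩ := hY𝓕 n B hB
  have hcast : ((n + 1 : ℕ) : ℝ≥0) = (n : ℝ≥0) + 1 := by push_cast; rfl
  rw [hR B (Y.le _ B hB), measure_congr (haeM he), hM' (n + 1) B' (by rw [hcast]; exact hB'),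
    ← hcons n B hB]
  exact (measure_congr (ae_le_nullFilter (hnull (n + 1)) he)).symm

lemma F_eq_iSup {Ω : Type} {Y : FilteredProbabilitySpace Ω} (hNP : PropertyNP Y) :
    Y.F = ⨆ s, Y.𝓕 s := by
  obtain ⟨X, hP, ⟨hE1, hE2, hE3⟩, hnat, hmin⟩ := hNP
  have hle : (⨆ s, Y.𝓕 s) ≤ Y.F := iSup_le Y.le
  have hY := Y.prob
  let W : FilteredProbabilitySpace Ω :=
    { F := ⨆ s, Y.𝓕 s
      𝓕 := Y.𝓕
      mono := Y.mono
      le := fun s => le_iSup Y.𝓕 s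
      P := Y.P.trim hle
      prob := @IsProbabilityMeasure.mk _ (_) _ (by
        rw [trim_measurableSet_eq hle MeasurableSet.univ]; exact hY.measure_univ) }
  have hXF : X.F ≤ ⨆ s, Y.𝓕 s := by
    rw [hP.2.1]
    exact iSup_mono hE1
  refine le_antisymm (hmin W ⟨hE1, hXF, ?_⟩ ⟨hnat.1, ?_⟩).2.1 hle
  · intro A hA
    show Y.P.trim hle A = _
    rw [trim_measurableSet_eq hle (hXF A hA)]
    exact hE3 A hA
  · intro s A hA h0
    refine hnat.2 s A hA ?_
    rw [← h0]
    exact (trim_measurableSet_eq hle (le_iSup Y.𝓕 s A hA)).symm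

section exist
variable {Ω : Type} [mΩ : MeasurableSpace Ω] {P : Measure Ω} [IsProbabilityMeasure P]
  {𝓕 : ℝ≥0 → MeasurableSpace Ω} {X N A : ℝ≥0 → Ω → ℝ}

/-- the set `{g ≤ s}` -/
def gle (X : ℝ≥0 → Ω → ℝ) (s : ℝ≥0) : Set Ω := {ω | lastZeroTime X ω ≤ (s : ℝ≥0∞)}

lemma mem_gle {s : ℝ≥0} {ω : Ω} : ω ∈ gle X s ↔ ∀ r, s < r → X r ω ≠ 0 := by
  simp only [gle, lastZeroTime, mem_ofPred_eq, iSup₂_le_iff, ENNReal.coe_le_coe]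
  constructor
  · intro h r hr h0
    exact absurd (h r h0) (not_le.2 hr)
  · intro h r h0
    by_contra hc
    exact h r (not_le.1 hc) h0

lemma gle_eq_iInter (s : ℝ≥0) : gle X s = ⋂ m : ℕ, nzS X s m := by
  ext ω
  simp only [mem_gle, mem_iInter]
  constructor
  · intro h m r hr _
    exact h r hr
  · intro h r hr
    obtain ⟨m, hm⟩ := exists_nat_ge r
    exact h m r hr hm

lemma nz_chain {s u w : ℝ≥0} (hsu : s ≤ u) (huw : u ≤ w) :
    nzS X s w = nzS X s u ∩ nzS X u w := by
  ext ω
  constructor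
  · intro h
    exact ⟨fun r h1 h2 => h r h1 (h2.trans huw), fun r h1 h2 => h r (hsu.trans_lt h1) h2⟩
  · rintro ⟨h1, h2⟩ r h3 h4
    rcases le_or_gt r u with h | h
    · exact h1 r h3 h
    · exact h2 r h h4

lemma gle_inter {s u : ℝ≥0} (hsu : s ≤ u) : gle X s = nzS X s u ∩ gle X u := by
  ext ω
  simp only [mem_inter_iff, mem_gle]
  constructor
  · intro h
    exact ⟨fun r h1 _ => h r h1, fun r h1 => h r (hsu.trans_lt h1)⟩
  · rintro ⟨h1, h2⟩ r h3
    rcases le_or_gt r u with h | h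
    · exact h1 r h3 h
    · exact h2 r h

lemma gle_mono {s u : ℝ≥0} (hsu : s ≤ u) : gle X s ⊆ gle X u := by
  rw [gle_inter hsu]; exact inter_subset_right

lemma gtop_eq : {ω : Ω | lastZeroTime X ω = ∞} = (⋃ n : ℕ, gle X (n : ℝ≥0))ᶜ := by
  ext ω
  simp only [mem_ofPred_eq, mem_compl_iff, mem_iUnion, not_exists, gle, not_le]
  constructor
  · intro h n
    rw [h]; exact ENNReal.coe_lt_top
  · intro h
    by_contra hc
    obtain ⟨n, hn⟩ := ENNReal.exists_nat_gt hc
    exact absurd (h n) (not_lt.2 (by exact_mod_cast hn.le))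

/-- starting sets -/
def BS (X : ℝ≥0 → Ω → ℝ) : ℕ → Set Ω
  | 0 => univ
  | n + 1 => (nzS X (n : ℝ≥0) ((n + 1 : ℕ) : ℝ≥0))ᶜ

/-- density measure -/
noncomputable def nuM (P : Measure Ω) (X : ℝ≥0 → Ω → ℝ) (s : ℝ≥0) : Measure Ω :=
  P.withDensity fun ω => ENNReal.ofReal (X s ω)

/-- Null-completeness property. -/
def NullC (P : Measure Ω) (𝓕 : ℝ≥0 → MeasurableSpace Ω) : Prop :=
  ∀ s D, MeasurableSet[𝓕 s] D → P D = 0 → ∀ B ⊆ D, MeasurableSet[𝓕 0] B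

lemma SD.nu_nz (h : SD P 𝓕 X N A) (hnull : NullC P 𝓕) {s u : ℝ≥0} (hsu : s ≤ u) {B : Set Ω}
    (hB : MeasurableSet[𝓕 s] B) : nuM P X u (B ∩ nzS X s u) = nuM P X s B := by
  unfold nuM
  rw [withDensity_apply _ (h.le s _ hB), withDensity_apply _
    ((h.le s _ hB).inter (h.le u _ (h.nz_meas hnull s u)))]
  exact h.nz_lintegral hsu hB

lemma SD.nu_fin (h : SD P 𝓕 X N A) (s : ℝ≥0) : IsFiniteMeasure (nuM P X s) :=
  isFiniteMeasure_withDensity_ofReal (h.intX s).2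

lemma nu_ac (s : ℝ≥0) {T : Set Ω} (hT : P T = 0) : nuM P X s T = 0 :=
  withDensity_absolutelyContinuous _ _ hT

lemma SD.BS_meas (h : SD P 𝓕 X N A) (hnull : NullC P 𝓕) (n : ℕ) :
    MeasurableSet[𝓕 n] (BS X n) := by
  cases n with
  | zero => exact MeasurableSet.univ
  | succ n => exact (h.nz_meas hnull _ _).compl

/-- Extension property. -/
def ExtP (P : Measure Ω) (𝓕 : ℝ≥0 → MeasurableSpace Ω) : Prop :=
  ∀ μ : ℕ → Measure Ω, (∀ n, IsFiniteMeasure (μ n)) → (∀ n T, P T = 0 → μ n T = 0) →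
    (∀ (n : ℕ) B, MeasurableSet[𝓕 n] B → μ (n + 1) B = μ n B) →
    ∃ R : Measure Ω, ∀ (n : ℕ) B, MeasurableSet[𝓕 n] B → R B = μ n B

lemma SD.exists_R (h : SD P 𝓕 X N A) (hnull : NullC P 𝓕) (hext : ExtP P 𝓕) (n : ℕ) :
    ∃ R : Measure Ω, ∀ m : ℕ, n ≤ m → ∀ B, MeasurableSet[𝓕 m] B →
      R B = nuM P X m (B ∩ (BS X n ∩ nzS X n m)) := by
  let μ : ℕ → Measure Ω := fun m =>
    (nuM P X ((max m n : ℕ) : ℝ≥0)).restrict (BS X n ∩ nzS X n ((max m n : ℕ) : ℝ≥0))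
  have hfin : ∀ m, IsFiniteMeasure (μ m) := fun m => by
    have := h.nu_fin ((max m n : ℕ) : ℝ≥0)
    dsimp only [μ]
    infer_instance
  have hac : ∀ m T, P T = 0 → μ m T = 0 := fun m T hT =>
    le_antisymm ((Measure.restrict_apply_le _ _).trans (nu_ac _ hT).le) zero_le
  have hcons : ∀ (m : ℕ) B, MeasurableSet[𝓕 m] B → μ (m + 1) B = μ m B := by
    intro m B hB
    dsimp only [μ]
    rw [Measure.restrict_apply (h.le _ _ hB), Measure.restrict_apply (h.le _ _ hB)]
    rcases le_or_gt n m with hm | hm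
    · rw [max_eq_left hm, max_eq_left (hm.trans (Nat.le_succ m))]
      have c1 : (n : ℝ≥0) ≤ m := by exact_mod_cast hm
      have c2 : (m : ℝ≥0) ≤ ((m + 1 : ℕ) : ℝ≥0) := by exact_mod_cast Nat.le_succ m
      rw [nz_chain c1 c2, ← inter_assoc, ← inter_assoc]
      have hB' : MeasurableSet[𝓕 m] (B ∩ BS X n ∩ nzS X n m) :=
        (hB.inter (h.mono c1 _ (h.BS_meas hnull n))).inter (h.nz_meas hnull _ _)
      rw [h.nu_nz hnull c2 hB', inter_assoc]
    · rw [max_eq_right hm.le, max_eq_right (Nat.succ_le_of_lt hm)]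
  obtain ⟨R, hR⟩ := hext μ hfin hac hcons
  refine ⟨R, fun m hm B hB => ?_⟩
  rw [hR m B hB]
  dsimp only [μ]
  rw [Measure.restrict_apply (h.le _ _ hB), max_eq_left hm]

lemma SD.gle_meas (h : SD P 𝓕 X N A) (hnull : NullC P 𝓕) (s : ℝ≥0) : MeasurableSet (gle X s) := by
  rw [gle_eq_iInter]
  exact MeasurableSet.iInter fun m => h.le _ _ (h.nz_meas hnull _ _)

lemma SD.exists_Q (h : SD P 𝓕 X N A) (hnull : NullC P 𝓕) (hext : ExtP P 𝓕) :
    ∃ Q : Measure Ω, Q {ω | lastZeroTime X ω = ∞} = 0 ∧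
      ∀ s B, MeasurableSet[𝓕 s] B → Q (B ∩ gle X s) = nuM P X s B := by
  choose R hR using h.exists_R hnull hext
  have hg : ∀ n, R n (gle X n)ᶜ = 0 := by
    intro n
    rw [gle_eq_iInter, compl_iInter]
    refine measure_iUnion_null fun m => ?_
    have c1 : (n : ℝ≥0) ≤ ((max m n : ℕ) : ℝ≥0) := by exact_mod_cast le_max_right m n
    have c2 : (m : ℝ≥0) ≤ ((max m n : ℕ) : ℝ≥0) := by exact_mod_cast le_max_left m n
    have : (nzS X n m)ᶜ ⊆ (nzS X n ((max m n : ℕ) : ℝ≥0))ᶜ := by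
      refine compl_subset_compl.2 fun ω hω r h1 h2 => hω r h1 (h2.trans c2)
    refine measure_mono_null this ?_
    rw [hR n (max m n) (le_max_right m n) _ (h.nz_meas hnull _ _).compl]
    convert measure_empty (μ := nuM P X ((max m n : ℕ) : ℝ≥0))
    ext ω
    simp only [mem_inter_iff, mem_compl_iff, mem_empty_iff_false]
    tauto
  have hb : ∀ n, R n (BS X n)ᶜ = 0 := by
    intro n
    rw [hR n n le_rfl _ (h.BS_meas hnull n).compl]
    convert measure_empty (μ := nuM P X n)
    ext ω
    simp only [mem_inter_iff, mem_compl_iff, mem_empty_iff_false]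
    tauto
  have hsum : ∀ k m : ℕ, k ≤ m → ∀ B, MeasurableSet[𝓕 m] B →
      ∑ n ∈ Finset.range (k + 1), R n B = nuM P X m (B ∩ nzS X k m) := by
    intro k
    induction k with
    | zero =>
      intro m hm B hB
      rw [Finset.sum_range_one, hR 0 m hm B hB]
      simp [BS]
    | succ k ih =>
      intro m hm B hB
      rw [Finset.sum_range_succ, ih m (by omega) B hB, hR (k + 1) m hm B hB]
      have c1 : (k : ℝ≥0) ≤ ((k + 1 : ℕ) : ℝ≥0) := by exact_mod_cast Nat.le_succ k
      have c2 : ((k + 1 : ℕ) : ℝ≥0) ≤ m := by exact_mod_cast hm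
      rw [nz_chain c1 c2]
      rw [← measure_inter_add_sdiff (B ∩ nzS X ((k + 1 : ℕ) : ℝ≥0) m)
        (h.le _ _ (h.nz_meas hnull k ((k + 1 : ℕ) : ℝ≥0)))]
      congr 2
      · ext ω
        simp only [mem_inter_iff]
        tauto
      · ext ω
        simp only [mem_inter_iff, BS, Set.mem_sdiff, mem_compl_iff]
        tauto
  refine ⟨Measure.sum R, ?_, ?_⟩
  · rw [Measure.sum_apply_eq_zero]
    intro n
    refine measure_mono_null ?_ (hg n)
    rw [gtop_eq]
    exact compl_subset_compl.2 (subset_iUnion (fun n : ℕ => gle X (n : ℝ≥0)) n)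
  · intro s B hB
    have hBm : MeasurableSet B := h.le _ _ hB
    obtain ⟨k, hk⟩ := exists_nat_ge s
    rw [Measure.sum_apply _ (hBm.inter (h.gle_meas hnull s))]
    have hzero : ∀ n ∉ Finset.range (k + 1), R n (B ∩ gle X s) = 0 := by
      intro n hn
      obtain ⟨j, rfl⟩ : ∃ j, n = j + 1 := ⟨n - 1, by simp at hn; omega⟩
      have hj : k ≤ j := by simp at hn; omega
      refine measure_mono_null ?_ (hb (j + 1))
      rintro ω ⟨-, hω⟩
      simp only [BS, compl_compl]
      have hsj : s ≤ j := hk.trans (by exact_mod_cast hj)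
      exact fun r h1 _ => mem_gle.1 hω r (hsj.trans_lt h1)
    rw [tsum_eq_sum hzero]
    have hRfin : ∀ n, IsFiniteMeasure (R n) := fun n => ⟨by
      rw [hR n n le_rfl univ MeasurableSet.univ]
      have := h.nu_fin (n : ℝ≥0)
      exact measure_lt_top _ _⟩
    have hlim : ∀ n ∈ Finset.range (k + 1), Tendsto (fun m : ℕ => R n (B ∩ nzS X s m)) atTop
        (nhds (R n (B ∩ gle X s))) := by
      intro n _
      rw [gle_eq_iInter, inter_iInter]
      refine tendsto_measure_iInter_atTop (fun m => ?_) ?_ ⟨0, measure_ne_top _ _⟩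
      · exact (hBm.inter (h.le _ _ (h.nz_meas hnull _ _))).nullMeasurableSet
      · intro a b hab
        refine inter_subset_inter_right _ fun ω hω r h1 h2 => hω r h1 (h2.trans ?_)
        exact_mod_cast hab
    have hl := tendsto_finsetSum _ hlim
    refine tendsto_nhds_unique hl ?_
    refine tendsto_const_nhds.congr' ?_
    filter_upwards [eventually_ge_atTop k] with m hm
    have hkm : (k : ℝ≥0) ≤ m := by exact_mod_cast hm
    have hB' : MeasurableSet[𝓕 m] (B ∩ nzS X s m) :=
      (h.mono (hk.trans hkm) _ hB).inter (h.nz_meas hnull _ _)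
    rw [hsum k m hm _ hB']
    have : B ∩ nzS X s m ∩ nzS X k m = B ∩ nzS X s m := by
      refine inter_eq_left.2 ?_
      rintro ω ⟨-, hω⟩ r h1 h2
      exact hω r (hk.trans_lt h1) h2
    rw [this, h.nu_nz hnull (hk.trans hkm) hB]

end exist

section uniq
variable {Ω : Type} [mΩ : MeasurableSpace Ω] {P : Measure Ω} [IsProbabilityMeasure P]
  {𝓕 : ℝ≥0 → MeasurableSpace Ω} {X N A : ℝ≥0 → Ω → ℝ}

/-- The integral characterisation. -/
def IntC (P : Measure Ω) (𝓕 : ℝ≥0 → MeasurableSpace Ω) (X : ℝ≥0 → Ω → ℝ) (Q : Measure Ω) : Prop :=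
  ∀ s : ℝ≥0, ∀ G : Ω → ℝ, Measurable[𝓕 s] G → (∃ M : ℝ, ∀ ω : Ω, |G ω| ≤ M) →
    ∫ ω in gle X s, G ω ∂Q = ∫ ω, G ω * X s ω ∂P

lemma SD.intC_of (h : SD P 𝓕 X N A) {Q : Measure Ω}
    (hQ : ∀ s B, MeasurableSet[𝓕 s] B → Q (B ∩ gle X s) = nuM P X s B) : IntC P 𝓕 X Q := by
  intro s G hG _
  have hfin := h.nu_fin s
  have htrim : (Q.restrict (gle X s)).trim (h.le s) = (nuM P X s).trim (h.le s) := by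
    refine @Measure.ext _ (𝓕 s) _ _ fun B hB => ?_
    rw [trim_measurableSet_eq _ hB, trim_measurableSet_eq _ hB,
      Measure.restrict_apply (h.le s _ hB), hQ s B hB]
  rw [integral_trim (h.le s) hG.stronglyMeasurable, htrim,
    ← integral_trim (h.le s) hG.stronglyMeasurable]
  unfold nuM
  rw [integral_withDensity_eq_integral_toReal_smul
    ((h.measX s).mono (h.le s) le_rfl).ennreal_ofReal (ae_of_all _ fun _ => ENNReal.ofReal_lt_top)]
  refine integral_congr_ae (ae_of_all _ fun ω => ?_)
  simp only [smul_eq_mul]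
  rw [ENNReal.toReal_ofReal (h.nonneg s ω), mul_comm]

lemma SD.sigmaFinite_of (h : SD P 𝓕 X N A) (hnull : NullC P 𝓕) {Q : Measure Ω}
    (h0 : Q {ω | lastZeroTime X ω = ∞} = 0)
    (hQ : ∀ s, Q (gle X s) < ∞) : SigmaFinite Q := by
  refine ⟨⟨⟨fun n => gle X (n : ℝ≥0) ∪ (⋃ k : ℕ, gle X (k : ℝ≥0))ᶜ, fun _ => trivial, fun n => ?_, ?_⟩⟩⟩
  · rw [gtop_eq] at h0
    refine (measure_union_le _ _).trans_lt ?_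
    rw [h0, add_zero]
    exact hQ n
  · rw [← iUnion_union, union_compl_self]

lemma IntC.ind {Q : Measure Ω} (hle : ∀ s, 𝓕 s ≤ mΩ) (hQ : IntC P 𝓕 X Q) {s : ℝ≥0} {C : Set Ω}
    (hC : MeasurableSet[𝓕 s] C) : Q.real (C ∩ gle X s) = ∫ ω in C, X s ω ∂P := by
  have hCm : MeasurableSet C := hle s _ hC
  have := hQ s (C.indicator fun _ => 1) (Measurable.indicator measurable_const hC) ⟨1, fun ω => by
    by_cases hω : ω ∈ C <;> simp [hω]⟩
  rw [integral_indicator hCm, Measure.restrict_restrict hCm] at this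
  simp only [integral_const, smul_eq_mul, mul_one, measureReal_restrict_apply_univ] at this
  rw [this, ← integral_indicator hCm]
  refine integral_congr_ae (ae_of_all _ fun ω => ?_)
  by_cases hω : ω ∈ C <;> simp [hω]

lemma SD.gle_fin (h : SD P 𝓕 X N A) (hnull : NullC P 𝓕) {Q : Measure Ω} [SigmaFinite Q]
    (hQ : IntC P 𝓕 X Q) (s : ℝ≥0) : Q (gle X s) < ∞ := by
  by_contra hc
  have htop : Q (gle X s) = ∞ := not_lt_top_iff.1 hc
  have htop' : Q (gle X (s + 1)) = ∞ :=
    top_le_iff.1 (htop ▸ measure_mono (gle_mono (le_add_of_nonneg_right zero_le_one)))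
  have e1 := hQ.ind h.le (s := s + 1) (C := univ) MeasurableSet.univ
  rw [univ_inter, measureReal_def, htop', Measure.restrict_univ] at e1
  have e2 : X (s + 1) =ᵐ[P] 0 := by
    rw [← integral_eq_zero_iff_of_nonneg (fun ω => h.nonneg _ ω) (h.intX _)]
    simpa using e1.symm
  have hD : P {ω | X (s + 1) ω ≠ 0} = 0 := by
    simpa [Filter.EventuallyEq, ae_iff] using e2
  have hDm : MeasurableSet[𝓕 (s + 1)] {ω | X (s + 1) ω ≠ 0} :=
    (ms_eq (𝓕 (s + 1)) (h.measX _) measurable_const).compl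
  obtain ⟨C, hCm, hCs, hC0, hC1⟩ := Measure.exists_subset_measure_lt_top
    (μ := Q) (h.gle_meas hnull s) (r := 0) (by rw [htop]; exact ENNReal.zero_lt_top)
  have hs : gle X s ⊆ {ω | X (s + 1) ω ≠ 0} := fun ω hω =>
    mem_gle.1 hω (s + 1) (lt_add_of_pos_right s one_pos)
  have hC : MeasurableSet[𝓕 0] C := hnull _ _ hDm hD C (hCs.trans hs)
  have e3 := hQ.ind h.le (s := s) (C := C) (h.mono zero_le _ hC)
  rw [inter_eq_left.2 hCs, Measure.restrict_eq_zero.2 (measure_mono_null (hCs.trans hs) hD),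
    integral_zero_measure, measureReal_def, ENNReal.toReal_eq_zero_iff] at e3
  rcases e3 with e | e
  · exact hC0.ne' e
  · exact hC1.ne e

lemma SD.meas_of_intC (h : SD P 𝓕 X N A) (hnull : NullC P 𝓕) {Q : Measure Ω} [SigmaFinite Q]
    (hQ : IntC P 𝓕 X Q) (s : ℝ≥0) (B : Set Ω) (hB : MeasurableSet[𝓕 s] B) :
    Q (B ∩ gle X s) = nuM P X s B := by
  have hf : Q (B ∩ gle X s) ≠ ∞ :=
    ((measure_mono inter_subset_right).trans_lt (h.gle_fin hnull hQ s)).ne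
  have e := hQ.ind h.le hB
  unfold nuM
  rw [withDensity_apply _ (h.le s _ hB), ← ofReal_integral_eq_lintegral_ofReal
    (h.intX s).integrableOn (ae_of_all _ fun ω => h.nonneg s ω), ← e, measureReal_def,
    ENNReal.ofReal_toReal hf]

lemma SD.meas_uniq (h : SD P 𝓕 X N A) (hnull : NullC P 𝓕) (hF : mΩ = ⨆ s, 𝓕 s)
    {Q Q' : Measure Ω} (h0 : Q {ω | lastZeroTime X ω = ∞} = 0)
    (h0' : Q' {ω | lastZeroTime X ω = ∞} = 0)
    (hQ : ∀ s B, MeasurableSet[𝓕 s] B → Q (B ∩ gle X s) = nuM P X s B)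
    (hQ' : ∀ s B, MeasurableSet[𝓕 s] B → Q' (B ∩ gle X s) = nuM P X s B) : Q = Q' := by
  have key : ∀ R : Measure Ω, (∀ s B, MeasurableSet[𝓕 s] B → R (B ∩ gle X s) = nuM P X s B) →
      ∀ (n s : ℝ≥0) B, MeasurableSet[𝓕 s] B → R (B ∩ gle X n) =
        nuM P X (max s n) (B ∩ nzS X n (max s n)) := by
    intro R hR n s B hB
    rw [gle_inter (le_max_right s n), ← inter_assoc]
    exact hR _ _ ((h.mono (le_max_left s n) _ hB).inter (h.nz_meas hnull _ _))
  have hr : ∀ n : ℕ, Q.restrict (gle X (n : ℝ≥0)) = Q'.restrict (gle X (n : ℝ≥0)) := by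
    intro n
    have hfin : IsFiniteMeasure (Q.restrict (gle X (n : ℝ≥0))) := ⟨by
      have := h.nu_fin (n : ℝ≥0)
      rw [Measure.restrict_apply MeasurableSet.univ, hQ _ _ MeasurableSet.univ]
      exact measure_lt_top _ _⟩
    refine ext_of_generate_finite {B | ∃ s, MeasurableSet[𝓕 s] B} ?_ ?_ ?_ ?_
    · exact hF.trans (MeasurableSpace.generateFrom_iUnion_measurableSet 𝓕 ▸ by
        congr 1; ext B; simp)
    · rintro B ⟨s, hB⟩ C ⟨t, hC⟩ -
      exact ⟨max s t, (h.mono (le_max_left s t) _ hB).inter (h.mono (le_max_right s t) _ hC)⟩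
    · rintro B ⟨s, hB⟩
      rw [Measure.restrict_apply (h.le s _ hB), Measure.restrict_apply (h.le s _ hB),
        key Q hQ _ _ _ hB, key Q' hQ' _ _ _ hB]
    · rw [Measure.restrict_apply MeasurableSet.univ, Measure.restrict_apply MeasurableSet.univ,
        hQ _ _ MeasurableSet.univ, hQ' _ _ MeasurableSet.univ]
  have hU := Measure.restrict_iUnion_congr.2 hr
  rw [gtop_eq] at h0 h0'
  have e1 : Q.restrict (⋃ n : ℕ, gle X (n : ℝ≥0)) = Q :=
    Measure.restrict_eq_self_of_ae_mem (mem_ae_iff.2 h0)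
  have e2 : Q'.restrict (⋃ n : ℕ, gle X (n : ℝ≥0)) = Q' :=
    Measure.restrict_eq_self_of_ae_mem (mem_ae_iff.2 h0')
  exact e1.symm.trans (hU.trans e2)

lemma SD.main (h : SD P 𝓕 X N A) (hnull : NullC P 𝓕) (hext : ExtP P 𝓕) (hF : mΩ = ⨆ s, 𝓕 s) :
    ∃! Q : Measure Ω, SigmaFinite Q ∧ Q {ω : Ω | lastZeroTime X ω = ∞} = 0 ∧ IntC P 𝓕 X Q := by
  obtain ⟨Q, hQ0, hQ⟩ := h.exists_Q hnull hext
  refine ⟨Q, ⟨?_, hQ0, h.intC_of hQ⟩, ?_⟩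
  · refine h.sigmaFinite_of hnull hQ0 fun s => ?_
    have := h.nu_fin s
    have e := hQ s univ MeasurableSet.univ
    rw [univ_inter] at e
    rw [e]
    exact measure_lt_top _ _
  · rintro Q' ⟨hs, h0, hI⟩
    exact h.meas_uniq hnull hF h0 hQ0 (h.meas_of_intC hnull hI) hQ

end uniq

lemma SD.of_classSigma {Ω : Type} (Y : FilteredProbabilitySpace Ω) (X N A : ℝ≥0 → Ω → ℝ)
    (hnonneg : ∀ s : ℝ≥0, ∀ ω : Ω, 0 ≤ X s ω)
    (hadapted : ∀ s : ℝ≥0, Measurable[Y.𝓕 s] (X s))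
    (hint : ∀ s : ℝ≥0, MeasureTheory.Integrable (X s) Y.P)
    (hSigma : IsClassSigma Y X N A) : @SD Ω Y.F Y.P Y.𝓕 X N A := by
  letI : MeasurableSpace Ω := Y.F
  haveI : IsProbabilityMeasure Y.P := Y.prob
  obtain ⟨heq, ⟨hNm, hNi, hNc, hNr⟩, hAm, hAc, hAmo, -, μA, hμ, -, hcar⟩ := hSigma
  refine ⟨Y.mono, Y.le, hnonneg, hadapted, hAm, hint, hNi, fun s => ?_, fun s t hst B hB => ?_,
    heq, fun ω s => ?_, hAc, hAmo, ?_⟩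
  · refine ((hint s).sub (hNi s)).congr (ae_of_all _ fun ω => ?_)
    simp [heq s ω]
  · rw [← setIntegral_condExp (Y.le s) (hNi t) hB]
    exact integral_congr_ae (ae_restrict_of_ae (hNc s t hst))
  · simp only [heq]
    exact (hNr ω s).1.add ((hAc ω).tendsto s |>.mono_left nhdsWithin_le_nhds)
  · filter_upwards [hcar] with ω hω v s hvs
    have hv : v ≤ s := by
      by_contra hc
      exact absurd (hAmo ω (not_le.1 hc).le) (not_le.2 hvs)
    by_contra hc
    push Not at hc
    have h1 : μA ω (Ioc v s) = 0 :=
      measure_mono_null (fun w hw => hc w hw.1 hw.2) hω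
    rw [hμ ω v s hv, ENNReal.ofReal_eq_zero] at h1
    linarith

theorem sigma_finite_measure_associated_with_class_sigma_submartingale
    {Ω : Type} (Y : FilteredProbabilitySpace Ω) (hNP : PropertyNP Y)
    (X N A : ℝ≥0 → Ω → ℝ)
    (hnonneg : ∀ s : ℝ≥0, ∀ ω : Ω, 0 ≤ X s ω)
    (hadapted : ∀ s : ℝ≥0, Measurable[Y.𝓕 s] (X s))
    (hint : ∀ s : ℝ≥0, MeasureTheory.Integrable (X s) Y.P)
    (hsub : ∀ s t : ℝ≥0, s ≤ t →
      (letI : MeasurableSpace Ω := Y.F; X s ≤ᵐ[Y.P] Y.P[X t | Y.𝓕 s]))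
    (hSigma : IsClassSigma Y X N A) :
    ∃! Q : @MeasureTheory.Measure Ω Y.F,
      @MeasureTheory.SigmaFinite Ω Y.F Q ∧
      Q {ω : Ω | lastZeroTime X ω = ∞} = 0 ∧
      ∀ s : ℝ≥0, ∀ G : Ω → ℝ, Measurable[Y.𝓕 s] G → (∃ M : ℝ, ∀ ω : Ω, |G ω| ≤ M) →
        ∫ ω in {ω : Ω | lastZeroTime X ω ≤ (s : ℝ≥0∞)}, G ω ∂Q
          = ∫ ω, G ω * X s ω ∂Y.P := by
  letI : MeasurableSpace Ω := Y.F
  haveI : IsProbabilityMeasure Y.P := Y.prob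
  have h := SD.of_classSigma Y X N A hnonneg hadapted hint hSigma
  have hnull : NullC Y.P Y.𝓕 := by
    obtain ⟨Z, -, hZ⟩ := hNP
    exact hZ.2.1.2
  have hext : ExtP Y.P Y.𝓕 := fun μ h1 h2 h3 => ext_Y hNP μ h1 h2 h3
  exact h.main hnull hext (F_eq_iSup hNP)
end

section
/- Let (Ω, F, (F_s)_{s≥0}) be a filtered measurable space satisfying property (P), and for each s ≥ 0 let Q_s be a probability measure on (Ω, F_s) such that for all t ≥ s ≥ 0 the restriction of Q_t to F_s equals Q_s. Then there exists a unique measure Q_∞ on (Ω, F) whose restriction to F_s equals Q_s for every s ≥ 0. -/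
open MeasureTheory Filter Set
open scoped NNReal ENNReal

open ProbabilityTheory in
lemma exists_projLimit_aux {X : ℕ → Type} [∀ n, MeasurableSpace (X n)]
    [∀ n, StandardBorelSpace (X n)] [∀ n, Nonempty (X n)]
    (g : ∀ n, X (n + 1) → X n) (hg : ∀ n, Measurable (g n))
    (μ : ∀ n, Measure (X n)) [∀ n, IsProbabilityMeasure (μ n)]
    (hμ : ∀ n, (μ (n + 1)).map (g n) = μ n) :
    ∃ P : Measure (∀ n, X n), (∀ n, P.map (fun x => x n) = μ n) ∧
      ∀ᵐ x ∂P, ∀ n, x n = g n (x (n + 1)) := by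
  let ev : ∀ n, (∀ i : Finset.Iic n, X i) → X n := fun n x => x ⟨n, Finset.mem_Iic.2 le_rfl⟩
  have hev : ∀ n, Measurable (ev n) := fun n => measurable_pi_apply _
  let η : ∀ n, Kernel (X n) (X (n + 1)) := fun n => condDistrib id (g n) (μ (n + 1))
  let κ : ∀ n, Kernel (∀ i : Finset.Iic n, X i) (X (n + 1)) := fun n => (η n).comap (ev n) (hev n)
  have : ∀ n, IsMarkovKernel (κ n) := fun n => by dsimp only [κ]; infer_instance
  have hη : ∀ n, μ n ⊗ₘ η n = (μ (n + 1)).map (fun y => (g n y, y)) := by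
    intro n
    have := compProd_map_condDistrib (mβ := inferInstance) (μ := μ (n + 1)) (X := g n) (Y := id)
      (by fun_prop)
    rw [hμ] at this
    exact this
  let P := Kernel.trajMeasure (μ 0) κ
  have key : ∀ n, P.map (fun x => x n) = μ n →
      P.map (fun x => (x n, x (n + 1))) = (μ (n + 1)).map (fun y => (g n y, y)) := by
    intro n hn
    have h1 := Kernel.map_frestrictLe_trajMeasure_compProd_eq_map_trajMeasure
      (μ₀ := μ 0) (κ := κ) (a := n)
    rw [← hη, ← hn]
    have h2 : P.map (fun x => (x n, x (n + 1))) =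
        (P.map (fun x ↦ (Preorder.frestrictLe n x, x (n + 1)))).map (Prod.map (ev n) id) := by
      rw [Measure.map_map (by fun_prop) (by fun_prop)]
      rfl
    rw [h2, ← h1]
    have h3 : P.map (fun x => x n) = (P.map (Preorder.frestrictLe n)).map (ev n) := by
      rw [Measure.map_map (by fun_prop) (by fun_prop)]
      rfl
    rw [h3]
    have : IsProbabilityMeasure P := by dsimp only [P]; infer_instance
    ext s hs
    rw [Measure.map_apply (by fun_prop) hs, Measure.compProd_apply (by measurability),
      Measure.compProd_apply hs, lintegral_map (g := ev n)]
    · rfl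
    · exact Kernel.measurable_kernel_prodMk_left hs
    · exact hev n
  have hmarg : ∀ n, P.map (fun x => x n) = μ n := by
    intro n
    induction n with
    | zero =>
      have h3 : P.map (fun x => x 0) = (P.map (Preorder.frestrictLe 0)).map (ev 0) := by
        rw [Measure.map_map (by fun_prop) (by fun_prop)]
        rfl
      rw [h3]
      dsimp only [P]
      rw [Kernel.trajMeasure, Measure.map_comp _ _ (by fun_prop), Kernel.traj_map_frestrictLe,
        Kernel.partialTraj_self, Measure.id_comp]
      exact (Measure.map_map (hev 0)
        (MeasurableEquiv.piUnique fun i : Finset.Iic 0 => X i).symm.measurable).trans Measure.map_id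
    | succ n ih =>
      have h := congrArg (Measure.map Prod.snd) (key n ih)
      have hgn := hg n
      rw [Measure.map_map (by fun_prop) (by fun_prop),
        Measure.map_map (by fun_prop) (by fun_prop)] at h
      exact h.trans Measure.map_id
  refine ⟨P, hmarg, ae_all_iff.2 fun n => ?_⟩
  have hgn := hg n
  have hS : MeasurableSet {p : X n × X (n + 1) | p.1 = g n p.2} :=
    measurableSet_eq_fun (by fun_prop) (by fun_prop)
  have h : ∀ᵐ p ∂(P.map (fun x => (x n, x (n + 1)))), p.1 = g n p.2 := by
    rw [key n (hmarg n), ae_map_iff (by fun_prop) hS]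
    simp
  exact (ae_map_iff (by fun_prop) hS).1 h

lemma exists_measure_aux {Ω : Type} {X : ℕ → Type} [mX : ∀ n, MeasurableSpace (X n)]
    [∀ n, StandardBorelSpace (X n)] (π : ∀ n, Ω → X n)
    (hsurj : ∀ n, Function.Surjective (π n))
    (hm : ∀ n, (mX n).comap (π n) ≤ (mX (n + 1)).comap (π (n + 1)))
    (hseq : ∀ x : ∀ n, X n, (∀ N, ∃ ω, ∀ n ≤ N, π n ω = x n) → ∃ ω, ∀ n, π n ω = x n)
    (μ : ∀ n, Measure (X n)) [∀ n, IsProbabilityMeasure (μ n)]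
    (hμ : ∀ n (B : Set (X n)) (B' : Set (X (n + 1))), MeasurableSet B → MeasurableSet B' →
      π n ⁻¹' B = π (n + 1) ⁻¹' B' → μ n B = μ (n + 1) B') :
    ∃ P : @Measure Ω (⨆ n, (mX n).comap (π n)), ∀ n B, MeasurableSet B →
      P (π n ⁻¹' B) = μ n B := by
  classical
  have hne : ∀ n, Nonempty (X n) := fun n => (μ n).nonempty_of_neZero
  have : Nonempty Ω := ⟨(hsurj 0 (hne 0).some).choose⟩
  have hfac : ∀ n, ∃ h : X (n + 1) → X n, Measurable h ∧ π n = h ∘ π (n + 1) := by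
    intro n
    exact Measurable.exists_eq_measurable_comp
      (measurable_iff_comap_le.2 (hm n))
  choose g hg hgπ using hfac
  have hmap : ∀ n, (μ (n + 1)).map (g n) = μ n := by
    intro n
    ext B hB
    rw [Measure.map_apply (hg n) hB]
    refine (hμ n B _ hB (hg n hB) ?_).symm
    rw [hgπ n]; rfl
  obtain ⟨P, hP, hae⟩ := exists_projLimit_aux g hg μ hmap
  set C : Set (∀ n, X n) := {x | ∀ n, x n = g n (x (n + 1))} with hC
  have hCm : MeasurableSet C := by
    rw [hC, ofPred_forall]
    refine MeasurableSet.iInter fun n => ?_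
    have := hg n
    exact measurableSet_eq_fun (by fun_prop) (by fun_prop)
  have hlift : ∀ x ∈ C, ∃ ω, ∀ n, π n ω = x n := by
    intro x hx
    refine hseq x fun N => ?_
    obtain ⟨ω, hω⟩ := hsurj N (x N)
    refine ⟨ω, fun n hn => ?_⟩
    induction hn using Nat.decreasingInduction with
    | self => exact hω
    | of_succ k hk ih => rw [hgπ k, Function.comp_apply, ih, ← hx k]
  let ω₀ : Ω := Classical.arbitrary Ω
  let σ : (∀ n, X n) → Ω := fun x => if h : x ∈ C then (hlift x h).choose else ω₀
  have hσ : ∀ x ∈ C, ∀ n, π n (σ x) = x n := by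
    intro x hx
    simp only [σ, dif_pos hx]
    exact (hlift x hx).choose_spec
  have hσ' : ∀ x ∉ C, σ x = ω₀ := fun x hx => by simp only [σ, dif_neg hx]
  let mΩ : MeasurableSpace Ω := ⨆ n, (mX n).comap (π n)
  have hπm : ∀ n, Measurable (π n) := fun n =>
    measurable_iff_comap_le.2 (le_iSup (fun n => (mX n).comap (π n)) n)
  have hσm : Measurable σ := by
    rw [measurable_iff_comap_le]
    simp only [mΩ, MeasurableSpace.comap_iSup, MeasurableSpace.comap_comp]
    refine iSup_le fun n => measurable_iff_comap_le.1 ?_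
    have : π n ∘ σ = C.piecewise (fun x => x n) (fun _ => π n ω₀) := by
      ext x
      by_cases hx : x ∈ C
      · simp [hx, hσ x hx]
      · simp [hx, hσ' x hx]
    rw [this]
    exact Measurable.piecewise hCm (by fun_prop) measurable_const
  refine ⟨P.map σ, fun n B hB => ?_⟩
  rw [Measure.map_apply hσm (hπm n hB), ← hP n, Measure.map_apply (by fun_prop) hB]
  refine measure_congr ?_
  filter_upwards [hae] with x hx
  have := hσ x hx n
  simp only [eq_iff_iff]
  change π n (σ x) ∈ B ↔ x n ∈ B
  rw [this]

theorem extension_of_coherent_family_of_propertyP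
    {Ω : Type} (F : MeasurableSpace Ω) (𝓕 : ℝ≥0 → MeasurableSpace Ω)
    (hP : PropertyP F 𝓕)
    (hmono : ∀ ⦃s t : ℝ≥0⦄, s ≤ t → 𝓕 s ≤ 𝓕 t)
    (hle : ∀ s : ℝ≥0, 𝓕 s ≤ F)
    (Q : (s : ℝ≥0) → @MeasureTheory.Measure Ω (𝓕 s))
    (hprob : ∀ s : ℝ≥0, @MeasureTheory.IsProbabilityMeasure Ω (𝓕 s) (Q s))
    (hcoh : ∀ (s t : ℝ≥0) (h : s ≤ t), @MeasureTheory.Measure.trim Ω (𝓕 s) (𝓕 t) (Q t) (hmono h) = Q s) :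
    ∃! Qinf : @MeasureTheory.Measure Ω F,
      ∀ s : ℝ≥0, @MeasureTheory.Measure.trim Ω (𝓕 s) F Qinf (hle s) = Q s := by
  obtain ⟨-, hF, -, hpol, hat⟩ := hP
  have hcoh' : ∀ (s t : ℝ≥0) (h : s ≤ t) (A : Set Ω), MeasurableSet[𝓕 s] A → Q t A = Q s A := by
    intro s t h A hA
    rw [← hcoh s t h, trim_measurableSet_eq (hmono h) hA]
  choose X τ hX π hsurj hcomap hsep using hpol
  let mX : ∀ s, MeasurableSpace (X s) := fun s => @borel (X s) (τ s)
  have hstd : ∀ s, StandardBorelSpace (X s) := fun s => by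
    let := τ s
    have := hX s
    have : BorelSpace (X s) := ⟨rfl⟩
    infer_instance
  have hmeas : ∀ s, Measurable[𝓕 s] (π s) := fun s => by
    rw [measurable_iff_comap_le]; exact (hcomap s).ge
  have hFn : F = ⨆ n : ℕ, (mX n).comap (π n) := by
    rw [hF]
    apply le_antisymm
    · refine iSup_le fun s => ?_
      obtain ⟨n, hn⟩ := exists_nat_ge s
      refine (hmono hn).trans ?_
      rw [hcomap]
      exact le_iSup (fun n : ℕ => (mX n).comap (π n)) n
    · refine iSup_le fun n => ?_
      refine le_trans ?_ (le_iSup 𝓕 (n : ℝ≥0))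
      exact (hcomap n).ge
  have hatom : ∀ s ω ω', ω' ∈ sigmaAtom (𝓕 s) ω ↔ π s ω' = π s ω := by
    intro s ω ω'
    constructor
    · intro h
      exact h (π s ⁻¹' {π s ω}) ⟨hmeas s (measurableSet_singleton _), rfl⟩
    · rintro h B ⟨hB, hω⟩
      exact hsep s B hB ω' ⟨ω, hω, h.symm⟩
  have hex : ∃ Qinf : @Measure Ω F, ∀ s : ℝ≥0, ∀ A, MeasurableSet[𝓕 s] A → Qinf A = Q s A := by
    let μ : ∀ n : ℕ, Measure (X n) := fun n => @Measure.map Ω (X n) (𝓕 n) _ (π n) (Q n)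
    have hμ : ∀ (n : ℕ) (B : Set (X n)), MeasurableSet B → μ n B = Q n (π n ⁻¹' B) :=
      fun n B hB => Measure.map_apply (hmeas n) hB
    have : ∀ n, IsProbabilityMeasure (μ n) := fun n =>
      ⟨by rw [hμ n _ .univ, preimage_univ]; exact (hprob n).measure_univ⟩
    have hcast : ∀ n : ℕ, (n : ℝ≥0) ≤ ((n + 1 : ℕ) : ℝ≥0) := fun n => by
      exact_mod_cast Nat.le_succ n
    obtain ⟨P, hP⟩ := exists_measure_aux (X := fun n : ℕ => X n) (fun n : ℕ => π n)
      (fun n => hsurj n)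
      (fun n => by
        have := hmono (hcast n)
        rw [hcomap, hcomap ((n + 1 : ℕ) : ℝ≥0)] at this
        exact this)
      (fun x hx => by
        choose ω hω using fun n : ℕ => hsurj n (x n)
        obtain ⟨w, hw⟩ := hat ω (fun N => by
          obtain ⟨w, hw⟩ := hx N
          refine ⟨w, mem_iInter₂.2 fun n hn => (hatom _ _ _).2 ?_⟩
          rw [hω, hw n (Nat.lt_succ_iff.1 (Finset.mem_range.1 hn))])
        exact ⟨w, fun n => ((hatom _ _ _).1 (mem_iInter.1 hw n)).trans (hω n)⟩)
      μ
      (fun n B B' hB hB' h => by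
        rw [hμ n B hB, hμ (n + 1) B' hB', ← hcoh' _ _ (hcast n) _ (hmeas n hB)]
        exact congrArg _ h)
    subst hFn
    refine ⟨P, fun s A hA => ?_⟩
    obtain ⟨n, hn⟩ := exists_nat_ge s
    rw [← hcoh' s n hn A hA]
    have hA' := hmono hn A hA
    rw [hcomap] at hA'
    obtain ⟨B, hB, rfl⟩ := hA'
    rw [hP n B hB, hμ n B hB]
  obtain ⟨Qinf, hQ⟩ := hex
  have htrim : ∀ R : @Measure Ω F, (∀ s, R.trim (hle s) = Q s) →
      ∀ s A, MeasurableSet[𝓕 s] A → R A = Q s A := by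
    intro R hR s A hA
    rw [← hR s, trim_measurableSet_eq (hle s) hA]
  refine ⟨Qinf, fun s => ?_, fun R hR => ?_⟩
  · refine @Measure.ext _ (𝓕 s) _ _ fun A hA => ?_
    rw [trim_measurableSet_eq (hle s) hA, hQ s A hA]
  · have hR' := htrim R hR
    have : IsFiniteMeasure Qinf := ⟨by
      rw [hQ 0 univ .univ, (hprob 0).measure_univ]; exact ENNReal.one_lt_top⟩
    symm
    refine ext_of_generate_finite {A | ∃ s, MeasurableSet[𝓕 s] A} ?_ ?_ ?_ ?_
    · rw [hF]
      exact MeasurableSpace.measurableSpace_iSup_eq 𝓕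
    · rintro A ⟨s, hA⟩ B ⟨t, hB⟩ -
      exact ⟨max s t, (hmono (le_max_left s t) A hA).inter (hmono (le_max_right s t) B hB)⟩
    · rintro A ⟨s, hA⟩
      rw [hQ s A hA, hR' s A hA]
    · rw [hQ 0 univ .univ, hR' 0 univ .univ]
end

section
/- Let (Ω, F, (F_s)_{s≥0}, P) be a filtered probability space satisfying property (NP). Then F is the σ-algebra generated by ⋃_{s≥0} F_s, and for every coherent family (Q_s)_{s≥0} of probability measures, where Q_s is defined on F_s, is absolutely continuous with respect to the restriction of P to F_s, and Q_t restricted to F_s equals Q_s for all t ≥ s ≥ 0, there exists a unique probability measure Q on F which coincides with Q_s on F_s for all s ≥ 0. -/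
open MeasureTheory Filter Set
open scoped NNReal ENNReal

open ProbabilityTheory in
theorem compProd_comap_map {A B C : Type} [MeasurableSpace A] [MeasurableSpace B]
    [MeasurableSpace C] (μ : Measure A) [IsProbabilityMeasure μ] (g : A → B) (hg : Measurable g)
    (κ : Kernel B C) [IsMarkovKernel κ] :
    (μ ⊗ₘ (κ.comap g hg)).map (Prod.map g id) = (μ.map g) ⊗ₘ κ := by
  have : IsProbabilityMeasure (μ.map g) := Measure.isProbabilityMeasure_map hg.aemeasurable
  ext s hs
  rw [Measure.map_apply (by fun_prop) hs, Measure.compProd_apply hs,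
    Measure.compProd_apply (hs.preimage (by fun_prop)),
    lintegral_map (Kernel.measurable_kernel_prodMk_left hs) hg]
  rfl

open ProbabilityTheory in
theorem exists_proj_limit (X : ℕ → Type) [∀ n, MeasurableSpace (X n)]
    [∀ n, StandardBorelSpace (X n)] [∀ n, Nonempty (X n)]
    (f : ∀ n, X (n + 1) → X n) (hf : ∀ n, Measurable (f n))
    (ν : ∀ n, Measure (X n)) [∀ n, IsProbabilityMeasure (ν n)]
    (hν : ∀ n, (ν (n + 1)).map (f n) = ν n) :
    ∃ μ : Measure (∀ n, X n), (∀ n, μ.map (fun x => x n) = ν n) ∧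
      ∀ n, ∀ᵐ x ∂μ, x n = f n (x (n + 1)) := by
  let ev : ∀ n, (∀ i : Finset.Iic n, X i) → X n := fun n x => x ⟨n, Finset.mem_Iic.2 le_rfl⟩
  have hev : ∀ n, Measurable (ev n) := fun n => measurable_pi_apply _
  let κ : ∀ n, Kernel (∀ i : Finset.Iic n, X i) (X (n + 1)) := fun n =>
    (condDistrib id (f n) (ν (n + 1))).comap (ev n) (hev n)
  have hκ : ∀ n, IsMarkovKernel (κ n) := fun n => by
    dsimp only [κ]; infer_instance
  let μ := Kernel.trajMeasure (ν 0) κ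
  have hμ : IsProbabilityMeasure μ := by dsimp only [μ]; infer_instance
  have key : ∀ n, μ.map (fun x => (x n, x (n + 1))) =
      (μ.map (fun x => x n)) ⊗ₘ (condDistrib id (f n) (ν (n + 1))) := by
    intro n
    have h := Kernel.map_frestrictLe_trajMeasure_compProd_eq_map_trajMeasure
      (μ₀ := ν 0) (κ := κ) (a := n)
    have hp : IsProbabilityMeasure (μ.map (Preorder.frestrictLe n)) :=
      Measure.isProbabilityMeasure_map (by fun_prop)
    have h2 := compProd_comap_map (μ.map (Preorder.frestrictLe n)) (ev n) (hev n)
      (condDistrib id (f n) (ν (n + 1)))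
    have h3 := congrArg (Measure.map (Prod.map (ev n) id)) h
    rw [Measure.map_map (by fun_prop) (by fun_prop)] at h3
    rw [Measure.map_map (by fun_prop) (by fun_prop)] at h2
    exact h3.symm.trans h2
  have step : ∀ n, μ.map (fun x => x n) = ν n →
      μ.map (fun x => (x n, x (n + 1))) = (ν (n + 1)).map (fun y => (f n y, y)) := by
    intro n hn
    rw [key n, hn, ← hν n, compProd_map_condDistrib (by fun_prop)]
    rfl
  have all : ∀ n, μ.map (fun x => x n) = ν n := by
    intro n
    induction n with
    | zero =>
      have h := Kernel.traj_map_frestrictLe (κ := κ) 0 0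
      have : (fun x : ∀ n, X n => x 0) = ev 0 ∘ Preorder.frestrictLe 0 := rfl
      rw [this, ← Measure.map_map (by fun_prop) (by fun_prop)]
      simp only [μ, Kernel.trajMeasure]
      rw [Measure.map_comp _ _ (by fun_prop), h, Kernel.partialTraj_self, Measure.id_comp]
      have hz : Measurable (MeasurableEquiv.piUnique fun i : Finset.Iic 0 => X i).symm :=
        MeasurableEquiv.measurable _
      exact (Measure.map_map (hev 0) hz).trans Measure.map_id
    | succ n ih =>
      have h := congrArg (Measure.map Prod.snd) (step n ih)
      rw [Measure.map_map (by fun_prop) (by fun_prop),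
        Measure.map_map (by fun_prop) (by fun_prop)] at h
      exact h.trans Measure.map_id
  refine ⟨μ, all, fun n => ?_⟩
  have h := step n (all n)
  have hs : MeasurableSet {p : X n × X (n + 1) | p.1 = f n p.2} :=
    measurableSet_eq_fun (by fun_prop) (by fun_prop)
  have h1 : ∀ᵐ p ∂((ν (n + 1)).map (fun y => (f n y, y))), p.1 = f n p.2 := by
    rw [ae_map_iff (by fun_prop) hs]
    exact Filter.Eventually.of_forall fun _ => rfl
  rw [← h, ae_map_iff (by fun_prop) hs] at h1
  exact h1

theorem exists_extension_propertyP {Ω : Type} (F : MeasurableSpace Ω)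
    (𝓕 : ℝ≥0 → MeasurableSpace Ω) (hP : PropertyP F 𝓕)
    (q : ∀ n : ℕ, @Measure Ω (𝓕 n)) (hq : ∀ n, q n univ = 1)
    (hcoh : ∀ (n : ℕ) (A : Set Ω), MeasurableSet[𝓕 n] A → q (n + 1 : ℕ) A = q n A) :
    ∃ Q : @Measure Ω F, ∀ (n : ℕ) (A : Set Ω), MeasurableSet[𝓕 n] A → Q A = q n A := by
  obtain ⟨hmono, hF, -, hpol, hat⟩ := hP
  have hne : Nonempty Ω := by
    by_contra hcon
    rw [not_nonempty_iff] at hcon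
    have h1 := hq 0
    rw [Set.univ_eq_empty_iff.2 hcon, measure_empty] at h1
    exact zero_ne_one h1
  choose X τ hX π hsurj hcomap _ using fun n : ℕ => hpol n
  let _ : ∀ n, MeasurableSpace (X n) := fun n => @borel (X n) (τ n)
  have : ∀ n, BorelSpace (X n) := fun n => ⟨rfl⟩
  have : ∀ n, StandardBorelSpace (X n) := fun n => inferInstance
  have : ∀ n, Nonempty (X n) := fun n => ⟨π n hne.some⟩
  have hmonoN : ∀ n : ℕ, 𝓕 n ≤ 𝓕 (n + 1 : ℕ) := fun n => hmono (by exact_mod_cast Nat.le_succ n)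
  have hπ : ∀ n : ℕ, @Measurable _ _ (𝓕 n) _ (π n) := fun n => by
    rw [hcomap n]; exact comap_measurable _
  have hset : ∀ (n : ℕ) (A : Set Ω), MeasurableSet[𝓕 n] A →
      ∃ C : Set (X n), MeasurableSet C ∧ π n ⁻¹' C = A := by
    intro n A hA
    rw [hcomap n] at hA
    exact hA
  let f : ∀ n, X (n + 1) → X n := fun n y => π n (Function.surjInv (hsurj (n + 1)) y)
  have hfac : ∀ n ω, f n (π (n + 1) ω) = π n ω := by
    intro n ω
    obtain ⟨C, hC, hCe⟩ := hset (n + 1) (π n ⁻¹' {π n ω})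
      (hmonoN n _ (hπ n (measurableSet_singleton _)))
    have h1 : π (n + 1) ω ∈ C := by
      change ω ∈ π (n + 1) ⁻¹' C
      rw [hCe]; rfl
    rw [← Function.surjInv_eq (hsurj (n + 1)) (π (n + 1) ω)] at h1
    change Function.surjInv (hsurj (n + 1)) (π (n + 1) ω) ∈ π (n + 1) ⁻¹' C at h1
    rw [hCe] at h1
    exact h1
  have hf : ∀ n, Measurable (f n) := by
    intro n B hB
    obtain ⟨C, hC, hCe⟩ := hset (n + 1) (π n ⁻¹' B) (hmonoN n _ (hπ n hB))
    have : f n ⁻¹' B = C := by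
      ext y
      obtain ⟨ω, rfl⟩ := hsurj (n + 1) y
      rw [mem_preimage, hfac]
      change ω ∈ π n ⁻¹' B ↔ ω ∈ π (n + 1) ⁻¹' C
      rw [hCe]
    rw [this]; exact hC
  let ν : ∀ n, Measure (X n) := fun n => @Measure.map _ _ (𝓕 n) _ (π n) (q n)
  have hνap : ∀ n (C : Set (X n)), MeasurableSet C → ν n C = q n (π n ⁻¹' C) :=
    fun n C hC => @Measure.map_apply _ _ (𝓕 n) _ (q n) _ (hπ n) _ hC
  have : ∀ n, IsProbabilityMeasure (ν n) := fun n => ⟨by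
    rw [hνap n _ MeasurableSet.univ, preimage_univ, hq]⟩
  have hν : ∀ n, (ν (n + 1)).map (f n) = ν n := by
    intro n
    ext C hC
    rw [Measure.map_apply (hf n) hC, hνap _ _ (hf n hC), hνap _ _ hC, ← hcoh n _ (hπ n hC)]
    congr 1
    ext ω
    simp only [mem_preimage, hfac]
  obtain ⟨μ, hμ1, hμ2⟩ := exists_proj_limit X f hf ν hν
  let coh : Set (∀ n, X n) := {x | ∀ n, x n = f n (x (n + 1))}
  have hcohm : MeasurableSet coh := by
    have : coh = ⋂ n, {x : ∀ n, X n | x n = f n (x (n + 1))} := by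
      ext x; simp [coh]
    rw [this]
    exact MeasurableSet.iInter fun n =>
      measurableSet_eq_fun (measurable_pi_apply n) ((hf n).comp (measurable_pi_apply (n + 1)))
  have hcohae : ∀ᵐ x ∂μ, x ∈ coh := by
    rw [← ae_all_iff] at hμ2
    exact hμ2
  have hlift : ∀ x ∈ coh, ∃ ω, ∀ n, π n ω = x n := by
    intro x hx
    choose w hw using fun n => hsurj n (x n)
    have hatom : ∀ n : ℕ, sigmaAtom (𝓕 n) (w n) = π n ⁻¹' {x n} := by
      intro n
      ext ω
      simp only [sigmaAtom, mem_sInter, mem_ofPred_eq, and_imp]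
      constructor
      · intro h
        exact h _ (hπ n (measurableSet_singleton _)) (hw n)
      · intro h B hB hwB
        obtain ⟨C, hC, rfl⟩ := hset n B hB
        have h' : π n ω = x n := h
        rw [mem_preimage, h', ← hw n]
        exact hwB
    have hdown : ∀ N n, n ≤ N → ∀ ω, π N ω = x N → π n ω = x n := by
      intro N n hn
      induction N, hn using Nat.le_induction with
      | base => exact fun ω h => h
      | succ k hk ih =>
        intro ω h
        apply ih
        rw [← hfac, h, ← hx k]
    obtain ⟨ω, hω⟩ := hat w (by
      intro N
      refine ⟨w N, ?_⟩
      simp only [mem_iInter, Finset.mem_range]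
      intro n hn
      rw [hatom]
      exact hdown N n (by omega) _ (hw N))
    refine ⟨ω, fun n => ?_⟩
    have := mem_iInter.1 hω n
    rw [hatom] at this
    exact this
  classical
  let g : (∀ n, X n) → Ω := fun x => if h : x ∈ coh then (hlift x h).choose else hne.some
  have hgc : ∀ x ∈ coh, ∀ n, π n (g x) = x n := by
    intro x hx
    simp only [g, dif_pos hx]
    exact (hlift x hx).choose_spec
  have hgn : ∀ x, x ∉ coh → g x = hne.some := by
    intro x hx
    simp only [g, dif_neg hx]
  have hgm : ∀ (n : ℕ) (A : Set Ω), MeasurableSet[𝓕 n] A → MeasurableSet (g ⁻¹' A) := by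
    intro n A hA
    obtain ⟨C, hC, rfl⟩ := hset n A hA
    have : g ⁻¹' (π n ⁻¹' C) =
        (coh ∩ (fun x => x n) ⁻¹' C) ∪ (cohᶜ ∩ {_x | π n hne.some ∈ C}) := by
      ext x
      by_cases hx : x ∈ coh
      · simp [hx, hgc x hx]
      · simp [hx, hgn x hx]
    rw [this]
    exact (hcohm.inter (measurable_pi_apply n hC)).union (hcohm.compl.inter (MeasurableSet.const _))
  have hg : @Measurable _ _ _ F g := by
    intro A hA
    have hle : F ≤ MeasurableSpace.map g inferInstance := by
      rw [hF]
      refine iSup_le fun s => ?_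
      obtain ⟨n, hn⟩ := exists_nat_ge s
      intro A hA
      exact hgm n A (hmono hn A hA)
    exact hle A hA
  refine ⟨@Measure.map _ _ _ F g μ, fun n A hA => ?_⟩
  have hAF : MeasurableSet[F] A := by
    rw [hF]; exact le_iSup 𝓕 (n : ℝ≥0) A hA
  rw [@Measure.map_apply _ _ _ F μ g hg A hAF]
  obtain ⟨C, hC, rfl⟩ := hset n A hA
  rw [← hνap n C hC, ← hμ1 n, Measure.map_apply (measurable_pi_apply n) hC]
  apply measure_congr
  filter_upwards [hcohae] with x hx
  apply propext
  change π n (g x) ∈ C ↔ x n ∈ C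
  rw [hgc x hx]

theorem exists_measure_of_nullMeasurable {Ω : Type} (m m' : MeasurableSpace Ω)
    (μ : @Measure Ω m) (h : ∀ A, MeasurableSet[m'] A → @NullMeasurableSet Ω m A μ) :
    ∃ ν : @Measure Ω m', ∀ A, MeasurableSet[m'] A → ν A = μ A := by
  refine ⟨@Measure.ofMeasurable Ω m' (fun A _ => μ A) measure_empty ?_, ?_⟩
  · intro f hf hd
    exact @measure_iUnion₀ _ _ m μ _ _ (fun i j hij => (hd hij).aedisjoint) fun i => h _ (hf i)
  · intro A hA
    exact Measure.ofMeasurable_apply A hA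

/-- Naturally negligible sets. -/
def NatNegl {Ω : Type} (X : FilteredProbabilitySpace Ω) (A : Set Ω) : Prop :=
  ∃ B : ℕ → Set Ω, (∀ n : ℕ, MeasurableSet[X.𝓕 n] (B n) ∧ X.P (B n) = 0) ∧ A ⊆ ⋃ n, B n

theorem NatNegl.subset {Ω : Type} {X : FilteredProbabilitySpace Ω} {A C : Set Ω}
    (h : NatNegl X A) (hC : C ⊆ A) : NatNegl X C := by
  obtain ⟨B, hB, hA⟩ := h
  exact ⟨B, hB, hC.trans hA⟩

theorem NatNegl.of_null {Ω : Type} {X : FilteredProbabilitySpace Ω} {A : Set Ω} (n : ℕ)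
    (hA : MeasurableSet[X.𝓕 n] A) (h0 : X.P A = 0) : NatNegl X A := by
  classical
  refine ⟨fun k => if k = n then A else ∅, fun k => ?_, ?_⟩
  · by_cases hk : k = n
    · subst hk; simp [hA, h0]
    · simp [hk]
  · intro x hx
    exact mem_iUnion.2 ⟨n, by simpa using hx⟩

/-- The filter of complements of naturally negligible sets. -/
def natFilter {Ω : Type} (X : FilteredProbabilitySpace Ω) : Filter Ω :=
  Filter.ofCountableUnion {A | NatNegl X A}
    (by
      intro S hS hneg
      choose! B hB hA using hneg
      refine ⟨fun n => ⋃ s ∈ S, B s n, fun n => ⟨?_, ?_⟩, ?_⟩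
      · exact MeasurableSet.biUnion hS fun s hs => (hB s hs n).1
      · exact (measure_biUnion_null_iff hS).2 fun s hs => (hB s hs n).2
      · refine sUnion_subset fun s hs => (hA s hs).trans ?_
        exact iUnion_mono fun n => subset_biUnion_of_mem (u := fun s => B s n) hs)
    (fun _ ht _ hst => NatNegl.subset ht hst)

instance natFilter_countableInter {Ω : Type} (X : FilteredProbabilitySpace Ω) :
    CountableInterFilter (natFilter X) :=
  Filter.countableInter_ofCountableUnion _ _ _

theorem mem_natFilter {Ω : Type} {X : FilteredProbabilitySpace Ω} {s : Set Ω} :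
    s ∈ natFilter X ↔ NatNegl X sᶜ := Iff.rfl

theorem natFilter_eq_iff {Ω : Type} {X : FilteredProbabilitySpace Ω} {A B : Set Ω}
    (h : A =ᶠ[natFilter X] B) : NatNegl X (A \ B) ∧ NatNegl X (B \ A) := by
  have h' : NatNegl X {x | A x = B x}ᶜ := h
  constructor
  · refine h'.subset fun x hx hxe => ?_
    have hxe' : (x ∈ A) = (x ∈ B) := hxe
    exact hx.2 (hxe' ▸ hx.1)
  · refine h'.subset fun x hx hxe => ?_
    have hxe' : (x ∈ A) = (x ∈ B) := hxe
    exact hx.2 (hxe' ▸ hx.1)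

theorem ae_eq_of_natFilter {Ω : Type} {X : FilteredProbabilitySpace Ω} {m : MeasurableSpace Ω}
    (μ : Measure Ω) (hμ : ∀ C, NatNegl X C → μ C = 0) {A B : Set Ω}
    (h : A =ᶠ[natFilter X] B) : A =ᵐ[μ] B := by
  have hle : ae μ ≤ natFilter X := fun s hs => mem_ae_iff.2 (hμ _ hs)
  exact hle h

theorem NatNegl.measure_zero {Ω : Type} {X : FilteredProbabilitySpace Ω} {A : Set Ω}
    (h : NatNegl X A) : X.P A = 0 := by
  obtain ⟨B, hB, hA⟩ := h
  exact measure_mono_null hA (measure_iUnion_null fun n => (hB n).2)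

theorem exists_natural {Ω : Type} (X : FilteredProbabilitySpace Ω) :
    ∃ Z : FilteredProbabilitySpace Ω, ExtendsFPS Z X ∧ NaturalConditions Z ∧
      Z.F = @eventuallyMeasurableSpace Ω X.F (natFilter X) _ ∧
      ∀ s, Z.𝓕 s = ⨅ (t : ℝ≥0) (_ : s < t),
        @eventuallyMeasurableSpace Ω (X.𝓕 t) (natFilter X) _ := by
  obtain ⟨p, hp⟩ := exists_measure_of_nullMeasurable X.F
    (@eventuallyMeasurableSpace Ω X.F (natFilter X) _) X.P (by
      rintro A ⟨B, hB, hAB⟩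
      exact ⟨B, hB, @ae_eq_of_natFilter Ω X X.F X.P (fun C hC => hC.measure_zero) _ _ hAB⟩)
  have hle : X.F ≤ @eventuallyMeasurableSpace Ω X.F (natFilter X) _ :=
    @le_eventuallyMeasurableSpace Ω X.F (natFilter X) _
  have hneg : ∀ (m : MeasurableSpace Ω) C, NatNegl X C →
      MeasurableSet[@eventuallyMeasurableSpace Ω m (natFilter X) _] C := by
    intro m C hC
    refine ⟨∅, MeasurableSet.empty, ?_⟩
    rw [eventuallyEq_empty]
    change NatNegl X _
    refine hC.subset fun x hx => ?_
    exact not_not.1 hx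
  let Z : FilteredProbabilitySpace Ω :=
    { F := @eventuallyMeasurableSpace Ω X.F (natFilter X) _
      𝓕 := fun s => ⨅ (t : ℝ≥0) (_ : s < t), @eventuallyMeasurableSpace Ω (X.𝓕 t) (natFilter X) _
      mono := fun s t hst => le_iInf₂ fun u hu => iInf₂_le u (hst.trans_lt hu)
      le := fun s => (iInf₂_le (s + 1) (lt_add_of_pos_right s one_pos)).trans (by
        rintro A ⟨B, hB, hAB⟩
        exact ⟨B, X.le _ _ hB, hAB⟩)
      P := p
      prob := ⟨by
        rw [hp _ MeasurableSet.univ]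
        exact X.prob.measure_univ⟩ }
  refine ⟨Z, ⟨fun s => le_iInf₂ fun t ht A hA => ⟨A, X.mono ht.le A hA, EventuallyEq.rfl⟩,
    hle, fun A hA => hp A (hle A hA)⟩, ⟨fun s => ?_, ?_⟩, rfl, fun s => rfl⟩
  · apply le_antisymm
    · exact le_iInf₂ fun t ht => Z.mono ht.le
    · refine le_iInf₂ fun t ht => ?_
      obtain ⟨u, hsu, hut⟩ := exists_between ht
      exact (iInf₂_le u hsu).trans (iInf₂_le t hut)
  · intro s A hA hA0 B hBA
    obtain ⟨n, hn⟩ := exists_nat_gt s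
    have h1 : MeasurableSet[@eventuallyMeasurableSpace Ω (X.𝓕 n) (natFilter X) _] A :=
      (iInf₂_le (n : ℝ≥0) hn : Z.𝓕 s ≤ _) A hA
    obtain ⟨C, hC, hAC⟩ := h1
    have h0 : X.P A = 0 := by
      rw [← hp A (Z.le s A hA)]; exact hA0
    have hC0 : X.P C = 0 := by
      rw [← measure_congr
        (@ae_eq_of_natFilter Ω X X.F X.P (fun C hC => hC.measure_zero) _ _ hAC)]
      exact h0
    have hCn : NatNegl X C := NatNegl.of_null n hC hC0
    have hAn : NatNegl X A := by
      have h2 : Aᶜ =ᶠ[natFilter X] Cᶜ := hAC.compl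
      have h3 : Cᶜ ∈ natFilter X := by
        rw [mem_natFilter, compl_compl]; exact hCn
      have h4 : Aᶜ ∈ natFilter X := by
        filter_upwards [h2, h3] with x hx hx'
        have hxe : (x ∈ Aᶜ) = (x ∈ Cᶜ) := hx
        exact hxe ▸ hx'
      rw [mem_natFilter, compl_compl] at h4
      exact h4
    have : ∀ t : ℝ≥0, 0 < t → MeasurableSet[@eventuallyMeasurableSpace Ω (X.𝓕 t) (natFilter X) _] B :=
      fun t _ => hneg _ _ (hAn.subset hBA)
    change MeasurableSet[⨅ (t : ℝ≥0) (_ : 0 < t), _] B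
    simp only [MeasurableSpace.measurableSet_iInf]
    exact this

theorem extension_of_coherent_family_of_propertyNP
    {Ω : Type} (Y : FilteredProbabilitySpace Ω) (hNP : PropertyNP Y)
    (Q : (s : ℝ≥0) → @MeasureTheory.Measure Ω (Y.𝓕 s))
    (hprob : ∀ s : ℝ≥0, @MeasureTheory.IsProbabilityMeasure Ω (Y.𝓕 s) (Q s))
    (habs : ∀ s : ℝ≥0,
      @MeasureTheory.Measure.AbsolutelyContinuous Ω (Y.𝓕 s) (Q s)
        (@MeasureTheory.Measure.trim Ω (Y.𝓕 s) Y.F Y.P (Y.le s)))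
    (hcoh : ∀ (s t : ℝ≥0) (h : s ≤ t),
      @MeasureTheory.Measure.trim Ω (Y.𝓕 s) (Y.𝓕 t) (Q t) (Y.mono h) = Q s) :
    Y.F = (⨆ s : ℝ≥0, Y.𝓕 s) ∧
    ∃! Qinf : @MeasureTheory.Measure Ω Y.F,
      @MeasureTheory.IsProbabilityMeasure Ω Y.F Qinf ∧
      ∀ s : ℝ≥0, @MeasureTheory.Measure.trim Ω (Y.𝓕 s) Y.F Qinf (Y.le s) = Q s := by
  obtain ⟨X, hP, hext, hnat, hmin⟩ := hNP
  obtain ⟨Z, hZext, hZnat, hZF, hZs⟩ := exists_natural X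
  obtain ⟨hYZs, hYZF, -⟩ := hmin Z hZext hZnat
  obtain ⟨hXYs, hXYF, hXYP⟩ := hext
  have hpart : ∀ C, NatNegl X C → ∃ D : ℕ → Set Ω, C = ⋃ n, D n ∧
      ∀ n, MeasurableSet[Y.𝓕 0] (D n) ∧ ∃ B, D n ⊆ B ∧ MeasurableSet[Y.𝓕 n] B ∧ Y.P B = 0 := by
    rintro C ⟨B, hB, hC⟩
    have hB0 : ∀ n, Y.P (B n) = 0 := fun n => by
      rw [hXYP _ (X.le _ _ (hB n).1)]; exact (hB n).2
    refine ⟨fun n => C ∩ B n, ?_, fun n => ⟨?_, B n, inter_subset_right,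
      hXYs n _ (hB n).1, hB0 n⟩⟩
    · rw [← inter_iUnion]; exact (inter_eq_left.2 hC).symm
    · exact hnat.2 n (B n) (hXYs n _ (hB n).1) (hB0 n) _ inter_subset_right
  have hnegm : ∀ C, NatNegl X C → MeasurableSet[Y.𝓕 0] C := by
    intro C hC
    obtain ⟨D, rfl, hD⟩ := hpart C hC
    exact MeasurableSet.iUnion fun n => (hD n).1
  have hFsup : Y.F = ⨆ s : ℝ≥0, Y.𝓕 s := by
    apply le_antisymm
    · intro A hA
      have hA' := hYZF A hA
      rw [hZF] at hA'
      obtain ⟨B, hB, hAB⟩ := hA'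
      obtain ⟨h1, h2⟩ := natFilter_eq_iff hAB
      have e : A = (B \ (B \ A)) ∪ (A \ B) := by
        ext x; simp only [mem_union, Set.mem_sdiff]; tauto
      have hBm : MeasurableSet[⨆ s : ℝ≥0, Y.𝓕 s] B := by
        rw [hP.2.1] at hB
        exact iSup_mono hXYs B hB
      rw [e]
      exact (hBm.diff (le_iSup Y.𝓕 0 _ (hnegm _ h2))).union (le_iSup Y.𝓕 0 _ (hnegm _ h1))
    · exact iSup_le Y.le
  have hcoh' : ∀ (s t : ℝ≥0), s ≤ t → ∀ A, MeasurableSet[Y.𝓕 s] A → Q t A = Q s A := by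
    intro s t hst A hA
    rw [← hcoh s t hst, trim_measurableSet_eq _ hA]
  have habs' : ∀ (s : ℝ≥0) A, MeasurableSet[Y.𝓕 s] A → Y.P A = 0 → Q s A = 0 := by
    intro s A hA h0
    apply habs s
    rw [trim_measurableSet_eq _ hA]
    exact h0
  have hneg0 : ∀ C, NatNegl X C → ∀ s, Q s C = 0 := by
    intro C hC s
    obtain ⟨D, rfl, hD⟩ := hpart C hC
    refine measure_iUnion_null fun n => ?_
    obtain ⟨hDm, B, hDB, hB, hB0⟩ := hD n
    rw [hcoh' 0 s zero_le _ hDm, ← hcoh' 0 n zero_le _ hDm]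
    exact measure_mono_null hDB (habs' n B hB hB0)
  obtain ⟨Q0, hQ0⟩ := exists_extension_propertyP X.F X.𝓕 hP
    (fun n => @Measure.trim Ω (X.𝓕 n) (Y.𝓕 n) (Q n) (hXYs n))
    (fun n => by
      rw [trim_measurableSet_eq _ MeasurableSet.univ]
      exact (hprob n).measure_univ)
    (fun n A hA => by
      have hle : (n : ℝ≥0) ≤ (n + 1 : ℕ) := by exact_mod_cast Nat.le_succ n
      rw [trim_measurableSet_eq _ hA, trim_measurableSet_eq _ (X.mono hle A hA)]
      exact hcoh' _ _ hle A (hXYs n A hA))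
  have hQ0' : ∀ (n : ℕ) A, MeasurableSet[X.𝓕 n] A → Q0 A = Q n A := by
    intro n A hA
    rw [hQ0 n A hA, trim_measurableSet_eq _ hA]
  have hQ0neg : ∀ C, NatNegl X C → Q0 C = 0 := by
    rintro C ⟨B, hB, hC⟩
    refine measure_mono_null hC (measure_iUnion_null fun n => ?_)
    rw [hQ0' n _ (hB n).1]
    exact hneg0 _ (NatNegl.of_null n (hB n).1 (hB n).2) n
  obtain ⟨Qi, hQi⟩ := exists_measure_of_nullMeasurable X.F Y.F Q0 (by
    intro A hA
    have hA' := hYZF A hA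
    rw [hZF] at hA'
    obtain ⟨B, hB, hAB⟩ := hA'
    exact ⟨B, hB, @ae_eq_of_natFilter Ω X X.F Q0 hQ0neg _ _ hAB⟩)
  have hQis : ∀ (s : ℝ≥0) A, MeasurableSet[Y.𝓕 s] A → Qi A = Q s A := by
    intro s A hA
    obtain ⟨n, hn⟩ := exists_nat_gt s
    have hA' := hYZs s A hA
    rw [hZs] at hA'
    obtain ⟨B, hB, hAB⟩ := (iInf₂_le (n : ℝ≥0) hn :
      (⨅ (t : ℝ≥0) (_ : s < t), @eventuallyMeasurableSpace Ω (X.𝓕 t) (natFilter X) _) ≤ _) A hA'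
    rw [hQi A (Y.le s A hA), ← hcoh' s n hn.le A hA,
      measure_congr (@ae_eq_of_natFilter Ω X X.F Q0 hQ0neg _ _ hAB), hQ0' n B hB,
      measure_congr (@ae_eq_of_natFilter Ω X (Y.𝓕 n) (Q n) (fun C hC => hneg0 C hC n) _ _ hAB)]
  refine ⟨hFsup, Qi, ⟨⟨?_⟩, fun s => ?_⟩, ?_⟩
  · rw [hQis 0 univ MeasurableSet.univ]
    exact (hprob 0).measure_univ
  · refine @Measure.ext Ω (Y.𝓕 s) _ _ fun A hA => ?_
    rw [trim_measurableSet_eq _ hA, hQis s A hA]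
  · rintro R ⟨hR, hRs⟩
    have hRs' : ∀ (s : ℝ≥0) A, MeasurableSet[Y.𝓕 s] A → R A = Q s A := by
      intro s A hA
      rw [← hRs s, trim_measurableSet_eq _ hA]
    refine @ext_of_generate_finite Ω Y.F R Qi {A | ∃ s, MeasurableSet[Y.𝓕 s] A} ?_ ?_ ?_ ?_ ?_
    · rw [hFsup, MeasurableSpace.measurableSpace_iSup_eq]
    · rintro A ⟨s, hA⟩ B ⟨t, hB⟩ -
      exact ⟨max s t, (Y.mono (le_max_left s t) A hA).inter (Y.mono (le_max_right s t) B hB)⟩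
    · infer_instance
    · rintro A ⟨s, hA⟩
      rw [hRs' s A hA, hQis s A hA]
    · rw [hRs' 0 univ MeasurableSet.univ, hQis 0 univ MeasurableSet.univ]
end

section
/- Let A : (0,∞) → (0,∞) be continuous, integrable in a neighborhood of zero but not integrable in a neighborhood of infinity. Then there exists a function Φ : [0,∞) → ℝ which is continuous on [0,∞), bounded, twice differentiable on (0,∞), satisfies Φ(0) = 1 and the Sturm–Liouville equation Φ''(t) = A(t)Φ(t) for all t > 0, and which moreover is strictly positive, strictly decreasing with Φ(t) → 0 as t → ∞, continuously differentiable everywhere on [0,∞), and satisfies Φ'(t) < 0 for all t ≥ 0. -/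
open MeasureTheory Filter Set

/-- Hypotheses on the coefficient `A` of the Sturm–Liouville equation: continuous and
strictly positive on `(0,∞)`, integrable in a neighborhood of zero, but not integrable
in a neighborhood of infinity. -/
def SLHyp (A : ℝ → ℝ) : Prop :=
  ContinuousOn A (Set.Ioi 0) ∧ (∀ t > (0:ℝ), 0 < A t) ∧
  MeasureTheory.IntegrableOn A (Set.Ioc 0 1) ∧
  (∫⁻ t in Set.Ici (1:ℝ), ENNReal.ofReal (A t)) = ⊤

/-- `Φ` is a bounded continuous function on `[0,∞)` with `Φ 0 = 1`, twice differentiable on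
`(0,∞)` and satisfying the Sturm–Liouville equation `Φ'' = A Φ` there. -/
def IsSL (A Φ : ℝ → ℝ) : Prop :=
  ContinuousOn Φ (Set.Ici 0) ∧
  (∃ M : ℝ, ∀ t ≥ (0:ℝ), |Φ t| ≤ M) ∧
  Φ 0 = 1 ∧
  (∀ t > (0:ℝ), DifferentiableAt ℝ Φ t) ∧
  (∀ t > (0:ℝ), HasDerivAt (deriv Φ) (A t * Φ t) t)

/-- A nonnegative coefficient, vanishing on `(-∞,0]` and locally integrable. -/
def SLCoef (a : ℝ → ℝ) : Prop :=
  (∀ t ≤ 0, a t = 0) ∧ (∀ t, 0 ≤ a t) ∧ (∀ x y, IntervalIntegrable a volume x y)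

/-- The Picard iterates. -/
noncomputable def slIter (a : ℝ → ℝ) : ℕ → ℝ → ℝ
  | 0 => fun _ => 1
  | n + 1 => fun t => 1 + ∫ s in (0:ℝ)..t, ∫ x in (0:ℝ)..s, a x * slIter a n x

lemma SLCoef.ii {a f : ℝ → ℝ} (ha : SLCoef a) (hf : Continuous f) (x y : ℝ) :
    IntervalIntegrable (fun s => a s * f s) volume x y :=
  (ha.2.2 x y).mul_continuousOn hf.continuousOn

lemma SLCoef.cont {a f : ℝ → ℝ} (ha : SLCoef a) (hf : Continuous f) :
    Continuous fun t => ∫ x in (0:ℝ)..t, a x * f x :=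
  intervalIntegral.continuous_primitive (fun x y => ha.ii hf x y) 0

lemma SLCoef.neg {a : ℝ → ℝ} (ha : SLCoef a) (f : ℝ → ℝ) {t : ℝ} (ht : t ≤ 0) :
    ∫ x in (0:ℝ)..t, a x * f x = 0 := by
  have : ∫ x in (0:ℝ)..t, a x * f x = ∫ x in (0:ℝ)..t, (0:ℝ) := by
    apply intervalIntegral.integral_congr
    intro x hx
    rw [uIcc_of_ge ht] at hx
    simp [ha.1 x hx.2]
  simp [this]

lemma SLCoef.neg2 {a : ℝ → ℝ} (ha : SLCoef a) (f : ℝ → ℝ) {t : ℝ} (ht : t ≤ 0) :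
    ∫ s in (0:ℝ)..t, ∫ x in (0:ℝ)..s, a x * f x = 0 := by
  have : ∫ s in (0:ℝ)..t, ∫ x in (0:ℝ)..s, a x * f x = ∫ x in (0:ℝ)..t, (0:ℝ) := by
    apply intervalIntegral.integral_congr
    intro x hx
    rw [uIcc_of_ge ht] at hx
    exact ha.neg f hx.2
  simp [this]

lemma SLCoef.mono1 {a f g : ℝ → ℝ} (ha : SLCoef a) (hf : Continuous f) (hg : Continuous g)
    (h : ∀ x, f x ≤ g x) (t : ℝ) :
    ∫ x in (0:ℝ)..t, a x * f x ≤ ∫ x in (0:ℝ)..t, a x * g x := by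
  rcases le_total t 0 with ht | ht
  · rw [ha.neg f ht, ha.neg g ht]
  · exact intervalIntegral.integral_mono_on ht (ha.ii hf _ _) (ha.ii hg _ _)
      (fun x _ => mul_le_mul_of_nonneg_left (h x) (ha.2.1 x))

lemma SLCoef.mono2 {a f g : ℝ → ℝ} (ha : SLCoef a) (hf : Continuous f) (hg : Continuous g)
    (h : ∀ x, f x ≤ g x) (t : ℝ) :
    ∫ s in (0:ℝ)..t, ∫ x in (0:ℝ)..s, a x * f x ≤
      ∫ s in (0:ℝ)..t, ∫ x in (0:ℝ)..s, a x * g x := by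
  rcases le_total t 0 with ht | ht
  · rw [ha.neg2 f ht, ha.neg2 g ht]
  · exact intervalIntegral.integral_mono_on ht ((ha.cont hf).intervalIntegrable _ _)
      ((ha.cont hg).intervalIntegrable _ _) (fun x _ => ha.mono1 hf hg h x)

lemma SLCoef.iter_cont {a : ℝ → ℝ} (ha : SLCoef a) : ∀ n, Continuous (slIter a n)
  | 0 => continuous_const
  | n + 1 => by
    have h := ha.cont (ha.iter_cont n)
    exact continuous_const.add
      (intervalIntegral.continuous_primitive (fun x y => h.intervalIntegrable x y) 0)

lemma SLCoef.iter_mono {a : ℝ → ℝ} (ha : SLCoef a) : ∀ n t, slIter a n t ≤ slIter a (n+1) t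
  | 0, t => by
    have h := ha.mono2 (f := fun _ => 0) (g := fun _ => 1) continuous_const continuous_const
      (fun _ => zero_le_one) t
    simp only [mul_zero, intervalIntegral.integral_zero] at h
    simp only [slIter]
    linarith
  | n + 1, t => by
    have h := ha.mono2 (ha.iter_cont n) (ha.iter_cont (n+1)) (ha.iter_mono n) t
    rw [slIter, slIter]
    linarith

/-- There is a bound by a continuous function. -/
lemma SLCoef.bound {a : ℝ → ℝ} (ha : SLCoef a) :
    ∃ E : ℝ → ℝ, Continuous E ∧ ∀ n t, slIter a n t ≤ E t := by
  set B : ℝ → ℝ := fun t => ∫ x in (0:ℝ)..t, a x * 1 with hB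
  have hBc : Continuous B := ha.cont continuous_const
  have hB0 : ∀ t, 0 ≤ B t := fun t => by
    have h := ha.mono1 (f := fun _ => 0) (g := fun _ => 1) continuous_const continuous_const
      (fun _ => zero_le_one) t
    simp only [mul_zero, intervalIntegral.integral_zero] at h
    exact h
  set G : ℝ → ℝ := fun t => ∫ x in (0:ℝ)..t, B x with hG
  have hGd : ∀ t, HasDerivAt G (B t) t := fun t => hBc.integral_hasStrictDerivAt 0 t |>.hasDerivAt
  have hGm : Monotone G := monotone_of_hasDerivAt_nonneg hGd hB0
  have hGc : Continuous G := continuous_iff_continuousAt.2 fun t => (hGd t).continuousAt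
  have hEc : Continuous fun t => Real.exp (G t) := Real.continuous_exp.comp hGc
  refine ⟨fun t => Real.exp (G t), hEc, ?_⟩
  have hEd : ∀ t, HasDerivAt (fun t => Real.exp (G t)) (Real.exp (G t) * B t) t :=
    fun t => (hGd t).exp
  have key : ∀ t, ∫ s in (0:ℝ)..t, ∫ x in (0:ℝ)..s, a x * Real.exp (G x) ≤ Real.exp (G t) - 1 := by
    intro t
    have hG0 : G 0 = 0 := by simp [hG]
    rcases le_total t 0 with ht | ht
    · rw [ha.neg2 _ ht]
      have : G t = 0 := by
        have h := ha.neg2 (fun _ => 1) ht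
        exact h
      simp [this]
    · have h1 : ∫ s in (0:ℝ)..t, Real.exp (G s) * B s = Real.exp (G t) - 1 := by
        rw [intervalIntegral.integral_eq_sub_of_hasDerivAt (fun x _ => hEd x)
          ((hEc.mul hBc).intervalIntegrable _ _)]
        simp [hG0]
      rw [← h1]
      refine intervalIntegral.integral_mono_on ht ((ha.cont hEc).intervalIntegrable _ _)
        ((hEc.mul hBc).intervalIntegrable _ _) (fun s hs => ?_)
      have h2 : Real.exp (G s) * B s = ∫ x in (0:ℝ)..s, a x * Real.exp (G s) := by
        simp only [hB, intervalIntegral.integral_mul_const]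
        simp [mul_comm]
      rw [h2]
      refine intervalIntegral.integral_mono_on hs.1 (ha.ii hEc _ _)
        (ha.ii continuous_const _ _) (fun x hx => ?_)
      exact mul_le_mul_of_nonneg_left (Real.exp_le_exp.2 (hGm hx.2)) (ha.2.1 x)
  intro n
  induction n with
  | zero =>
    intro t
    simp only [slIter]
    have hG0 : 0 ≤ G t := by
      have h := ha.mono2 (f := fun _ => 0) (g := fun _ => 1) continuous_const continuous_const
        (fun _ => zero_le_one) t
      simp only [mul_zero, intervalIntegral.integral_zero] at h
      exact h
    exact Real.one_le_exp hG0
  | succ n ih =>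
    intro t
    rw [slIter]
    have := ha.mono2 (ha.iter_cont n) hEc ih t
    have := key t
    linarith

/-- Existence of the increasing solution. -/
lemma SLCoef.exists_u {a : ℝ → ℝ} (ha : SLCoef a) :
    ∃ u p : ℝ → ℝ, (∀ t, 1 ≤ u t) ∧ Continuous p ∧ (∀ t, HasDerivAt u (p t) t) ∧
      (∀ t, p t = ∫ x in (0:ℝ)..t, a x * u x) := by
  obtain ⟨E, hEc, hE⟩ := ha.bound
  have hmono : ∀ t, Monotone fun n => slIter a n t :=
    fun t => monotone_nat_of_le_succ fun n => ha.iter_mono n t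
  have hbdd : ∀ t, BddAbove (range fun n => slIter a n t) := fun t =>
    ⟨E t, by rintro _ ⟨n, rfl⟩; exact hE n t⟩
  set u : ℝ → ℝ := fun t => ⨆ n, slIter a n t with hu
  have hlim : ∀ t, Tendsto (fun n => slIter a n t) atTop (nhds (u t)) := fun t =>
    tendsto_atTop_ciSup (hmono t) (hbdd t)
  have h1 : ∀ n t, 1 ≤ slIter a n t := fun n t => hmono t (Nat.zero_le n)
  have hu1 : ∀ t, 1 ≤ u t := fun t => ge_of_tendsto' (hlim t) fun n => h1 n t
  have hab : ∀ n t, |slIter a n t| ≤ E t := fun n t => by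
    rw [abs_of_nonneg (zero_le_one.trans (h1 n t))]; exact hE n t
  have hp : ∀ t, Tendsto (fun n => ∫ x in (0:ℝ)..t, a x * slIter a n x) atTop
      (nhds (∫ x in (0:ℝ)..t, a x * u x)) := by
    intro t
    refine intervalIntegral.tendsto_integral_filter_of_dominated_convergence
      (fun x => a x * E x) ?_ ?_ (ha.ii hEc _ _) ?_
    · exact Eventually.of_forall fun n => (ha.ii (ha.iter_cont n) 0 t).def'.aestronglyMeasurable
    · refine Eventually.of_forall fun n => Eventually.of_forall fun x _ => ?_
      rw [Real.norm_eq_abs, abs_mul, abs_of_nonneg (ha.2.1 x)]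
      exact mul_le_mul_of_nonneg_left (hab n x) (ha.2.1 x)
    · exact Eventually.of_forall fun x _ => (hlim x).const_mul _
  set p : ℝ → ℝ := fun t => ∫ x in (0:ℝ)..t, a x * u x with hpdef
  have hueq : ∀ t, u t = 1 + ∫ s in (0:ℝ)..t, p s := by
    intro t
    have h2 : Tendsto (fun n => slIter a (n+1) t) atTop (nhds (1 + ∫ s in (0:ℝ)..t, p s)) := by
      simp only [slIter]
      refine Tendsto.const_add _ ?_
      refine intervalIntegral.tendsto_integral_filter_of_dominated_convergence
        (fun s => ∫ x in (0:ℝ)..s, a x * E x) ?_ ?_ ((ha.cont hEc).intervalIntegrable _ _) ?_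
      · exact Eventually.of_forall fun n =>
          (ha.cont (ha.iter_cont n)).aestronglyMeasurable
      · refine Eventually.of_forall fun n => Eventually.of_forall fun s _ => ?_
        have h3 := ha.mono1 (f := fun _ => 0) continuous_const (ha.iter_cont n)
          (fun x => zero_le_one.trans (h1 n x)) s
        simp only [mul_zero, intervalIntegral.integral_zero] at h3
        rw [Real.norm_eq_abs, abs_of_nonneg h3]
        exact ha.mono1 (ha.iter_cont n) hEc (hE n) s
      · exact Eventually.of_forall fun x _ => hp x
    exact tendsto_nhds_unique ((tendsto_add_atTop_iff_nat 1).2 (hlim t)) h2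
  have hum : Measurable u := measurable_of_tendsto_metrizable
    (fun n => (ha.iter_cont n).measurable) (tendsto_pi_nhds.2 hlim)
  have hii : ∀ x y, IntervalIntegrable (fun s => a s * u s) volume x y := by
    intro x y
    refine (ha.ii hEc x y).mono_fun
      ((ha.2.2 x y).def'.aestronglyMeasurable.mul hum.aestronglyMeasurable) ?_
    refine Eventually.of_forall fun s => ?_
    have h4 : u s ≤ E s := le_of_tendsto' (hlim s) fun n => hE n s
    have h5 := hu1 s
    simp only [Real.norm_eq_abs]
    rw [abs_mul, abs_mul, abs_of_nonneg (ha.2.1 s), abs_of_nonneg (by linarith),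
      abs_of_nonneg (by linarith)]
    exact mul_le_mul_of_nonneg_left h4 (ha.2.1 s)
  have hpc : Continuous p := intervalIntegral.continuous_primitive hii 0
  refine ⟨u, p, hu1, hpc, fun t => ?_, fun t => rfl⟩
  have h6 : u = fun t => 1 + ∫ s in (0:ℝ)..t, p s := funext hueq
  rw [h6]
  exact (hpc.integral_hasStrictDerivAt 0 t).hasDerivAt.const_add 1

theorem existence_of_sturm_liouville_solution (A : ℝ → ℝ) (hA : SLHyp A) :
    ∃ Φ Φ' : ℝ → ℝ,
      IsSL A Φ ∧
      (∀ t ≥ (0:ℝ), 0 < Φ t) ∧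
      StrictAntiOn Φ (Set.Ici 0) ∧
      Filter.Tendsto Φ Filter.atTop (nhds 0) ∧
      ContinuousOn Φ' (Set.Ici 0) ∧
      (∀ t ≥ (0:ℝ), HasDerivWithinAt Φ (Φ' t) (Set.Ici 0) t) ∧
      (∀ t ≥ (0:ℝ), Φ' t < 0) := by
  obtain ⟨hAc, hApos, hA1, hAinf⟩ := hA
  set a : ℝ → ℝ := (Ioi (0:ℝ)).indicator A with ha_def
  have haA : ∀ t > 0, a t = A t := fun t ht => indicator_of_mem (mem_Ioi.2 ht) A
  have haI : ∀ T, 0 ≤ T → IntervalIntegrable a volume 0 T := by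
    intro T hT
    rw [intervalIntegrable_iff_integrableOn_Ioc_of_le hT]
    have h1 : IntegrableOn A (Ioc 0 T) := by
      have h2 : IntegrableOn A (Icc 1 T) :=
        (hAc.mono fun x hx => lt_of_lt_of_le one_pos hx.1).integrableOn_Icc
      refine (hA1.union h2).mono_set fun x hx => ?_
      rcases le_total x 1 with h | h
      · exact Or.inl ⟨hx.1, h⟩
      · exact Or.inr ⟨h, hx.2⟩
    exact h1.congr_fun (fun x hx => (haA x hx.1).symm) measurableSet_Ioc
  have haneg : ∀ t ≤ 0, a t = 0 := fun t ht =>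
    indicator_of_notMem (by simpa using ht) A
  have haI' : ∀ T, IntervalIntegrable a volume 0 T := by
    intro T
    rcases le_total 0 T with hT | hT
    · exact haI T hT
    · have h0 : IntervalIntegrable (fun _ : ℝ => (0:ℝ)) volume 0 T := by simp
      refine h0.congr fun x hx => ?_
      rw [uIoc_of_ge hT] at hx
      exact (haneg x hx.2).symm
  have ha : SLCoef a := by
    refine ⟨haneg, fun t => ?_, fun x y => (haI' x).symm.trans (haI' y)⟩
    exact indicator_nonneg (fun x hx => (hApos x hx).le) t
  have hac : ∀ t > 0, ContinuousAt a t := by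
    intro t ht
    have h1 : ContinuousAt A t := hAc.continuousAt (Ioi_mem_nhds ht)
    refine h1.congr ?_
    filter_upwards [Ioi_mem_nhds ht] with x hx using (haA x hx).symm
  obtain ⟨u, p, hu1, hpc, hud, hp⟩ := ha.exists_u
  have hupos : ∀ t, 0 < u t := fun t => one_pos.trans_le (hu1 t)
  have huc : Continuous u := continuous_iff_continuousAt.2 fun t => (hud t).continuousAt
  -- primitives of `a * f`
  have hprim : ∀ f : ℝ → ℝ, Continuous f → ∀ t > 0,
      HasDerivAt (fun t => ∫ x in (0:ℝ)..t, a x * f x) (A t * f t) t := by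
    intro f hf t ht
    rw [← haA t ht]
    refine intervalIntegral.integral_hasDerivAt_right (ha.ii hf 0 t) ?_
      ((hac t ht).mul hf.continuousAt)
    have hco : ContinuousOn (fun x => a x * f x) (Ioi 0) := fun x hx =>
      ((hac x hx).mul hf.continuousAt).continuousWithinAt
    exact hco.stronglyMeasurableAtFilter isOpen_Ioi t ht
  have hpd : ∀ t > 0, HasDerivAt p (A t * u t) t := by
    intro t ht
    have : p = fun t => ∫ x in (0:ℝ)..t, a x * u x := funext hp
    rw [this]
    exact hprim u huc t ht
  have hpmono : Monotone p := by
    intro x y hxy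
    rw [hp, hp, ← sub_nonneg,
      intervalIntegral.integral_interval_sub_left (ha.ii huc _ _) (ha.ii huc _ _)]
    exact intervalIntegral.integral_nonneg hxy
      fun s _ => mul_nonneg (ha.2.1 s) (hupos s).le
  have hp0 : p 0 = 0 := by simp [hp]
  have hp1 : 0 < p 1 := by
    have hs : StrictMonoOn p (Ici 0) := by
      refine strictMonoOn_of_deriv_pos (convex_Ici 0) hpc.continuousOn fun x hx => ?_
      rw [interior_Ici] at hx
      rw [(hpd x hx).deriv]
      exact mul_pos (hApos x hx) (hupos x)
    have := hs (mem_Ici.2 le_rfl) (mem_Ici.2 zero_le_one) zero_lt_one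
    rwa [hp0] at this
  -- the integral of `u⁻²`
  set q : ℝ → ℝ := fun t => ((u t) ^ 2)⁻¹ with hq
  have hqpos : ∀ t, 0 < q t := fun t => inv_pos.2 (pow_pos (hupos t) 2)
  have hqc : Continuous q := (huc.pow 2).inv₀ fun t => (pow_pos (hupos t) 2).ne'
  set I : ℝ → ℝ := fun t => ∫ s in (0:ℝ)..t, q s with hI
  have hId : ∀ t, HasDerivAt I (q t) t := fun t => (hqc.integral_hasStrictDerivAt 0 t).hasDerivAt
  have hIm : StrictMono I := strictMono_of_hasDerivAt_pos hId hqpos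
  have hwd : ∀ t, HasDerivAt (fun t => (u t)⁻¹) (-(p t) * q t) t := fun t => by
    have := (hud t).inv (hupos t).ne'
    exact this.congr_deriv (by simp [hq, div_eq_mul_inv])
  -- comparison
  have hcomp : ∀ t T, t ≤ T → p t * I T + (u T)⁻¹ ≤ p t * I t + (u t)⁻¹ := by
    intro t T htT
    have hd : ∀ s, HasDerivAt (fun s => p t * I s + (u s)⁻¹) (p t * q s + -(p s) * q s) s :=
      fun s => ((hId s).const_mul (p t)).add (hwd s)
    have han : AntitoneOn (fun s => p t * I s + (u s)⁻¹) (Ici t) := by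
      refine antitoneOn_of_deriv_nonpos (convex_Ici t)
        (fun s _ => (hd s).continuousAt.continuousWithinAt)
        (fun s _ => (hd s).differentiableAt.differentiableWithinAt) fun s hs => ?_
      rw [interior_Ici] at hs
      rw [(hd s).deriv]
      have h1 : p t ≤ p s := hpmono (le_of_lt hs)
      nlinarith [hqpos s]
    exact han (mem_Ici.2 le_rfl) (mem_Ici.2 htT) htT
  have hbd : BddAbove (range I) := by
    refine ⟨(p 1 * I 1 + (u 1)⁻¹) / p 1, ?_⟩
    rintro _ ⟨t, rfl⟩
    rw [le_div_iff₀ hp1]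
    have h1 := hcomp 1 (max t 1) (le_max_right _ _)
    have h2 := hIm.monotone (le_max_left t 1)
    have h3 := inv_pos.2 (hupos (max t 1))
    nlinarith
  set L : ℝ := ⨆ t, I t with hL
  have hIL : Tendsto I atTop (nhds L) := tendsto_atTop_ciSup hIm.monotone hbd
  have hIlt : ∀ t, I t < L := fun t =>
    (hIm (lt_add_one t)).trans_le (le_ciSup hbd (t+1))
  -- the decreasing solution
  set v : ℝ → ℝ := fun t => u t * (L - I t) with hv
  set w : ℝ → ℝ := fun t => p t * (L - I t) - (u t)⁻¹ with hw
  have hvpos : ∀ t, 0 < v t := fun t => mul_pos (hupos t) (sub_pos.2 (hIlt t))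
  have hvd : ∀ t, HasDerivAt v (w t) t := by
    intro t
    have h := (hud t).mul ((hId t).const_sub L)
    refine h.congr_deriv ?_
    have := (hupos t).ne'
    simp only [hw, hq]
    field_simp
    ring
  have hwd2 : ∀ t > 0, HasDerivAt w (A t * v t) t := by
    intro t ht
    have h := ((hpd t ht).mul ((hId t).const_sub L)).sub (hwd t)
    refine h.congr_deriv ?_
    simp only [hv]
    ring
  have hIc : Continuous I := continuous_iff_continuousAt.2 fun t => (hId t).continuousAt
  have hwc : Continuous w :=
    (hpc.mul (continuous_const.sub hIc)).sub (huc.inv₀ fun t => (hupos t).ne')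
  have hw0 : ∀ t, w t ≤ 0 := by
    intro t
    have h1 : p t * L ≤ p t * I t + (u t)⁻¹ := by
      refine le_of_tendsto (hIL.const_mul (p t)) ?_
      filter_upwards [eventually_ge_atTop t] with T hT
      have := hcomp t T hT
      have := inv_pos.2 (hupos T)
      linarith
    simp only [hw]
    linarith
  have hws : StrictMonoOn w (Ici 0) := by
    refine strictMonoOn_of_deriv_pos (convex_Ici 0) hwc.continuousOn fun x hx => ?_
    rw [interior_Ici] at hx
    rw [(hwd2 x hx).deriv]
    exact mul_pos (hApos x hx) (hvpos x)
  have hwneg : ∀ t ≥ 0, w t < 0 := fun t ht =>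
    (hws (mem_Ici.2 ht) (mem_Ici.2 (by linarith)) (lt_add_one t)).trans_le (hw0 (t+1))
  have hvc : Continuous v := continuous_iff_continuousAt.2 fun t => (hvd t).continuousAt
  have hvanti : Antitone v := antitone_of_hasDerivAt_nonpos hvd hw0
  have hvs : StrictAntiOn v (Ici 0) := by
    refine strictAntiOn_of_deriv_neg (convex_Ici 0) hvc.continuousOn fun x hx => ?_
    rw [interior_Ici] at hx
    rw [(hvd x).deriv]
    exact hwneg x (le_of_lt hx)
  have hvbdd : BddBelow (range v) := ⟨0, by rintro _ ⟨t, rfl⟩; exact (hvpos t).le⟩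
  have hvlim : Tendsto v atTop (nhds 0) := by
    have hl := tendsto_atTop_ciInf hvanti hvbdd
    set c : ℝ := ⨅ t, v t with hc
    have hc0 : 0 ≤ c := le_ciInf fun t => (hvpos t).le
    rcases hc0.eq_or_lt with h | hcpos
    · rwa [← h] at hl
    · exfalso
      have hcv : ∀ t, c ≤ v t := fun t => ciInf_le hvbdd t
      set B : ℝ → ℝ := fun t => ∫ x in (0:ℝ)..t, a x * 1 with hB
      have hBd : ∀ t > 0, HasDerivAt B (A t * 1) t := hprim (fun _ => 1) continuous_const
      have hm : MonotoneOn (fun t => w t - c * B t) (Ici 1) := by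
        have hd : ∀ t > 0, HasDerivAt (fun t => w t - c * B t) (A t * v t - c * (A t * 1)) t :=
          fun t ht => (hwd2 t ht).sub ((hBd t ht).const_mul c)
        have hpos1 : ∀ t ∈ Ici (1:ℝ), 0 < t := fun t ht => one_pos.trans_le ht
        refine monotoneOn_of_deriv_nonneg (convex_Ici 1)
          (fun s hs => (hd s (hpos1 s hs)).continuousAt.continuousWithinAt)
          (fun s hs => (hd s (hpos1 s (interior_subset hs))).differentiableAt.differentiableWithinAt)
          fun s hs => ?_
        have hs0 := hpos1 s (interior_subset hs)
        rw [(hd s hs0).deriv]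
        nlinarith [hcv s, hApos s hs0]
      have hBb : ∀ t ≥ 1, B t ≤ (c * B 1 - w 1) / c := by
        intro t ht
        rw [le_div_iff₀ hcpos]
        have h1 := hm (mem_Ici.2 le_rfl) (mem_Ici.2 ht) ht
        simp only at h1
        have := hw0 t
        linarith
      have hint : IntegrableOn a (Ioi 1) := by
        refine integrableOn_Ioi_of_intervalIntegral_norm_bounded ((c * B 1 - w 1) / c - B 1) 1
          (l := atTop) (b := id) (fun T => ?_) tendsto_id ?_
        · rcases le_total 1 T with h | h
          · exact (intervalIntegrable_iff_integrableOn_Ioc_of_le h).1 (ha.2.2 1 T)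
          · simp [Ioc_eq_empty_of_le h]
        · filter_upwards [eventually_ge_atTop 1] with T hT
          have h2 : ∫ x in (1:ℝ)..T, ‖a x‖ = B T - B 1 := by
            simp only [hB, mul_one]
            rw [intervalIntegral.integral_interval_sub_left (haI' _) (haI' _)]
            refine intervalIntegral.integral_congr fun x _ => ?_
            simp [abs_of_nonneg (ha.2.1 x)]
          simp only [id]
          rw [h2]
          linarith [hBb T hT]
      have hint2 : IntegrableOn A (Ici 1) := by
        rw [integrableOn_Ici_iff_integrableOn_Ioi]
        exact hint.congr_fun (fun x hx => haA x (one_pos.trans hx)) measurableSet_Ioi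
      exact hint2.lintegral_lt_top.ne hAinf
  have hderiv : deriv v = w := funext fun t => (hvd t).deriv
  have hv0 := hvpos 0
  have hΦd : ∀ t, HasDerivAt (fun t => v t / v 0) (w t / v 0) t := fun t => (hvd t).div_const _
  refine ⟨fun t => v t / v 0, fun t => w t / v 0, ⟨(hvc.div_const _).continuousOn, ⟨1, ?_⟩,
    div_self hv0.ne', fun t _ => (hΦd t).differentiableAt, ?_⟩, fun t _ => div_pos (hvpos t) hv0,
    ?_, ?_, (hwc.div_const _).continuousOn, fun t _ => (hΦd t).hasDerivWithinAt,
    fun t ht => div_neg_of_neg_of_pos (hwneg t ht) hv0⟩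
  · intro t ht
    rw [abs_of_pos (div_pos (hvpos t) hv0), div_le_one hv0]
    exact hvanti ht
  · intro t ht
    have h1 : deriv (fun t => v t / v 0) = fun t => w t / v 0 := funext fun t => (hΦd t).deriv
    rw [h1, ← mul_div_assoc]
    exact (hwd2 t ht).div_const _
  · intro x hx y hy hxy
    exact div_lt_div_of_pos_right (hvs hx hy hxy) hv0
  · simpa using hvlim.div_const (v 0)
end

section
/- In the setting of the family (A_λ), set K := |Φ_{A₀}'(0)|. Then K > 0, and |Φ_{A_λ}'(t)| converges to K as (λ, t) → (0, 0); i.e., for every ε > 0 there exist λ₁ > 0 and t₁ > 0 such that for all λ ∈ (0, λ₁] and t ∈ [0, t₁], one has | |Φ_{A_λ}'(t)| − K | ≤ ε. -/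
open MeasureTheory Filter Set

/-- Everything we need about a bounded solution of the Sturm–Liouville equation. -/
theorem sl_aux (A Φ : ℝ → ℝ) (hA : ∀ t > (0:ℝ), 0 < A t)
    (hAint : ∀ T > (0:ℝ), IntervalIntegrable A volume 0 T) (h : IsSL A Φ) :
    (∀ t ≥ (0:ℝ), 0 ≤ Φ t ∧ Φ t ≤ 1) ∧
    ContinuousOn (derivWithin Φ (Set.Ici 0)) (Set.Ici 0) ∧
    (∀ t > (0:ℝ), HasDerivAt Φ (derivWithin Φ (Set.Ici 0) t) t) ∧
    (∀ t > (0:ℝ), HasDerivAt (derivWithin Φ (Set.Ici 0)) (A t * Φ t) t) ∧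
    (∀ t ≥ (0:ℝ), derivWithin Φ (Set.Ici 0) t ≤ 0) ∧
    MonotoneOn (derivWithin Φ (Set.Ici 0)) (Set.Ici 0) ∧
    (∀ T > (0:ℝ), |derivWithin Φ (Set.Ici 0) T| ≤ 1 / T) := by
  obtain ⟨hcont, ⟨M, hM⟩, h0, hd, hdd⟩ := h
  have hd' : ∀ t > (0:ℝ), HasDerivAt Φ (deriv Φ t) t := fun t ht => (hd t ht).hasDerivAt
  -- the product of the solution and its derivative is monotone
  have hg : ∀ t > (0:ℝ), HasDerivAt (fun t => Φ t * deriv Φ t)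
      (deriv Φ t * deriv Φ t + Φ t * (A t * Φ t)) t := fun t ht => (hd' t ht).mul (hdd t ht)
  have hgm : MonotoneOn (fun t => Φ t * deriv Φ t) (Set.Ioi 0) := by
    apply monotoneOn_of_deriv_nonneg (convex_Ioi 0)
    · intro t ht; exact (hg t ht).continuousAt.continuousWithinAt
    · intro t ht; rw [interior_Ioi] at ht
      exact (hg t ht).differentiableAt.differentiableWithinAt
    · intro t ht; rw [interior_Ioi] at ht
      rw [(hg t ht).deriv]
      have := hA t ht
      nlinarith [mul_self_nonneg (deriv Φ t), mul_nonneg this.le (mul_self_nonneg (Φ t))]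
  have hsq : ∀ t > (0:ℝ), HasDerivAt (fun t => Φ t * Φ t) (2 * (Φ t * deriv Φ t)) t := by
    intro t ht
    have := (hd' t ht).mul (hd' t ht)
    exact this.congr_deriv (by ring)
  have hgneg : ∀ t > (0:ℝ), Φ t * deriv Φ t ≤ 0 := by
    intro t ht
    by_contra hpos
    push Not at hpos
    set q := Φ t * deriv Φ t with hq
    have key : ∀ s ≥ t, 2 * q * (s - t) ≤ Φ s * Φ s - Φ t * Φ t := by
      intro s hs
      refine Convex.mul_sub_le_image_sub_of_le_deriv (f := fun t => Φ t * Φ t) (convex_Ici t) ?_ ?_ ?_ t self_mem_Ici s hs hs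
      · intro x hx
        exact (hsq x (lt_of_lt_of_le ht hx)).continuousAt.continuousWithinAt
      · intro x hx; rw [interior_Ici] at hx
        exact (hsq x (lt_trans ht hx)).differentiableAt.differentiableWithinAt
      · intro x hx; rw [interior_Ici] at hx
        have hx0 : 0 < x := lt_trans ht hx
        rw [(hsq x hx0).deriv]
        have := hgm (show t ∈ Set.Ioi 0 from ht) (show x ∈ Set.Ioi 0 from hx0) (le_of_lt hx)
        simp only at this
        linarith
    have hs : t + (M * M + 1) / (2 * q) ≥ t := by
      have : 0 ≤ (M * M + 1) / (2 * q) := by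
        have := mul_self_nonneg M
        positivity
      linarith
    have k := key _ hs
    have e : 2 * q * (t + (M * M + 1) / (2 * q) - t) = M * M + 1 := by field_simp; ring
    rw [e] at k
    have b := hM (t + (M * M + 1) / (2 * q)) (by linarith)
    have b2 := abs_le.1 b
    nlinarith [mul_self_nonneg (Φ t)]
  have hsqa : AntitoneOn (fun t => Φ t * Φ t) (Set.Ici 0) := by
    apply antitoneOn_of_deriv_nonpos (convex_Ici 0)
    · exact hcont.mul hcont
    · intro t ht; rw [interior_Ici] at ht
      exact (hsq t ht).differentiableAt.differentiableWithinAt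
    · intro t ht; rw [interior_Ici] at ht
      rw [(hsq t ht).deriv]
      have := hgneg t ht
      linarith
  have hnn : ∀ t ≥ (0:ℝ), 0 ≤ Φ t := by
    intro t ht
    by_contra hneg
    push Not at hneg
    have : (0:ℝ) ∈ Φ '' Set.Icc 0 t := by
      apply intermediate_value_Icc' ht (hcont.mono Icc_subset_Ici_self)
      exact ⟨hneg.le, by rw [h0]; norm_num⟩
    obtain ⟨s, hs, hs0⟩ := this
    have := hsqa (show s ∈ Set.Ici 0 from hs.1) (show t ∈ Set.Ici 0 from ht) hs.2
    simp only [hs0] at this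
    nlinarith
  have hle : ∀ t ≥ (0:ℝ), Φ t ≤ 1 := by
    intro t ht
    have := hsqa (show (0:ℝ) ∈ Set.Ici 0 from self_mem_Ici) (show t ∈ Set.Ici 0 from ht) ht
    simp only [h0] at this
    nlinarith
  have hanti : AntitoneOn Φ (Set.Ici 0) := by
    intro s hs t ht hst
    have := hsqa hs ht hst
    simp only at this
    exact le_of_not_gt fun hlt => by nlinarith [hnn s hs, hnn t ht]
  -- integrability
  have hAΦ : ∀ T > (0:ℝ), IntervalIntegrable (fun x => A x * Φ x) volume 0 T := by
    intro T hT
    apply (hAint T hT).mul_continuousOn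
    rw [uIcc_of_le hT.le]
    exact hcont.mono Icc_subset_Ici_self
  have hlim : ∃ L, Tendsto (deriv Φ) (nhdsWithin 0 (Set.Ioi 0)) (nhds L) := by
    have hc : ContinuousOn (fun s => ∫ x in s..1, A x * Φ x) (Set.uIcc 0 1) := by
      apply intervalIntegral.continuousOn_primitive_interval_left
      have := (hAΦ 1 one_pos)
      rwa [intervalIntegrable_iff_integrableOn_Icc_of_le zero_le_one, ← uIcc_of_le zero_le_one] at this
    refine ⟨deriv Φ 1 - ∫ x in (0:ℝ)..1, A x * Φ x, ?_⟩
    have hc0 : Tendsto (fun s => ∫ x in s..1, A x * Φ x) (nhdsWithin 0 (Set.Ioi 0))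
        (nhds (∫ x in (0:ℝ)..1, A x * Φ x)) := by
      have := hc 0 (by simp)
      rw [uIcc_of_le zero_le_one] at this
      have h2 := this.mono (Ioo_subset_Icc_self)
      unfold ContinuousWithinAt at h2
      rwa [nhdsWithin_Ioo_eq_nhdsGT one_pos] at h2
    refine (hc0.const_sub (deriv Φ 1)).congr' ?_
    filter_upwards [Ioo_mem_nhdsGT (show (0:ℝ) < 1 from one_pos)] with s hs
    rw [intervalIntegral.integral_eq_sub_of_hasDerivAt (f := deriv Φ)]
    · ring
    · intro x hx
      rw [uIcc_of_le hs.2.le] at hx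
      exact hdd x (lt_of_lt_of_le hs.1 hx.1)
    · apply (hAΦ 1 one_pos).mono_set
      rw [uIcc_of_le hs.2.le, uIcc_of_le zero_le_one]
      exact Icc_subset_Icc_left hs.1.le
  obtain ⟨L, hL⟩ := hlim
  have hD0 : HasDerivWithinAt Φ L (Set.Ici 0) 0 := by
    apply hasDerivWithinAt_Ici_of_tendsto_deriv (s := Set.Ioi 0)
    · intro x hx; exact (hd x hx).differentiableWithinAt
    · exact (hcont 0 self_mem_Ici).mono Ioi_subset_Ici_self
    · exact self_mem_nhdsWithin
    · exact hL
  have hDe0 : derivWithin Φ (Set.Ici 0) 0 = L := hD0.derivWithin (uniqueDiffWithinAt_Ici 0)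
  have hDe : ∀ t > (0:ℝ), derivWithin Φ (Set.Ici 0) t = deriv Φ t := fun t ht =>
    derivWithin_of_mem_nhds (Ici_mem_nhds ht)
  have hDev : ∀ t > (0:ℝ), derivWithin Φ (Set.Ici 0) =ᶠ[nhds t] deriv Φ := by
    intro t ht
    filter_upwards [Ioi_mem_nhds ht] with s hs using hDe s hs
  have hDd : ∀ t > (0:ℝ), HasDerivAt (derivWithin Φ (Set.Ici 0)) (A t * Φ t) t := fun t ht =>
    (hdd t ht).congr_of_eventuallyEq (hDev t ht)
  have hDc : ContinuousOn (derivWithin Φ (Set.Ici 0)) (Set.Ici 0) := by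
    intro t ht
    rcases eq_or_lt_of_le (show (0:ℝ) ≤ t from ht) with rfl | hpos
    · rw [← continuousWithinAt_Ioi_iff_Ici]
      unfold ContinuousWithinAt
      rw [hDe0]
      refine hL.congr' ?_
      filter_upwards [self_mem_nhdsWithin] with s hs using (hDe s hs).symm
    · exact (hDd t hpos).continuousAt.continuousWithinAt
  have hDm : MonotoneOn (derivWithin Φ (Set.Ici 0)) (Set.Ici 0) := by
    apply monotoneOn_of_deriv_nonneg (convex_Ici 0) hDc
    · intro t ht; rw [interior_Ici] at ht
      exact (hDd t ht).differentiableAt.differentiableWithinAt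
    · intro t ht; rw [interior_Ici] at ht
      rw [(hDd t ht).deriv]
      exact mul_nonneg (hA t ht).le (hnn t (le_of_lt ht))
  have hDn : ∀ t ≥ (0:ℝ), derivWithin Φ (Set.Ici 0) t ≤ 0 := fun t _ => hanti.derivWithin_nonpos
  refine ⟨fun t ht => ⟨hnn t ht, hle t ht⟩, hDc, fun t ht => ?_, hDd, hDn, hDm, ?_⟩
  · rw [hDe t ht]; exact hd' t ht
  · intro T hT
    rw [abs_of_nonpos (hDn T hT.le), le_div_iff₀ hT]
    have : Φ T - Φ 0 ≤ derivWithin Φ (Set.Ici 0) T * (T - 0) := by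
      refine Convex.image_sub_le_mul_sub_of_deriv_le (convex_Icc 0 T) (hcont.mono Icc_subset_Ici_self) ?_ ?_ 0 ⟨le_rfl, hT.le⟩ T ⟨hT.le, le_rfl⟩ hT.le
      · intro x hx; rw [interior_Icc] at hx
        exact (hd x hx.1).differentiableWithinAt
      · intro x hx; rw [interior_Icc] at hx
        rw [← hDe x hx.1]
        exact hDm (show x ∈ Set.Ici 0 from hx.1.le) (show T ∈ Set.Ici 0 from hT.le) hx.2.le
    have := hnn T hT.le
    linarith

/-- Wronskian comparison of the derivatives at zero. -/
theorem sl_wronskian (A B Φ Ψ : ℝ → ℝ) (hA : ∀ t > (0:ℝ), 0 < A t) (hB : ∀ t > (0:ℝ), 0 < B t)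
    (hiA : ∀ T > (0:ℝ), IntervalIntegrable A volume 0 T)
    (hiB : ∀ T > (0:ℝ), IntervalIntegrable B volume 0 T) (hΦ : IsSL A Φ) (hΨ : IsSL B Ψ)
    (T : ℝ) (hT : 0 < T) :
    |derivWithin Φ (Set.Ici 0) 0 - derivWithin Ψ (Set.Ici 0) 0| ≤
      2 / T + ∫ x in (0:ℝ)..T, |A x - B x| := by
  obtain ⟨a1, a2, a3, a4, a5, a6, a7⟩ := sl_aux A Φ hA hiA hΦ
  obtain ⟨b1, b2, b3, b4, b5, b6, b7⟩ := sl_aux B Ψ hB hiB hΨ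
  have cΦ := hΦ.1
  have cΨ := hΨ.1
  have Φ0 := hΦ.2.2.1
  have Ψ0 := hΨ.2.2.1
  set D := derivWithin Φ (Set.Ici 0)
  set E := derivWithin Ψ (Set.Ici 0)
  have hsub : Set.Icc 0 T ⊆ Set.Ici (0:ℝ) := Icc_subset_Ici_self
  have hi : IntervalIntegrable (fun x => (A x - B x) * (Φ x * Ψ x)) volume 0 T := by
    apply ((hiA T hT).sub (hiB T hT)).mul_continuousOn
    rw [uIcc_of_le hT.le]
    exact (cΦ.mul cΨ).mono hsub
  have hF := intervalIntegral.integral_eq_sub_of_hasDerivAt_of_le hT.le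
    (f := fun x => D x * Ψ x - Φ x * E x) (f' := fun x => (A x - B x) * (Φ x * Ψ x))
    (((a2.mul cΨ).sub (cΦ.mul b2)).mono hsub)
    (fun x hx => by
      have := ((a4 x hx.1).mul (b3 x hx.1)).sub ((a3 x hx.1).mul (b4 x hx.1))
      exact this.congr_deriv (by ring)) hi
  simp only [Φ0, Ψ0] at hF
  have hb : |∫ x in (0:ℝ)..T, (A x - B x) * (Φ x * Ψ x)| ≤ ∫ x in (0:ℝ)..T, |A x - B x| := by
    refine (intervalIntegral.abs_integral_le_integral_abs hT.le).trans ?_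
    apply intervalIntegral.integral_mono_on hT.le hi.abs ((hiA T hT).sub (hiB T hT)).abs
    intro x hx
    rw [abs_mul]
    have h1 := a1 x hx.1
    have h2 := b1 x hx.1
    have h3 : |Φ x * Ψ x| ≤ 1 := by
      rw [abs_of_nonneg (mul_nonneg h1.1 h2.1)]
      exact mul_le_one₀ h1.2 h2.1 h2.2
    exact mul_le_of_le_one_right (abs_nonneg _) h3
  have e1 : |D T * Ψ T| ≤ 1 / T := by
    rw [abs_mul, abs_of_nonneg (b1 T hT.le).1]
    exact (mul_le_of_le_one_right (abs_nonneg _) (b1 T hT.le).2).trans (a7 T hT)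
  have e2 : |Φ T * E T| ≤ 1 / T := by
    rw [abs_mul, abs_of_nonneg (a1 T hT.le).1]
    exact (mul_le_of_le_one_left (abs_nonneg _) (a1 T hT.le).2).trans (b7 T hT)
  have e3 : 2 / T = 1 / T + 1 / T := by ring
  rw [e3]
  rw [abs_le] at *
  constructor <;> linarith [e1.1, e1.2, e2.1, e2.2, hb.1, hb.2]

/-- Modulus of continuity at zero of the derivative. -/
theorem sl_modulus (A G Φ : ℝ → ℝ) (hA : ∀ t > (0:ℝ), 0 < A t) (hAG : ∀ t > (0:ℝ), A t ≤ G t)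
    (hiA : ∀ T > (0:ℝ), IntervalIntegrable A volume 0 T)
    (hiG : ∀ T > (0:ℝ), IntervalIntegrable G volume 0 T) (hΦ : IsSL A Φ)
    (t : ℝ) (ht : 0 ≤ t) :
    |derivWithin Φ (Set.Ici 0) t - derivWithin Φ (Set.Ici 0) 0| ≤ ∫ x in (0:ℝ)..t, G x := by
  obtain ⟨a1, a2, a3, a4, a5, a6, a7⟩ := sl_aux A Φ hA hiA hΦ
  rcases eq_or_lt_of_le ht with rfl | hT
  · simp
  have hi : IntervalIntegrable (fun x => A x * Φ x) volume 0 t := by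
    apply (hiA t hT).mul_continuousOn
    rw [uIcc_of_le hT.le]
    exact hΦ.1.mono Icc_subset_Ici_self
  have hF := intervalIntegral.integral_eq_sub_of_hasDerivAt_of_le hT.le
    (f := derivWithin Φ (Set.Ici 0)) (f' := fun x => A x * Φ x)
    (a2.mono Icc_subset_Ici_self) (fun x hx => a4 x hx.1) hi
  rw [← hF, abs_of_nonneg]
  · apply intervalIntegral.integral_mono_on_of_le_Ioo hT.le hi (hiG t hT)
    intro x hx
    exact (mul_le_of_le_one_right (hA x hx.1).le (a1 x hx.1.le).2).trans (hAG x hx.1)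
  · rw [hF]
    have := a6 (show (0:ℝ) ∈ Set.Ici 0 from self_mem_Ici) (show t ∈ Set.Ici 0 from ht) ht
    linarith

theorem derivative_of_phi_lambda_tendsto_K
    (β c C : ℝ) (hβ : -1 < β) (hc : 0 < c) (hC : 0 < C)
    (p : ℝ → ℝ) (hpc : ContinuousOn p (Set.Ioi 0)) (hppos : ∀ u > (0:ℝ), 0 < p u)
    (hplim : Filter.Tendsto p Filter.atTop (nhds c))
    (hpbd₁ : β ≤ 0 → ∀ u > (0:ℝ), p u ≤ C)
    (hpbd₂ : 0 < β → ∀ u > (0:ℝ), p u ≤ C * (1 + u ^ (-β)))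
    (Φ₀ : ℝ → ℝ) (hΦ₀ : IsSL (fun t => c * t ^ β) Φ₀)
    (K : ℝ) (hK : K = |derivWithin Φ₀ (Set.Ici 0) 0|) :
    0 < K ∧
    ∀ ε > (0:ℝ), ∃ lam₁ > (0:ℝ), ∃ t₁ > (0:ℝ),
      ∀ lam : ℝ, 0 < lam → lam ≤ lam₁ → ∀ t : ℝ, 0 ≤ t → t ≤ t₁ →
        ∀ Φ : ℝ → ℝ, IsSL (fun u => u ^ β * p (u * lam ^ (-(1 / (β + 2))))) Φ →
          abs (|derivWithin Φ (Set.Ici 0) t| - K) ≤ ε := by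
  have hA0 : ∀ t > (0:ℝ), 0 < c * t ^ β := fun t ht => mul_pos hc (Real.rpow_pos_of_pos ht _)
  have hr : ∀ a b : ℝ, IntervalIntegrable (fun t : ℝ => t ^ β) volume a b :=
    fun a b => intervalIntegral.intervalIntegrable_rpow' hβ
  have hi0 : ∀ T > (0:ℝ), IntervalIntegrable (fun t => c * t ^ β) volume 0 T :=
    fun T _ => (hr 0 T).const_mul c
  have hGi : ∀ a b : ℝ, IntervalIntegrable (fun t : ℝ => C * (t ^ β + 1)) volume a b :=
    fun a b => ((hr a b).add (intervalIntegrable_const)).const_mul C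
  have hApos : ∀ lam : ℝ, 0 < lam → ∀ t > (0:ℝ), 0 < t ^ β * p (t * lam ^ (-(1 / (β + 2)))) := by
    intro lam hl t ht
    exact mul_pos (Real.rpow_pos_of_pos ht _) (hppos _ (mul_pos ht (Real.rpow_pos_of_pos hl _)))
  have hAG : ∀ lam : ℝ, 0 < lam → lam ≤ 1 → ∀ t > (0:ℝ),
      t ^ β * p (t * lam ^ (-(1 / (β + 2)))) ≤ C * (t ^ β + 1) := by
    intro lam hl hl1 t ht
    have htb := Real.rpow_pos_of_pos ht β
    have hlb := Real.rpow_pos_of_pos hl (-(1 / (β + 2)))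
    have hu : 0 < t * lam ^ (-(1 / (β + 2))) := mul_pos ht hlb
    rcases le_or_gt β 0 with hb | hb
    · have := hpbd₁ hb _ hu
      nlinarith [mul_le_mul_of_nonneg_left this htb.le]
    · have h1 := hpbd₂ hb _ hu
      have h2 := mul_le_mul_of_nonneg_left h1 htb.le
      refine h2.trans ?_
      have h3 : t ^ β * (t * lam ^ (-(1 / (β + 2)))) ^ (-β) ≤ 1 := by
        rw [Real.mul_rpow ht.le hlb.le, ← mul_assoc, ← Real.rpow_add ht, add_neg_cancel,
          Real.rpow_zero, one_mul, ← Real.rpow_mul hl.le]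
        apply Real.rpow_le_one hl.le hl1
        have : 0 ≤ 1 / (β + 2) := by positivity
        nlinarith
      nlinarith [mul_le_mul_of_nonneg_left h3 hC.le]
  have hAc : ∀ lam : ℝ, 0 < lam →
      ContinuousOn (fun t : ℝ => t ^ β * p (t * lam ^ (-(1 / (β + 2))))) (Set.Ioi 0) := by
    intro lam hl
    apply ContinuousOn.mul
    · intro t ht
      exact (Real.continuousAt_rpow_const t β (Or.inl (ne_of_gt ht))).continuousWithinAt
    · apply hpc.comp (by fun_prop)
      intro t ht
      exact mul_pos ht (Real.rpow_pos_of_pos hl _)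
  have hAm : ∀ lam : ℝ, 0 < lam → ∀ T > (0:ℝ), AEStronglyMeasurable
      (fun t : ℝ => t ^ β * p (t * lam ^ (-(1 / (β + 2))))) (volume.restrict (Set.uIoc 0 T)) := by
    intro lam hl T hT
    rw [uIoc_of_le hT.le]
    exact ((hAc lam hl).mono Ioc_subset_Ioi_self).aestronglyMeasurable measurableSet_Ioc
  have hiA : ∀ lam : ℝ, 0 < lam → lam ≤ 1 → ∀ T > (0:ℝ), IntervalIntegrable
      (fun t : ℝ => t ^ β * p (t * lam ^ (-(1 / (β + 2))))) volume 0 T := by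
    intro lam hl hl1 T hT
    refine (hGi 0 T).mono_fun (hAm lam hl T hT) ?_
    filter_upwards [ae_restrict_mem measurableSet_uIoc] with t ht
    rw [uIoc_of_le hT.le] at ht
    have h1 := hApos lam hl t ht.1
    have h2 := hAG lam hl hl1 t ht.1
    rw [Real.norm_of_nonneg h1.le, Real.norm_of_nonneg (h1.le.trans h2)]
    exact h2
  constructor
  · obtain ⟨a1, a2, a3, a4, a5, a6, a7⟩ := sl_aux _ Φ₀ hA0 hi0 hΦ₀
    rw [hK, abs_pos]
    intro h0
    have hz : ∀ t ≥ (0:ℝ), derivWithin Φ₀ (Set.Ici 0) t = 0 := by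
      intro t ht
      have := a6 (show (0:ℝ) ∈ Set.Ici 0 from self_mem_Ici) (show t ∈ Set.Ici 0 from ht) ht
      rw [h0] at this
      exact le_antisymm (a5 t ht) this
    have hΦ1 : ∀ t > (0:ℝ), Φ₀ t = 0 := by
      intro t ht
      have e : derivWithin Φ₀ (Set.Ici 0) =ᶠ[nhds t] fun _ => 0 := by
        filter_upwards [Ioi_mem_nhds ht] with s hs using hz s (le_of_lt hs)
      have := (a4 t ht).unique ((hasDerivAt_const t (0:ℝ)).congr_of_eventuallyEq e)
      exact (mul_eq_zero.1 this).resolve_left (hA0 t ht).ne'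
    have hc1 : Tendsto Φ₀ (nhdsWithin 0 (Set.Ioi 0)) (nhds 1) := by
      have := (hΦ₀.1 0 self_mem_Ici).mono Ioi_subset_Ici_self
      unfold ContinuousWithinAt at this
      rwa [hΦ₀.2.2.1] at this
    have hc2 : Tendsto Φ₀ (nhdsWithin 0 (Set.Ioi 0)) (nhds 0) := by
      refine tendsto_const_nhds.congr' ?_
      filter_upwards [self_mem_nhdsWithin] with s hs using (hΦ1 s hs).symm
    exact one_ne_zero (tendsto_nhds_unique hc1 hc2)
  intro ε hε
  set T : ℝ := 6 / ε with hTdef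
  have hT : 0 < T := by positivity
  have h2T : 2 / T = ε / 3 := by rw [hTdef]; field_simp; norm_num
  -- dominated convergence
  have hDC : Tendsto (fun lam : ℝ => ∫ x in (0:ℝ)..T,
      |x ^ β * p (x * lam ^ (-(1 / (β + 2)))) - c * x ^ β|) (nhdsWithin 0 (Set.Ioi 0))
      (nhds (∫ x in (0:ℝ)..T, (0:ℝ))) := by
    apply intervalIntegral.tendsto_integral_filter_of_dominated_convergence
      (fun x => C * (x ^ β + 1) + c * x ^ β)
    · filter_upwards [self_mem_nhdsWithin] with lam hl
      have := ((hAm lam hl T hT).sub (hi0 T hT).def'.aestronglyMeasurable).norm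
      exact this
    · filter_upwards [Ioo_mem_nhdsGT (show (0:ℝ) < 1 from one_pos)] with lam hl
      refine ae_of_all _ fun x hx => ?_
      rw [uIoc_of_le hT.le] at hx
      have h1 := hApos lam hl.1 x hx.1
      have h2 := hAG lam hl.1 hl.2.le x hx.1
      have h3 := hA0 x hx.1
      rw [Real.norm_eq_abs, abs_abs, abs_le]
      constructor <;> linarith
    · exact (hGi 0 T).add (hi0 T hT)
    · refine ae_of_all _ fun x hx => ?_
      rw [uIoc_of_le hT.le] at hx
      have hα : -(1 / (β + 2)) < 0 := by
        have : 0 < 1 / (β + 2) := by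
          apply one_div_pos.2; linarith
        linarith
      have h1 : Tendsto (fun lam : ℝ => lam ^ (-(1 / (β + 2)))) (nhdsWithin 0 (Set.Ioi 0)) atTop :=
        tendsto_rpow_neg_nhdsGT_zero hα
      have h2 := hplim.comp (h1.const_mul_atTop hx.1)
      have h3 := ((h2.const_mul (x ^ β)).sub_const (c * x ^ β)).abs
      have e : |x ^ β * c - c * x ^ β| = 0 := by rw [mul_comm, sub_self, abs_zero]
      rw [e] at h3
      exact h3
  rw [intervalIntegral.integral_zero] at hDC
  have hev := hDC.eventually (gt_mem_nhds (show (0:ℝ) < ε / 3 by positivity))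
  obtain ⟨δ, hδ, hδ'⟩ := mem_nhdsGT_iff_exists_Ioc_subset.1 hev
  have hGc : Continuous (fun t => ∫ x in (0:ℝ)..t, C * (x ^ β + 1)) :=
    intervalIntegral.continuous_primitive hGi 0
  have hG0 := (hGc.tendsto 0).eventually
    (gt_mem_nhds (show (∫ x in (0:ℝ)..0, C * (x ^ β + 1)) < ε / 3 by
      rw [intervalIntegral.integral_same]; positivity))
  obtain ⟨η, hη, hη'⟩ := Metric.eventually_nhds_iff.1 hG0
  refine ⟨min δ 1, lt_min hδ one_pos, η / 2, by positivity, ?_⟩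
  intro lam hl hl1 t ht ht1 Φ hΦ
  have hle1 : lam ≤ 1 := hl1.trans (min_le_right _ _)
  have w := sl_wronskian _ _ Φ Φ₀ (hApos lam hl) hA0 (hiA lam hl hle1) hi0 hΦ hΦ₀ T hT
  have m := sl_modulus _ (fun t : ℝ => C * (t ^ β + 1)) Φ (hApos lam hl) (hAG lam hl hle1)
    (hiA lam hl hle1) (fun T _ => hGi 0 T) hΦ t ht
  have k1 := hδ' ⟨hl, hl1.trans (min_le_left _ _)⟩
  have k2 := hη' (y := t) (by rw [Real.dist_eq, sub_zero, abs_of_nonneg ht]; linarith)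
  replace k1 : (∫ x in (0:ℝ)..T,
      |x ^ β * p (x * lam ^ (-(1 / (β + 2)))) - c * x ^ β|) < ε / 3 := k1
  rw [h2T] at w
  rw [hK]
  refine (abs_abs_sub_abs_le _ _).trans ?_
  have tri := abs_sub_le (derivWithin Φ (Set.Ici 0) t) (derivWithin Φ (Set.Ici 0) 0)
    (derivWithin Φ₀ (Set.Ici 0) 0)
  linarith
end
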